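/- arXiv:2301.00534 — 2 statements merged into one kernel-verified Lean document; each statement's English description precedes it below -/
import Mathlib

section
/- Let Λ be an Artin algebra of finite representation type, M a basic representation generator of mod-Λ, A = End_Λ(M) the Auslander algebra, and A̲ = A/P the stable Auslander algebra, where P is the two-sided ideal of all endomorphisms of M that factor through a projective Λ-module. Let S be a simple non-projective right A̲-module and let 0 → T → E → S → 0 be an almost split sequence in mod-A̲. Then exactly one of the following holds: (1) T is a projective A̲-module; (2) there exist a simple A̲-module S' and an injective envelope ι : S' → I in mod-A̲ (I injective and the image of ι essential in I) such that T ≅ Coker(ι), i.e. T is isomorphic to the first cosyzygy Ω^{-1}(S'). -/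
/-!
STATEMENT 14: Let Λ be an Artin algebra of finite representation type, M a basic
representation generator of mod-Λ, A = End_Λ(M), and A̲ = A/P the stable Auslander
algebra (P the ideal of endomorphisms factoring through a projective).  Let S be a
simple non-projective A̲-module and 0 → T → E → S → 0 an almost split sequence in
mod-A̲.  Then exactly one of the following holds: (1) T is projective; (2) there are
a simple A̲-module S' and an injective envelope ι : S' → I in mod-A̲ with
T ≅ Coker(ι) = Ω⁻¹(S').
-/

open DirectSum Function

namespace Statement14

variable (k : Type) [CommRing k]

/-- An indecomposable module. -/
def IndecMod (R V : Type) [Ring R] [AddCommGroup V] [Module R V] : Prop :=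
  Nontrivial V ∧ ∀ N₁ N₂ : Submodule R V, IsCompl N₁ N₂ → N₁ = ⊥ ∨ N₂ = ⊥

/-- A ring has finite representation type: there are finitely many f.g.
indecomposable modules up to isomorphism. -/
def FiniteRepType (R : Type) [Ring R] : Prop :=
  ∃ (n : ℕ) (rep : Fin n → ModuleCat.{0} R),
    ∀ (V : ModuleCat.{0} R), Module.Finite R V → IndecMod R V →
      ∃ i, Nonempty ((V : Type) ≃ₗ[R] (rep i : Type))

/-- `(i, p)` is an almost split sequence of finitely generated `R`-modules. -/
def IsAlmostSplitSeq (R : Type) [Ring R] {T B C : Type} [AddCommGroup T] [Module R T]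
    [AddCommGroup B] [Module R B] [AddCommGroup C] [Module R C]
    (i : T →ₗ[R] B) (p : B →ₗ[R] C) : Prop :=
  (Function.Injective i ∧ Function.Surjective p ∧ Function.Exact i p) ∧
  ¬ (∃ r : B →ₗ[R] T, r ∘ₗ i = LinearMap.id) ∧
  ¬ (∃ s : C →ₗ[R] B, p ∘ₗ s = LinearMap.id) ∧
  (∀ (Z : Type) [AddCommGroup Z] [Module R Z] [Module.Finite R Z],
    ∀ t : Z →ₗ[R] C, ¬ (∃ s : C →ₗ[R] Z, t ∘ₗ s = LinearMap.id) →
      ∃ l : Z →ₗ[R] B, p ∘ₗ l = t) ∧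
  (∀ (Z : Type) [AddCommGroup Z] [Module R Z] [Module.Finite R Z],
    ∀ t : T →ₗ[R] Z, ¬ (∃ r : Z →ₗ[R] T, r ∘ₗ t = LinearMap.id) →
      ∃ l : B →ₗ[R] Z, l ∘ₗ i = t)

/-- An endomorphism of `M` factors through a projective Λ-module. -/
def FactorsThroughProjective (Λ : Type) [Ring Λ] (M : Type) [AddCommGroup M] [Module Λ M]
    (φ : Module.End Λ M) : Prop :=
  ∃ (P₀ : ModuleCat.{0} Λ), Module.Projective Λ P₀ ∧
    ∃ (α : M →ₗ[Λ] P₀) (β : (P₀ : Type) →ₗ[Λ] M), β ∘ₗ α = φ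

section Dualizing

/-- A retract of an injective module is injective. -/
theorem injective_of_retract {R Q J : Type} [Ring R] [AddCommGroup Q] [Module R Q]
    [AddCommGroup J] [Module R J] (hQ : Module.Injective R Q) (j : J →ₗ[R] Q) (r : Q →ₗ[R] J)
    (h : ∀ x, r (j x) = x) : Module.Injective R J where
  out X Y _ _ _ _ f hf g := by
    obtain ⟨l, hl⟩ := hQ.out f hf (j ∘ₗ g)
    exact ⟨r ∘ₗ l, fun x => by simp [hl, h]⟩

/-- Every submodule of an injective module is contained in an injective submodule over which it
is essential. -/
theorem exists_injective_essential {R Q : Type} [Ring R] [AddCommGroup Q] [Module R Q]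
    (hQ : Module.Injective R Q) (B : Submodule R Q) :
    ∃ J : Submodule R Q, B ≤ J ∧ (∀ x ∈ J, x ≠ 0 → ∃ r : R, r • x ∈ B ∧ r • x ≠ 0) ∧
      Module.Injective R J := by
  obtain ⟨J, hBJ, hJ⟩ := zorn_le_nonempty₀
    {J : Submodule R Q | ∀ x ∈ J, x ≠ 0 → ∃ r : R, r • x ∈ B ∧ r • x ≠ 0}
    (fun c hc hchain y hy => ⟨sSup c, fun x hx hx0 => by
      obtain ⟨K, hK, hxK⟩ := (Submodule.mem_sSup_of_directed ⟨y, hy⟩ hchain.directedOn).1 hx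
      exact hc hK x hxK hx0, fun z hz => le_sSup hz⟩) B
    (fun x hx hx0 => ⟨1, by simpa using hx, by simpa using hx0⟩)
  obtain ⟨C, -, hC⟩ := zorn_le_nonempty₀
    {C : Submodule R Q | ∀ x ∈ C, x ∈ J → x = 0}
    (fun c hc hchain y hy => ⟨sSup c, fun x hx hxJ => by
      obtain ⟨K, hK, hxK⟩ := (Submodule.mem_sSup_of_directed ⟨y, hy⟩ hchain.directedOn).1 hx
      exact hc hK x hxK hxJ, fun z hz => le_sSup hz⟩) ⊥
    (fun x hx _ => by simpa using hx)
  have hinj : Injective (C.mkQ ∘ₗ J.subtype) := by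
    rw [← LinearMap.ker_eq_bot, LinearMap.ker_eq_bot']
    intro x hx
    have : (x : Q) ∈ C := by simpa using hx
    exact Subtype.ext (hC.prop _ this x.2)
  obtain ⟨ω, hω⟩ := hQ.out (C.mkQ ∘ₗ J.subtype) hinj J.subtype
  have hess : ∀ z : Q, z ∉ C → ∃ (r : R) (j : J), j ≠ 0 ∧ r • C.mkQ z = C.mkQ j := by
    intro z hz
    by_contra hcon
    push Not at hcon
    refine hz (hC.le_of_ge (y := C ⊔ Submodule.span R {z}) ?_ le_sup_left
      (Submodule.mem_sup_right (Submodule.mem_span_singleton_self z)))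
    intro x hx hxJ
    obtain ⟨c, hc, w, hw, rfl⟩ := Submodule.mem_sup.1 hx
    obtain ⟨r, rfl⟩ := Submodule.mem_span_singleton.1 hw
    by_contra h0
    refine hcon r ⟨_, hxJ⟩ (fun h => h0 (congrArg Subtype.val h)) ?_
    rw [← map_smul, eq_comm, ← sub_eq_zero, ← map_sub]
    simpa using hc
  have hωJ : LinearMap.range ω ≤ J := by
    refine hJ.le_of_ge ?_ ?_
    · rintro _ ⟨q, rfl⟩ hx
      obtain ⟨z, rfl⟩ := C.mkQ_surjective q
      have hz : z ∉ C := fun h => hx (by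
        have h0 : C.mkQ z = 0 := (Submodule.Quotient.mk_eq_zero C).2 h
        rw [h0, map_zero])
      obtain ⟨r, j, hj, hrj⟩ := hess z hz
      have h1 : r • ω (C.mkQ z) = j := by
        rw [← map_smul, hrj]; exact hω j
      obtain ⟨s, hs⟩ := hJ.prop j j.2 (fun h => hj (Subtype.ext h))
      exact ⟨s * r, by rwa [mul_smul, h1]⟩
    · intro x hx
      exact ⟨C.mkQ x, hω ⟨x, hx⟩⟩
  refine ⟨J, hBJ, hJ.prop, injective_of_retract hQ J.subtype
    ((ω ∘ₗ C.mkQ).codRestrict J fun x => hωJ ⟨_, rfl⟩) fun x => Subtype.ext (hω x)⟩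

/-- `J` is an injective `k`-module whose elements annihilated by a given maximal ideal form a
simple module. -/
class IsDualizing (k J : Type) [CommRing k] [AddCommGroup J] [Module k J] : Prop where
  injective : Module.Injective k J
  exists_ne_zero : ∀ m : Ideal k, m.IsMaximal → ∃ x : J, x ≠ 0 ∧ ∀ a ∈ m, a • x = 0
  mem_span : ∀ m : Ideal k, m.IsMaximal → ∀ x y : J, x ≠ 0 → (∀ a ∈ m, a • x = 0) →
    (∀ a ∈ m, a • y = 0) → ∃ c : k, y = c • x

theorem exists_isDualizing (k : Type) [CommRing k] [IsArtinianRing k] :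
    ∃ (J : Type) (_ : AddCommGroup J) (_ : Module k J), IsDualizing k J := by
  have hred : IsReduced (k ⧸ nilradical k) :=
    (Ideal.isRadical_iff_quotient_reduced _).1 (Ideal.radical_isRadical _)
  obtain ⟨Q, _, _, hQ, i, hi⟩ : ∃ (Q : Type) (_ : AddCommGroup Q) (_ : Module k Q)
      (_ : Module.Injective k Q) (i : (k ⧸ nilradical k) →ₗ[k] Q), Injective i := by
    let P := (CategoryTheory.EnoughInjectives.presentation (ModuleCat.of k (k ⧸ nilradical k))).some
    have := P.injective
    exact ⟨P.J, inferInstance, inferInstance,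
      Module.injective_module_of_injective_object k P.J, P.f.hom,
      (ModuleCat.mono_iff_injective _).1 P.mono⟩
  obtain ⟨J, hBJ, hess, hJ⟩ := exists_injective_essential hQ (LinearMap.range i)
  have hB : ∀ m : Ideal k, m.IsMaximal → ∀ x ∈ J, (∀ a ∈ m, a • x = 0) → ∃ b : k,
      x = i (Ideal.Quotient.mk _ b) := by
    intro m hm x hx hmx
    by_cases hx0 : x = 0
    · exact ⟨0, by simp [hx0]⟩
    obtain ⟨r, ⟨b, hb⟩, hr⟩ := hess x hx hx0
    have hrm : r ∉ m := fun h => hr (hmx r h)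
    obtain ⟨s, d, hd, hsd⟩ := hm.exists_inv hrm
    obtain ⟨b, rfl⟩ := Ideal.Quotient.mk_surjective b
    refine ⟨s * b, ?_⟩
    calc x = (s * r + d) • x := by rw [hsd, one_smul]
      _ = s • r • x := by rw [add_smul, hmx d hd, add_zero, mul_smul]
      _ = i (s • Ideal.Quotient.mk _ b) := by rw [← hb, map_smul]
  refine ⟨J, inferInstance, inferInstance, hJ, ?_, ?_⟩
  · intro m hm
    have : IsSemisimpleRing (k ⧸ nilradical k) :=
      IsArtinianRing.isSemisimpleRing_of_isReduced _
    obtain ⟨c, hc⟩ := exists_isCompl (m.map (Ideal.Quotient.mk (nilradical k)))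
    have hne : c ≠ ⊥ := by
      rintro rfl
      have h1 := hc.sup_eq_top
      rw [sup_bot_eq] at h1
      have h2 := congrArg (Ideal.comap (Ideal.Quotient.mk (nilradical k))) h1
      rw [Ideal.comap_map_of_surjective _ Ideal.Quotient.mk_surjective, ← RingHom.ker_eq_comap_bot,
        Ideal.mk_ker, sup_of_le_left (nilradical_le_prime m (H := hm.isPrime)), Ideal.comap_top] at h2
      exact hm.ne_top h2
    obtain ⟨x, hx, hx0⟩ := Submodule.exists_mem_ne_zero_of_ne_bot hne
    refine ⟨⟨i x, hBJ ⟨x, rfl⟩⟩, fun h => hx0 (hi ?_), fun a ha => Subtype.ext ?_⟩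
    · simpa using congrArg Subtype.val h
    · have : a • x = 0 := by
        have h1 : a • x = Ideal.Quotient.mk _ a * x := by
          rw [Algebra.smul_def]; rfl
        have h2 := hc.disjoint.le_bot (x := a • x) ⟨by
          rw [h1]; exact Ideal.mul_mem_right _ _ (Ideal.mem_map_of_mem _ ha), by
          rw [h1]; exact Ideal.mul_mem_left _ _ hx⟩
        simpa using h2
      simp [← map_smul, this]
  · intro m hm x y hx0 hx hy
    obtain ⟨a, ha⟩ := hB m hm x x.2 fun c hc => by simpa using congrArg Subtype.val (hx c hc)
    obtain ⟨b, hb⟩ := hB m hm y y.2 fun c hc => by simpa using congrArg Subtype.val (hy c hc)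
    have ham : a ∉ m := by
      intro h
      have h1 : i (a • Ideal.Quotient.mk _ a) = 0 := by
        rw [map_smul, ← ha]; simpa using congrArg Subtype.val (hx a h)
      have h2 : (Ideal.Quotient.mk (nilradical k) a) * (Ideal.Quotient.mk _ a) = 0 :=
        hi (by rw [map_zero, ← h1, Algebra.smul_def]; rfl)
      have h3 := IsReduced.eq_zero (Ideal.Quotient.mk (nilradical k) a) ⟨2, by rw [pow_two, h2]⟩
      exact hx0 (Subtype.ext (by rw [ha, h3, map_zero]; rfl))
    obtain ⟨s, d, hd, hsd⟩ := hm.exists_inv ham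
    refine ⟨s * b, ?_⟩
    have h4 : a • y = b • x := Subtype.ext (by
      rw [Submodule.coe_smul, Submodule.coe_smul, ha, hb, ← map_smul i, ← map_smul i]
      congr 1
      exact congrArg (Ideal.Quotient.mk (nilradical k)) (mul_comm a b))
    calc y = (s * a + d) • y := by rw [hsd, one_smul]
      _ = s • a • y := by rw [add_smul, hy d hd, add_zero, mul_smul]
      _ = (s * b) • x := by rw [h4, mul_smul]

end Dualizing

section Duality

variable {k J : Type} [CommRing k] [AddCommGroup J] [Module k J] [hJ : IsDualizing k J]
  {N N₁ N₂ : Type} [AddCommGroup N] [Module k N] [AddCommGroup N₁] [Module k N₁]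
  [AddCommGroup N₂] [Module k N₂]

theorem exists_functional_factor (g : N₁ →ₗ[k] N₂) (θ : N₁ →ₗ[k] J)
    (h : ∀ x, g x = 0 → θ x = 0) : ∃ θ' : N₂ →ₗ[k] J, ∀ x, θ' (g x) = θ x := by
  obtain ⟨l, hl⟩ := hJ.injective.out ((LinearMap.ker g).liftQ g le_rfl)
    (LinearMap.ker_eq_bot.1 (Submodule.ker_liftQ_eq_bot _ _ _ le_rfl))
    ((LinearMap.ker g).liftQ θ fun x hx => h x hx)
  exact ⟨l, fun x => hl (Submodule.Quotient.mk x)⟩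

theorem exists_functional_ne_zero (J : Type) [AddCommGroup J] [Module k J] [hJ : IsDualizing k J]
    {p : Submodule k N} {n : N} (hn : n ∉ p) :
    ∃ θ : N →ₗ[k] J, (∀ x ∈ p, θ x = 0) ∧ θ n ≠ 0 := by
  have hn' : p.mkQ n ≠ 0 := by simpa using hn
  have hI : Ideal.torsionOf k (N ⧸ p) (p.mkQ n) ≠ ⊤ := by
    rwa [Ne, Ideal.torsionOf_eq_top_iff]
  obtain ⟨m, hm, hle⟩ := Ideal.exists_le_maximal _ hI
  obtain ⟨x, hx0, hx⟩ := hJ.exists_ne_zero m hm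
  obtain ⟨θ, hθ⟩ := exists_functional_factor (LinearMap.toSpanSingleton k (N ⧸ p) (p.mkQ n))
    (LinearMap.toSpanSingleton k J x) fun c hc => hx c (hle hc)
  refine ⟨θ ∘ₗ p.mkQ, fun y hy => ?_, ?_⟩
  · have : p.mkQ y = 0 := by simpa using hy
    simp only [LinearMap.comp_apply, this, map_zero]
  · simpa [LinearMap.toSpanSingleton_apply] using (hθ 1).trans_ne (by simpa using hx0)

theorem exists_maximal_ann [IsSimpleModule k N] :
    ∃ (m : Ideal k) (n : N), m.IsMaximal ∧ (∀ a ∈ m, a • n = 0) ∧ ∀ x : N, ∃ c : k, x = c • n := by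
  obtain ⟨m, hm, ⟨e⟩⟩ := isSimpleModule_iff_quot_maximal.1 (inferInstance : IsSimpleModule k N)
  refine ⟨m, e.symm (Ideal.Quotient.mk m 1), hm, fun a ha => ?_, fun x => ?_⟩
  · rw [← map_smul, map_eq_zero_iff _ e.symm.injective]
    have : Ideal.Quotient.mk m a = 0 := Ideal.Quotient.eq_zero_iff_mem.2 ha
    rw [← this, Algebra.smul_def]; simp
  · obtain ⟨c, hc⟩ := Ideal.Quotient.mk_surjective (e x)
    refine ⟨c, ?_⟩
    rw [← map_smul, LinearEquiv.eq_symm_apply, ← hc, Algebra.smul_def]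
    simp

theorem eq_smul_of_isSimpleModule [IsSimpleModule k N] {θ₀ : N →ₗ[k] J} (h₀ : θ₀ ≠ 0)
    (θ : N →ₗ[k] J) : ∃ c : k, θ = c • θ₀ := by
  obtain ⟨m, n, hm, hmn, hn⟩ := exists_maximal_ann (k := k) (N := N)
  have hne : θ₀ n ≠ 0 := fun h => h₀ (LinearMap.ext fun x => by
    obtain ⟨c, rfl⟩ := hn x; simp [h])
  obtain ⟨c, hc⟩ := hJ.mem_span m hm (θ₀ n) (θ n) hne
    (fun a ha => by rw [← map_smul, hmn a ha, map_zero])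
    (fun a ha => by rw [← map_smul, hmn a ha, map_zero])
  refine ⟨c, LinearMap.ext fun x => ?_⟩
  obtain ⟨d, rfl⟩ := hn x
  rw [map_smul, hc, LinearMap.smul_apply, map_smul, smul_comm]

theorem exists_eval_of_isSimpleModule [IsSimpleModule k N] (φ : (N →ₗ[k] J) →ₗ[k] J) :
    ∃ n : N, ∀ θ, φ θ = θ n := by
  obtain ⟨m, n, hm, hmn, hn⟩ := exists_maximal_ann (k := k) (N := N)
  by_cases hz : ∀ θ : N →ₗ[k] J, θ = 0
  · exact ⟨0, fun θ => by simp [hz θ]⟩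
  push Not at hz
  obtain ⟨θ₀, h₀⟩ := hz
  have hne : θ₀ n ≠ 0 := fun h => h₀ (LinearMap.ext fun x => by
    obtain ⟨c, rfl⟩ := hn x; simp [h])
  have hm0 : ∀ a ∈ m, a • θ₀ = 0 := fun a ha => LinearMap.ext fun x => by
    obtain ⟨c, rfl⟩ := hn x
    rw [LinearMap.smul_apply, ← map_smul, smul_comm, hmn a ha]; simp
  obtain ⟨c, hc⟩ := hJ.mem_span m hm (θ₀ n) (φ θ₀) hne
    (fun a ha => by rw [← map_smul, hmn a ha, map_zero])
    (fun a ha => by rw [← map_smul, hm0 a ha, map_zero])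
  refine ⟨c • n, fun θ => ?_⟩
  obtain ⟨d, rfl⟩ := eq_smul_of_isSimpleModule h₀ θ
  rw [map_smul, hc, LinearMap.smul_apply, map_smul]

theorem isNoetherian_dual_of_isFiniteLength [IsNoetherianRing k] (h : IsFiniteLength k N) :
    IsNoetherian k (N →ₗ[k] J) := by
  induction h with
  | of_subsingleton =>
    rename_i N _ _ _
    have : Subsingleton (N →ₗ[k] J) := ⟨fun a b => LinearMap.ext fun x => by
      rw [Subsingleton.elim x 0]; simp⟩
    infer_instance
  | @of_simple_quotient N _ _ N' hs _ ih =>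
    have : IsNoetherian k ((N ⧸ N') →ₗ[k] J) := by
      by_cases hz : ∀ θ : (N ⧸ N') →ₗ[k] J, θ = 0
      · have : Subsingleton ((N ⧸ N') →ₗ[k] J) := ⟨fun a b => by rw [hz a, hz b]⟩
        infer_instance
      push Not at hz
      obtain ⟨θ₀, h₀⟩ := hz
      have hf : Module.Finite k ((N ⧸ N') →ₗ[k] J) := ⟨⟨{θ₀}, by
        rw [Finset.coe_singleton, eq_top_iff]
        intro θ _
        obtain ⟨c, rfl⟩ := eq_smul_of_isSimpleModule h₀ θ
        exact Submodule.smul_mem _ _ (Submodule.mem_span_singleton_self _)⟩⟩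
      infer_instance
    refine isNoetherian_of_range_eq_ker (LinearMap.lcomp k J N'.mkQ) (LinearMap.lcomp k J N'.subtype)
      ?_
    ext θ
    constructor
    · rintro ⟨θ', rfl⟩
      ext x
      have : N'.mkQ x = 0 := by simp
      exact (congrArg θ' this).trans (map_zero θ')
    · intro hθ
      refine ⟨N'.liftQ θ fun x hx => ?_, LinearMap.ext fun x => rfl⟩
      exact LinearMap.congr_fun hθ ⟨x, hx⟩

theorem exists_eval_of_isFiniteLength (h : IsFiniteLength k N) :
    ∀ φ : (N →ₗ[k] J) →ₗ[k] J, ∃ n : N, ∀ θ, φ θ = θ n := by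
  induction h with
  | of_subsingleton => exact fun φ => ⟨0, fun θ => by
      rw [show θ = 0 from LinearMap.ext fun x => by rw [Subsingleton.elim x 0]; simp]; simp⟩
  | @of_simple_quotient N _ _ N' hs _ ih =>
    intro φ
    obtain ⟨q, hq⟩ := exists_eval_of_isSimpleModule (φ ∘ₗ LinearMap.lcomp k J N'.mkQ)
    obtain ⟨n, rfl⟩ := N'.mkQ_surjective q
    obtain ⟨φ', hφ'⟩ := exists_functional_factor (LinearMap.lcomp k J N'.subtype)
      (φ - LinearMap.applyₗ n) fun θ hθ => by
        have h1 := hq (N'.liftQ θ fun x hx => LinearMap.congr_fun hθ ⟨x, hx⟩)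
        have h2 : LinearMap.lcomp k J N'.mkQ (N'.liftQ θ fun x hx =>
          LinearMap.congr_fun hθ ⟨x, hx⟩) = θ := rfl
        rw [LinearMap.comp_apply, h2] at h1
        exact sub_eq_zero.2 h1
    obtain ⟨n', hn'⟩ := ih φ'
    refine ⟨n + n', fun θ => ?_⟩
    have h3 := hφ' θ
    rw [hn'] at h3
    rw [map_add]
    simpa [eq_sub_iff_add_eq, add_comm, eq_comm] using h3

variable [IsArtinianRing k] [Module.Finite k N]

theorem isFiniteLength_of_finite : IsFiniteLength k N :=
  isFiniteLength_iff_isNoetherian_isArtinian.2 ⟨inferInstance, inferInstance⟩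

/-- Duals of finitely generated modules are finitely generated. -/
instance finite_dual : Module.Finite k (N →ₗ[k] J) :=
  have := isNoetherian_dual_of_isFiniteLength (J := J) (isFiniteLength_of_finite (k := k) (N := N))
  inferInstance

/-- Finitely generated modules are reflexive. -/
theorem exists_eval (φ : (N →ₗ[k] J) →ₗ[k] J) : ∃ n : N, ∀ θ, φ θ = θ n :=
  exists_eval_of_isFiniteLength isFiniteLength_of_finite φ

end Duality

section Separation

variable {k J : Type} [CommRing k] [AddCommGroup J] [Module k J]
  [hJ : IsDualizing k J]

theorem eq_of_forall_functional (J : Type) [AddCommGroup J] [Module k J] [IsDualizing k J]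
    {N : Type} [AddCommGroup N] [Module k N] {x y : N}
    (h : ∀ θ : N →ₗ[k] J, θ x = θ y) : x = y := by
  by_contra hne
  obtain ⟨θ, -, hθ⟩ := exists_functional_ne_zero J (p := (⊥ : Submodule k N)) (n := x - y)
    (by simpa [sub_eq_zero] using hne)
  exact hθ (by rw [map_sub, h, sub_self])

end Separation

section RightDual

variable {k J : Type} [CommRing k] [AddCommGroup J] [Module k J]

/-- The dual of a module `N` over a `k`-algebra, a module over the opposite algebra. -/
def RightDual (k J N : Type) [CommRing k] [AddCommGroup J] [Module k J] [AddCommGroup N]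
    [Module k N] : Type := N →ₗ[k] J

namespace RightDual

variable {R N : Type} [Ring R] [Algebra k R] [AddCommGroup N] [Module R N] [Module k N]

instance : AddCommGroup (RightDual k J N) := inferInstanceAs (AddCommGroup (N →ₗ[k] J))

/-- The underlying functional. -/
def toMap (θ : RightDual k J N) : N →ₗ[k] J := θ

/-- A functional as an element of the dual. -/
def ofMap (θ : N →ₗ[k] J) : RightDual k J N := θ

@[simp]
theorem toMap_ofMap (θ : N →ₗ[k] J) : (ofMap θ).toMap = θ := rfl

theorem ext {θ θ' : RightDual k J N} (h : ∀ x, θ.toMap x = θ'.toMap x) : θ = θ' :=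
  LinearMap.ext h

@[simp]
theorem toMap_add (θ θ' : RightDual k J N) : (θ + θ').toMap = θ.toMap + θ'.toMap := rfl

@[simp]
theorem toMap_zero : (0 : RightDual k J N).toMap = 0 := rfl

variable [IsScalarTower k R N]

instance : SMul Rᵐᵒᵖ (RightDual k J N) where
  smul r θ := ofMap
    { toFun := fun x => θ.toMap (r.unop • x)
      map_add' := fun x y => by rw [smul_add, map_add]
      map_smul' := fun c x => by rw [smul_comm, map_smul]; rfl }

@[simp]
theorem smul_apply (r : Rᵐᵒᵖ) (θ : RightDual k J N) (x : N) :
    (r • θ).toMap x = θ.toMap (r.unop • x) := rfl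

instance : Module Rᵐᵒᵖ (RightDual k J N) where
  one_smul θ := ext fun x => by simp
  mul_smul r s θ := ext fun x => by simp [mul_smul]
  smul_zero r := ext fun x => by simp
  smul_add r θ θ' := ext fun x => by simp
  add_smul r s θ := ext fun x => by simp [add_smul]
  zero_smul θ := ext fun x => by simp

end RightDual

/-- If the dual of a finitely generated module is injective, then the module is projective. -/
theorem projective_of_injective_dual [IsDualizing k J] [IsArtinianRing k] {R N : Type} [Ring R]
    [Algebra k R] [Module.Finite k R] [AddCommGroup N] [Module R N] [Module k N]
    [IsScalarTower k R N] [Module.Finite R N] (h : Module.Injective Rᵐᵒᵖ (RightDual k J N)) :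
    Module.Projective R N := by
  obtain ⟨m, ρ, hρ⟩ := Module.Finite.exists_fin' R N
  let ρ' : RightDual k J N →ₗ[Rᵐᵒᵖ] RightDual k J (Fin m → R) :=
    { toFun := fun θ => RightDual.ofMap (θ.toMap ∘ₗ ρ.restrictScalars k)
      map_add' := fun _ _ => rfl
      map_smul' := fun c θ => RightDual.ext fun x => by simp }
  have hρ' : Injective ρ' := fun θ θ' hθ => RightDual.ext fun x => by
    obtain ⟨y, rfl⟩ := hρ x
    exact LinearMap.congr_fun (congrArg RightDual.toMap hθ) y
  obtain ⟨σ, hσ⟩ := h.out ρ' hρ' LinearMap.id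
  have key : ∀ τ : N, ∃ n : Fin m → R, ∀ θ : (Fin m → R) →ₗ[k] J,
      (σ (RightDual.ofMap θ)).toMap τ = θ n := fun τ =>
    exists_eval (k := k)
      { toFun := fun θ => (σ (RightDual.ofMap θ)).toMap τ
        map_add' := fun θ θ' => by
          have : RightDual.ofMap (θ + θ') = RightDual.ofMap θ + RightDual.ofMap θ' := rfl
          rw [this, map_add]
          rfl
        map_smul' := fun c θ => by
          have h1 : RightDual.ofMap (c • θ) =
              MulOpposite.op (algebraMap k R c) • RightDual.ofMap θ :=
            RightDual.ext fun x => by simp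
          rw [h1, map_smul, RightDual.smul_apply]
          simp }
  choose s hs using key
  refine Module.Projective.of_split
    (i := { toFun := s, map_add' := fun x y => ?_, map_smul' := fun r x => ?_ }) ρ ?_
  · exact eq_of_forall_functional (k := k) J fun θ => by simp [← hs]
  · refine eq_of_forall_functional (k := k) J fun θ => ?_
    have h1 := hs x (MulOpposite.op r • RightDual.ofMap θ).toMap
    have h2 : RightDual.ofMap (MulOpposite.op r • RightDual.ofMap θ).toMap =
      MulOpposite.op r • RightDual.ofMap θ := rfl
    rw [h2, map_smul, RightDual.smul_apply, RightDual.smul_apply] at h1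
    simpa [← hs] using h1
  · refine LinearMap.ext fun x => eq_of_forall_functional (k := k) J fun θ => ?_
    have h1 := hs x (ρ' (RightDual.ofMap θ)).toMap
    have h2 : σ (RightDual.ofMap (ρ' (RightDual.ofMap θ)).toMap) = _ := hσ (RightDual.ofMap θ)
    rw [h2] at h1
    exact h1.symm

end RightDual


section Additive

variable {Λ : Type} [Ring Λ] (M : Type) [AddCommGroup M] [Module Λ M]

/-- `W` is a direct summand of a finite power of `M`. -/
def InAdd (Λ : Type) [Ring Λ] (M : Type) [AddCommGroup M] [Module Λ M]
    (W : Type) [AddCommGroup W] [Module Λ W] : Prop :=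
  ∃ (ι : Type) (_ : Fintype ι) (a : ι → W →ₗ[Λ] M) (b : ι → M →ₗ[Λ] W),
    ∑ j, b j ∘ₗ a j = LinearMap.id

variable {M} {W W' : Type} [AddCommGroup W] [Module Λ W] [AddCommGroup W'] [Module Λ W']

theorem InAdd.of_retract (h : InAdd Λ M W) (u : W' →ₗ[Λ] W) (v : W →ₗ[Λ] W')
    (hvu : v ∘ₗ u = LinearMap.id) : InAdd Λ M W' := by
  obtain ⟨ι, _, a, b, hab⟩ := h
  refine ⟨ι, inferInstance, fun j => a j ∘ₗ u, fun j => v ∘ₗ b j, ?_⟩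
  ext x
  have h1 := congrArg v (LinearMap.congr_fun hab (u x))
  have h2 := LinearMap.congr_fun hvu x
  simp only [LinearMap.sum_apply, LinearMap.comp_apply, LinearMap.id_apply, map_sum] at h1 h2 ⊢
  rw [h1, h2]

theorem InAdd.of_isCompl {N₁ N₂ : Submodule Λ W} (hc : IsCompl N₁ N₂) (h₁ : InAdd Λ M N₁)
    (h₂ : InAdd Λ M N₂) : InAdd Λ M W := by
  obtain ⟨ι₁, _, a₁, b₁, h₁⟩ := h₁
  obtain ⟨ι₂, _, a₂, b₂, h₂⟩ := h₂
  refine ⟨ι₁ ⊕ ι₂, inferInstance,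
    Sum.elim (fun j => a₁ j ∘ₗ N₁.projectionOnto N₂ hc)
      (fun j => a₂ j ∘ₗ N₂.projectionOnto N₁ hc.symm),
    Sum.elim (fun j => N₁.subtype ∘ₗ b₁ j) (fun j => N₂.subtype ∘ₗ b₂ j), ?_⟩
  ext x
  have e₁ := congrArg N₁.subtype (LinearMap.congr_fun h₁ (N₁.projectionOnto N₂ hc x))
  have e₂ := congrArg N₂.subtype (LinearMap.congr_fun h₂ (N₂.projectionOnto N₁ hc.symm x))
  simp only [LinearMap.sum_apply, LinearMap.comp_apply, LinearMap.id_apply, map_sum,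
    Fintype.sum_sum_type, Sum.elim_inl, Sum.elim_inr, LinearMap.add_apply] at e₁ e₂ ⊢
  rw [e₁, e₂]
  exact Submodule.projection_add_projection_eq_self hc x

/-- If every finitely generated indecomposable module is a summand of `M`, then every finitely
generated module is a summand of a power of `M`. -/
theorem inAdd_of_finite [IsArtinianRing Λ]
    (hM : ∀ (W : Type) [AddCommGroup W] [Module Λ W], Module.Finite Λ W → IndecMod Λ W →
      InAdd Λ M W) (W : Type) [AddCommGroup W] [Module Λ W] [Module.Finite Λ W] :
    InAdd Λ M W := by
  suffices h : ∀ N : Submodule Λ W, InAdd Λ M N from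
    (h ⊤).of_retract Submodule.topEquiv.symm.toLinearMap Submodule.topEquiv.toLinearMap
      (by ext; simp)
  intro N
  induction N using IsWellFounded.induction (α := Submodule Λ W) (· < ·) with
  | ind N ih =>
  by_cases hN : IndecMod Λ N
  · exact hM N inferInstance hN
  by_cases hbot : Nontrivial N
  swap
  · have := not_nontrivial_iff_subsingleton.1 hbot
    exact ⟨PEmpty, inferInstance, fun j => j.elim, fun j => j.elim,
      LinearMap.ext fun x => Subsingleton.elim _ _⟩
  have hN' : ¬ ∀ N₁ N₂ : Submodule Λ N, IsCompl N₁ N₂ → N₁ = ⊥ ∨ N₂ = ⊥ := fun h => hN ⟨hbot, h⟩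
  push Not at hN'
  obtain ⟨N₁, N₂, hc, h₁, h₂⟩ := hN'
  have aux : ∀ P : Submodule Λ N, P ≠ ⊤ → InAdd Λ M P := by
    intro P hP
    let e := P.equivMapOfInjective N.subtype N.injective_subtype
    refine (ih (P.map N.subtype) ?_).of_retract e.toLinearMap e.symm.toLinearMap (by ext; simp)
    refine lt_of_le_of_ne (Submodule.map_subtype_le N P) fun h => hP ?_
    rw [eq_top_iff]
    rintro x -
    have : (x : W) ∈ P.map N.subtype := by rw [h]; exact x.2
    obtain ⟨y, hy, hyx⟩ := this
    rwa [← N.injective_subtype hyx]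
  refine InAdd.of_isCompl hc (aux _ fun h => h₂ ?_) (aux _ fun h => h₁ ?_)
  · simpa [h] using hc.inf_eq_bot
  · simpa [h] using hc.inf_eq_bot

end Additive

section ProjMaps

variable {k Λ : Type} [CommRing k] [Ring Λ] [Algebra k Λ]
  {W W' W'' : Type} [AddCommGroup W] [Module Λ W]
  [AddCommGroup W'] [Module Λ W'] [Module k W'] [IsScalarTower k Λ W']
  [AddCommGroup W''] [Module Λ W''] [Module k W''] [IsScalarTower k Λ W'']

variable (k Λ) in
/-- The maps which factor through a finitely generated free module. -/
def projMaps (W W' : Type) [AddCommGroup W] [Module Λ W] [AddCommGroup W'] [Module Λ W']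
    [Module k W'] [IsScalarTower k Λ W'] : Submodule k (W →ₗ[Λ] W') where
  carrier := {w | ∃ (ι : Type) (_ : Fintype ι) (α : ι → W →ₗ[Λ] Λ) (β : ι → Λ →ₗ[Λ] W'),
    ∑ j, β j ∘ₗ α j = w}
  zero_mem' := ⟨PEmpty, inferInstance, fun j => j.elim, fun j => j.elim, by simp⟩
  add_mem' := by
    rintro _ _ ⟨ι, _, α, β, rfl⟩ ⟨ι', _, α', β', rfl⟩
    exact ⟨ι ⊕ ι', inferInstance, Sum.elim α α', Sum.elim β β', by simp⟩
  smul_mem' := by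
    rintro c _ ⟨ι, _, α, β, rfl⟩
    exact ⟨ι, inferInstance, α, fun j => c • β j, by
      rw [Finset.smul_sum]; rfl⟩

theorem comp_mem_projMaps {w : W →ₗ[Λ] W'} (hw : w ∈ projMaps k Λ W W') (v : W' →ₗ[Λ] W'') :
    v ∘ₗ w ∈ projMaps k Λ W W'' := by
  obtain ⟨ι, _, α, β, rfl⟩ := hw
  exact ⟨ι, inferInstance, α, fun j => v ∘ₗ β j, by ext; simp⟩

theorem mem_projMaps_comp {V : Type} [AddCommGroup V] [Module Λ V] {w : W →ₗ[Λ] W'}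
    (hw : w ∈ projMaps k Λ W W') (v : V →ₗ[Λ] W) :
    w ∘ₗ v ∈ projMaps k Λ V W' := by
  obtain ⟨ι, _, α, β, rfl⟩ := hw
  exact ⟨ι, inferInstance, fun j => α j ∘ₗ v, β, by ext; simp⟩

theorem exists_lift_of_mem_projMaps {w : W →ₗ[Λ] W'} (hw : w ∈ projMaps k Λ W W')
    {g : W'' →ₗ[Λ] W'} (hg : Surjective g) :
    ∃ w' ∈ projMaps k Λ W W'', g ∘ₗ w' = w := by
  obtain ⟨ι, _, α, β, rfl⟩ := hw
  choose β' hβ' using fun j => Module.projective_lifting_property g (β j) hg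
  refine ⟨∑ j, β' j ∘ₗ α j, ⟨ι, inferInstance, α, β', rfl⟩, ?_⟩
  ext x
  simp [← hβ']

theorem exists_fun_of_mem_projMaps {w : W →ₗ[Λ] W'} (hw : w ∈ projMaps k Λ W W') :
    ∃ (ι : Type) (_ : Fintype ι) (α : W →ₗ[Λ] ι → Λ) (β : (ι → Λ) →ₗ[Λ] W'), β ∘ₗ α = w := by
  obtain ⟨ι, _, α, β, rfl⟩ := hw
  exact ⟨ι, inferInstance, LinearMap.pi α, ∑ j, β j ∘ₗ LinearMap.proj j, by ext; simp⟩

variable (k) in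
theorem mem_projMaps_of_projective [Module.Finite Λ W'] {Q : Type} [AddCommGroup Q] [Module Λ Q]
    [Module.Projective Λ Q] (α : W →ₗ[Λ] Q) (β : Q →ₗ[Λ] W') : β ∘ₗ α ∈ projMaps k Λ W W' := by
  obtain ⟨m, ρ, hρ⟩ := Module.Finite.exists_fin' Λ W'
  obtain ⟨β', rfl⟩ := Module.projective_lifting_property ρ β hρ
  refine ⟨Fin m, inferInstance, fun j => LinearMap.proj j ∘ₗ β' ∘ₗ α,
    fun j => ρ ∘ₗ LinearMap.single Λ (fun _ => Λ) j, ?_⟩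
  ext x
  simp only [LinearMap.sum_apply, LinearMap.comp_apply, LinearMap.proj_apply, ← map_sum]
  congr 1
  exact Finset.univ_sum_single (β' (α x))

theorem finite_hom [IsArtinianRing k] [Module.Finite k Λ] [Module.Finite Λ W]
    [Module.Finite Λ W'] : Module.Finite k (W →ₗ[Λ] W') := by
  have : Module.Finite k W' := Module.Finite.trans Λ W'
  obtain ⟨m, ρ, hρ⟩ := Module.Finite.exists_fin' Λ W
  let E : (W →ₗ[Λ] W') →ₗ[k] (Fin m → W') :=
    { toFun := fun w j => w (ρ (Pi.single j 1))
      map_add' := fun _ _ => rfl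
      map_smul' := fun _ _ => rfl }
  refine Module.Finite.of_injective E fun w w' h => ?_
  have : w ∘ₗ ρ = w' ∘ₗ ρ := by
    refine LinearMap.pi_ext' fun j => LinearMap.ext_ring ?_
    exact congrFun h j
  refine LinearMap.ext fun x => ?_
  obtain ⟨y, rfl⟩ := hρ x
  exact LinearMap.congr_fun this y

end ProjMaps

/-- `π` presents `R` as the quotient of the endomorphism ring of `M` by the maps which factor
through a projective module. -/
class IsStableQuotient {k Λ M R : Type} [CommRing k] [Ring Λ] [Algebra k Λ]
    [AddCommGroup M] [Module Λ M] [Module k M] [IsScalarTower k Λ M]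
    [Ring R] [Algebra k R] (π : Module.End Λ M →ₐ[k] R) : Prop where
  surjective : Surjective π
  eq_zero_iff : ∀ a, π a = 0 ↔ a ∈ projMaps k Λ M M

section StableDual

variable {k Λ M R : Type} [CommRing k] [Ring Λ] [Algebra k Λ]
    [AddCommGroup M] [Module Λ M] [Module k M] [IsScalarTower k Λ M]
    [Ring R] [Algebra k R]

/-- The dual of the module of maps from `M` to `W` modulo the maps which factor through a projective
module. -/
structure StableDual (π : Module.End Λ M →ₐ[k] R) (J W : Type) [AddCommGroup J] [Module k J]
    [AddCommGroup W] [Module Λ W] [Module k W] [IsScalarTower k Λ W] where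
  /-- The underlying functional. -/
  toMap : (M →ₗ[Λ] W) →ₗ[k] J
  eq_zero : ∀ h ∈ projMaps k Λ M W, toMap h = 0

namespace StableDual

variable {π : Module.End Λ M →ₐ[k] R} {J W W' : Type} [AddCommGroup J] [Module k J]
  [AddCommGroup W] [Module Λ W] [Module k W] [IsScalarTower k Λ W]
  [AddCommGroup W'] [Module Λ W'] [Module k W'] [IsScalarTower k Λ W']

theorem toMap_injective : Injective (toMap : StableDual π J W → _) := by
  rintro ⟨_, _⟩ ⟨_, _⟩ rfl
  rfl

theorem ext {θ θ' : StableDual π J W} (h : ∀ u, θ.toMap u = θ'.toMap u) : θ = θ' :=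
  toMap_injective (LinearMap.ext h)

instance : Zero (StableDual π J W) := ⟨⟨0, fun _ _ => rfl⟩⟩

instance : Add (StableDual π J W) :=
  ⟨fun θ θ' => ⟨θ.toMap + θ'.toMap, fun h hh => by simp [θ.eq_zero h hh, θ'.eq_zero h hh]⟩⟩

instance : Neg (StableDual π J W) := ⟨fun θ => ⟨-θ.toMap, fun h hh => by simp [θ.eq_zero h hh]⟩⟩

instance : Sub (StableDual π J W) :=
  ⟨fun θ θ' => ⟨θ.toMap - θ'.toMap, fun h hh => by simp [θ.eq_zero h hh, θ'.eq_zero h hh]⟩⟩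

instance {C : Type} [Monoid C] [DistribMulAction C J] [SMulCommClass k C J] :
    SMul C (StableDual π J W) :=
  ⟨fun c θ => ⟨c • θ.toMap, fun h hh => by simp [θ.eq_zero h hh]⟩⟩

instance : AddCommGroup (StableDual π J W) :=
  toMap_injective.addCommGroup toMap rfl (fun _ _ => rfl) (fun _ => rfl) (fun _ _ => rfl)
    (fun _ _ => rfl) (fun _ _ => rfl)

/-- The underlying functional, as an additive map. -/
def toMapHom : StableDual π J W →+ ((M →ₗ[Λ] W) →ₗ[k] J) where
  toFun := toMap
  map_zero' := rfl
  map_add' _ _ := rfl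

instance : Module k (StableDual π J W) :=
  toMap_injective.module k toMapHom fun _ _ => rfl

@[simp] theorem toMap_zero : (0 : StableDual π J W).toMap = 0 := rfl
@[simp] theorem toMap_add (θ θ' : StableDual π J W) : (θ + θ').toMap = θ.toMap + θ'.toMap := rfl
@[simp] theorem toMap_sub (θ θ' : StableDual π J W) : (θ - θ').toMap = θ.toMap - θ'.toMap := rfl
@[simp] theorem toMap_neg (θ : StableDual π J W) : (-θ).toMap = -θ.toMap := rfl
@[simp] theorem toMap_smul (c : k) (θ : StableDual π J W) : (c • θ).toMap = c • θ.toMap := rfl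

variable [hπ : IsStableQuotient π]

noncomputable instance : SMul R (StableDual π J W) where
  smul r θ :=
    { toMap :=
        { toFun := fun h => θ.toMap (h ∘ₗ surjInv hπ.surjective r)
          map_add' := fun h h' => by rw [LinearMap.add_comp, map_add]
          map_smul' := fun c h => by rw [LinearMap.smul_comp, map_smul]; rfl }
      eq_zero := fun h hh => θ.eq_zero _ (mem_projMaps_comp hh _) }

theorem toMap_mk_smul (a : Module.End Λ M) (θ : StableDual π J W) (h : M →ₗ[Λ] W) :
    (π a • θ).toMap h = θ.toMap (h ∘ₗ a) := by
  have h1 : surjInv hπ.surjective (π a) - a ∈ projMaps k Λ M M := by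
    rw [← hπ.eq_zero_iff, map_sub, surjInv_eq hπ.surjective, sub_self]
  have h2 := θ.eq_zero _ (comp_mem_projMaps h1 h)
  rw [LinearMap.comp_sub, map_sub, sub_eq_zero] at h2
  exact h2

noncomputable instance : Module R (StableDual π J W) where
  one_smul θ := ext fun h => by
    rw [← map_one π, toMap_mk_smul]; rfl
  mul_smul r s θ := ext fun h => by
    obtain ⟨a, rfl⟩ := hπ.surjective r
    obtain ⟨b, rfl⟩ := hπ.surjective s
    rw [← map_mul, toMap_mk_smul, toMap_mk_smul, toMap_mk_smul]; rfl
  smul_zero r := ext fun h => rfl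
  smul_add r θ θ' := ext fun h => rfl
  add_smul r s θ := ext fun h => by
    obtain ⟨a, rfl⟩ := hπ.surjective r
    obtain ⟨b, rfl⟩ := hπ.surjective s
    rw [← map_add, toMap_add, LinearMap.add_apply, toMap_mk_smul, toMap_mk_smul, toMap_mk_smul,
      LinearMap.comp_add, map_add]
  zero_smul θ := ext fun h => by
    rw [← map_zero π, toMap_mk_smul, LinearMap.comp_zero, map_zero]; rfl

instance : IsScalarTower k R (StableDual π J W) where
  smul_assoc c r θ := ext fun h => by
    obtain ⟨a, rfl⟩ := hπ.surjective r
    rw [← map_smul, toMap_mk_smul, toMap_smul, LinearMap.smul_apply, toMap_mk_smul, ← map_smul]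
    congr 1
    ext x
    simp [LinearMap.map_smul_of_tower]

/-- The functional as a linear map. -/
def toMapₗ : StableDual π J W →ₗ[k] ((M →ₗ[Λ] W) →ₗ[k] J) where
  toFun := toMap
  map_add' _ _ := rfl
  map_smul' _ _ := rfl

instance [IsDualizing k J] [IsArtinianRing k] [Module.Finite k Λ] [Module.Finite Λ M]
    [Module.Finite Λ W] : Module.Finite R (StableDual π J W) := by
  have : Module.Finite k (M →ₗ[Λ] W) := finite_hom
  have : Module.Finite k (StableDual π J W) :=
    Module.Finite.of_injective (toMapₗ (π := π)) toMap_injective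
  exact Module.Finite.of_restrictScalars_finite k R _

variable (π J) in
/-- The contravariant functoriality of the stable dual. -/
def map (w : W →ₗ[Λ] W') : StableDual π J W' →ₗ[R] StableDual π J W where
  toFun θ :=
    { toMap :=
        { toFun := fun h => θ.toMap (w ∘ₗ h)
          map_add' := fun h h' => by rw [LinearMap.comp_add, map_add]
          map_smul' := fun c h => by
            rw [RingHom.id_apply, ← map_smul]; congr 1; ext x
            simp [LinearMap.map_smul_of_tower] }
      eq_zero := fun h hh => θ.eq_zero _ (comp_mem_projMaps hh _) }
  map_add' _ _ := rfl
  map_smul' r θ := ext fun h => by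
    obtain ⟨a, rfl⟩ := hπ.surjective r
    rw [RingHom.id_apply, toMap_mk_smul]
    exact toMap_mk_smul _ _ _

@[simp]
theorem toMap_map (w : W →ₗ[Λ] W') (θ : StableDual π J W') (h : M →ₗ[Λ] W) :
    (map π J w θ).toMap h = θ.toMap (w ∘ₗ h) := rfl

theorem map_eq_zero {w : W →ₗ[Λ] W'} (hw : w ∈ projMaps k Λ W W') : map π J w = 0 :=
  LinearMap.ext fun θ => ext fun h => θ.eq_zero _ (mem_projMaps_comp hw h)

theorem map_comp {W'' : Type} [AddCommGroup W''] [Module Λ W''] [Module k W'']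
    [IsScalarTower k Λ W''] (w' : W' →ₗ[Λ] W'') (w : W →ₗ[Λ] W') :
    map π J (w' ∘ₗ w) = map π J w ∘ₗ map π J w' := rfl

theorem map_id : map π J (LinearMap.id : W →ₗ[Λ] W) = LinearMap.id := rfl

theorem map_add (w w' : W →ₗ[Λ] W') : map π J (w + w') = map π J w + map π J w' :=
  LinearMap.ext fun θ => ext fun h => by simp [LinearMap.add_comp]

theorem map_sub (w w' : W →ₗ[Λ] W') : map π J (w - w') = map π J w - map π J w' :=
  LinearMap.ext fun θ => ext fun h => by simp [LinearMap.sub_comp]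

section Coordinates

variable {ι : Type} [Fintype ι] (a : ι → W →ₗ[Λ] M) {N : Type} [AddCommGroup N] [Module R N] [Module k N] [IsScalarTower k R N]

variable (π) in
/-- The map into a stable dual with the given coordinates. -/
def lift (l : ι → N →ₗ[k] J) : N →ₗ[R] StableDual π J W where
  toFun n :=
    { toMap :=
        { toFun := fun h => ∑ j, l j (π (a j ∘ₗ h) • n)
          map_add' := fun h h' => by
            simp only [LinearMap.comp_add, _root_.map_add, add_smul, Finset.sum_add_distrib]
          map_smul' := fun c h => by
            have : ∀ j, a j ∘ₗ (c • h) = c • (a j ∘ₗ h : Module.End Λ M) := fun j => by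
              ext x; simp [LinearMap.map_smul_of_tower]
            simp only [this, map_smul, smul_assoc, Finset.smul_sum, RingHom.id_apply] }
      eq_zero := fun h hh => Finset.sum_eq_zero fun j _ => by
        rw [(hπ.eq_zero_iff _).2 (comp_mem_projMaps hh _), zero_smul, map_zero] }
  map_add' n n' := ext fun h => by
    simp [smul_add, Finset.sum_add_distrib]
  map_smul' r n := ext fun h => by
    obtain ⟨c, rfl⟩ := hπ.surjective r
    rw [RingHom.id_apply, toMap_mk_smul]
    refine Finset.sum_congr rfl fun j _ => ?_
    rw [smul_smul, ← map_mul]; rfl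

theorem toMap_lift (l : ι → N →ₗ[k] J) (n : N) (h : M →ₗ[Λ] W) :
    (lift π a l n).toMap h = ∑ j, l j (π (a j ∘ₗ h) • n) := rfl

end Coordinates

theorem toMap_eq_sum {ι : Type} [Fintype ι] {a : ι → W →ₗ[Λ] M} {b : ι → M →ₗ[Λ] W}
    (hab : ∑ j, b j ∘ₗ a j = LinearMap.id) {N : Type} [AddCommGroup N] [Module R N] (φ : N →ₗ[R] StableDual π J W) (n : N) (h : M →ₗ[Λ] W) :
    (φ n).toMap h = ∑ j, (φ (π (a j ∘ₗ h) • n)).toMap (b j) := by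
  have h1 : h = ∑ j, b j ∘ₗ a j ∘ₗ h := by
    conv_lhs => rw [← LinearMap.id_comp h, ← hab]
    ext x; simp
  conv_lhs => rw [h1]
  rw [_root_.map_sum]
  refine Finset.sum_congr rfl fun j _ => ?_
  rw [map_smul, toMap_mk_smul]

variable [hJ : IsDualizing k J]

theorem injective_of_inAdd (hW : InAdd Λ M W) : Module.Injective R (StableDual π J W) where
  out N' N _ _ _ _ f hf g := by
    obtain ⟨ι, _, a, b, hab⟩ := hW
    let _ : Module k N' := Module.compHom N' (algebraMap k R)
    let _ : Module k N := Module.compHom N (algebraMap k R)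
    have : IsScalarTower k R N' := ⟨fun c r x => by
      rw [Algebra.smul_def, mul_smul]; rfl⟩
    have : IsScalarTower k R N := ⟨fun c r x => by
      rw [Algebra.smul_def, mul_smul]; rfl⟩
    let l : ι → N' →ₗ[k] J := fun j =>
      (LinearMap.applyₗ (b j) ∘ₗ toMapₗ (π := π)) ∘ₗ g.restrictScalars k
    choose l' hl' using fun j => hJ.injective.out (f.restrictScalars k) hf (l j)
    refine ⟨lift π a l', fun n => ext fun h => ?_⟩
    rw [toMap_eq_sum hab g, toMap_lift]
    refine Finset.sum_congr rfl fun j _ => ?_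
    rw [← map_smul]
    exact hl' j _

theorem exists_eq_map [IsArtinianRing k] [Module.Finite k Λ] [Module.Finite Λ M]
    [Module.Finite Λ W] (hW : InAdd Λ M W') (φ : StableDual π J W →ₗ[R] StableDual π J W') :
    ∃ w : W' →ₗ[Λ] W, φ = map π J w := by
  obtain ⟨ι, _, a, b, hab⟩ := hW
  have : Module.Finite k (M →ₗ[Λ] W) := finite_hom
  have key : ∀ j, ∃ c : M →ₗ[Λ] W, ∀ θ, (φ θ).toMap (b j) = θ.toMap c := fun j => by
    obtain ⟨l, hl⟩ := hJ.injective.out (toMapₗ (π := π) (J := J) (W := W)) toMap_injective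
      ((LinearMap.applyₗ (b j) ∘ₗ toMapₗ (π := π)) ∘ₗ φ.restrictScalars k)
    obtain ⟨c, hc⟩ := exists_eval l
    exact ⟨c, fun θ => (hl θ).symm.trans (hc _)⟩
  choose c hc using key
  refine ⟨∑ j, c j ∘ₗ a j, LinearMap.ext fun θ => ext fun h => ?_⟩
  rw [toMap_eq_sum hab φ, toMap_map]
  have h1 : (∑ j, c j ∘ₗ a j) ∘ₗ h = ∑ j, c j ∘ₗ a j ∘ₗ h := by ext x; simp
  rw [h1, _root_.map_sum]
  refine Finset.sum_congr rfl fun j _ => ?_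
  rw [hc, toMap_mk_smul]

theorem mem_projMaps_of_map_eq_zero {w : W →ₗ[Λ] W'} (hW : InAdd Λ M W) (hw : map π J w = 0) :
    w ∈ projMaps k Λ W W' := by
  obtain ⟨ι, _, a, b, hab⟩ := hW
  have h1 : w = ∑ j, (w ∘ₗ b j) ∘ₗ a j := by
    conv_lhs => rw [← LinearMap.comp_id w, ← hab]
    ext x; simp
  rw [h1]
  refine Submodule.sum_mem _ fun j _ => mem_projMaps_comp ?_ _
  by_contra hcon
  obtain ⟨θ, hθ, hne⟩ := exists_functional_ne_zero J hcon
  exact hne (congrArg (fun t => t.toMap (b j))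
    (LinearMap.congr_fun hw (⟨θ, hθ⟩ : StableDual π J W')))

end StableDual

end StableDual

section General

variable {R : Type} [Ring R]

theorem exists_comp_eq_of_surjective {N N₁ N₂ : Type} [AddCommGroup N] [Module R N]
    [AddCommGroup N₁] [Module R N₁] [AddCommGroup N₂] [Module R N₂] {p : N →ₗ[R] N₁}
    (hp : Surjective p) (g : N →ₗ[R] N₂) (h : ∀ x, p x = 0 → g x = 0) :
    ∃ s : N₁ →ₗ[R] N₂, s ∘ₗ p = g := by
  refine ⟨(LinearMap.ker p).liftQ g h ∘ₗ (p.quotKerEquivOfSurjective hp).symm.toLinearMap,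
    LinearMap.ext fun x => ?_⟩
  have : (p.quotKerEquivOfSurjective hp).symm (p x) = Submodule.Quotient.mk x := by
    rw [LinearEquiv.symm_apply_eq]; rfl
  simp only [LinearMap.comp_apply, LinearEquiv.coe_coe, this]
  exact Submodule.liftQ_apply _ _ _

/-- Fitting's lemma for an indecomposable module. -/
theorem IndecMod.bijective {X : Type} [AddCommGroup X] [Module R X] [IsArtinian R X]
    [IsNoetherian R X] (hX : IndecMod R X) {c : Module.End R X} (hc : ∀ n, c ^ n ≠ 0) :
    Bijective c := by
  obtain ⟨n, hn⟩ := (c.eventually_isCompl_ker_pow_range_pow.and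
    (Filter.eventually_ge_atTop 1)).exists
  rcases hX.2 _ _ hn.1 with h | h
  · refine IsArtinian.bijective_of_injective_endomorphism c ?_
    have h1 : Injective ⇑(c ^ n) := LinearMap.ker_eq_bot.1 h
    obtain ⟨m, rfl⟩ := Nat.exists_eq_add_of_le' hn.2
    rw [pow_succ] at h1
    exact Injective.of_comp (f := ⇑(c ^ m)) h1
  · exact absurd (LinearMap.range_eq_bot.1 h) (hc n)

/-- `f` is not a split monomorphism, and every map from its source to a finitely generated module
which is not a split monomorphism factors through `f`. -/
structure IsLeftAlmostSplit {X Y : Type} [AddCommGroup X] [Module R X] [AddCommGroup Y]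
    [Module R Y] (f : X →ₗ[R] Y) : Prop where
  not_split : ¬ ∃ r : Y →ₗ[R] X, r ∘ₗ f = LinearMap.id
  factor : ∀ {W : Type} [AddCommGroup W] [Module R W] [Module.Finite R W] (g : X →ₗ[R] W),
    (¬ ∃ r : W →ₗ[R] X, r ∘ₗ g = LinearMap.id) → ∃ g' : Y →ₗ[R] W, g' ∘ₗ f = g

/-- Every finitely generated module is a summand of a power of the finitely generated module
`M`. -/
class IsGenerator (Λ M : Type) [Ring Λ] [AddCommGroup M] [Module Λ M] : Prop where
  finite : Module.Finite Λ M
  inAdd : ∀ (W : Type) [AddCommGroup W] [Module Λ W] [Module.Finite Λ W], InAdd Λ M W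

end General

section AlmostSplit

variable {k Λ M R : Type} [CommRing k] [Ring Λ] [Algebra k Λ]
    [AddCommGroup M] [Module Λ M] [Module k M] [IsScalarTower k Λ M]
    [Ring R] [Algebra k R] {π : Module.End Λ M →ₐ[k] R}
    {X S : Type} [AddCommGroup X] [Module Λ X] [AddCommGroup S] [Module R S]

theorem mk_comp_smul (π : Module.End Λ M →ₐ[k] R) (a b : M →ₗ[Λ] M) (n : S) :
    π (a ∘ₗ b) • n = π a • π b • n := by
  rw [smul_smul, ← map_mul]; rfl

theorem mk_sum_smul (π : Module.End Λ M →ₐ[k] R) {ι : Type} [Fintype ι]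
    (a : ι → M →ₗ[Λ] M) (n : S) : π (∑ j, a j) • n = ∑ j, π (a j) • n := by
  rw [map_sum, Finset.sum_smul]

theorem smul_eq_zero_of_not_split [hπ : IsStableQuotient π] [IsArtinian Λ X] [IsNoetherian Λ X]
    (hX : IndecMod Λ X) [IsSimpleModule R S] {u : X →ₗ[Λ] M} {v : M →ₗ[Λ] X}
    (hvu : v ∘ₗ u = LinearMap.id) {x : S} (hx : x ≠ 0) (hux : π (u ∘ₗ v) • x = x)
    (φ : X →ₗ[Λ] M) (hφ : ¬ ∃ r : M →ₗ[Λ] X, r ∘ₗ φ = LinearMap.id) : π (φ ∘ₗ v) • x = 0 := by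
  by_contra hy
  obtain ⟨r, hr⟩ := IsSimpleModule.toSpanSingleton_surjective R hy x
  obtain ⟨a, rfl⟩ := hπ.surjective r
  rw [LinearMap.toSpanSingleton_apply] at hr
  let c : Module.End Λ X := v ∘ₗ a ∘ₗ φ
  have hc1 : π (u ∘ₗ c ∘ₗ v) • x = x := by
    have : u ∘ₗ c ∘ₗ v = (u ∘ₗ v) ∘ₗ a ∘ₗ (φ ∘ₗ v) := rfl
    rw [this, mk_comp_smul, mk_comp_smul, hr, hux]
  have hc : ∀ n : ℕ, π (u ∘ₗ (c ^ n : Module.End Λ X) ∘ₗ v) • x = x := by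
    intro n
    induction n with
    | zero => exact hux
    | succ n ih =>
      have : u ∘ₗ (c ^ (n + 1) : Module.End Λ X) ∘ₗ v =
          (u ∘ₗ (c ^ n : Module.End Λ X) ∘ₗ v) ∘ₗ (u ∘ₗ c ∘ₗ v) := by
        ext y
        have := LinearMap.congr_fun hvu (c (v y))
        simp only [LinearMap.comp_apply, LinearMap.id_apply] at this
        simp [pow_succ, this]
      rw [this, mk_comp_smul, hc1, ih]
  have hbij := hX.bijective (c := c) fun n hn => hx (by
    rw [← hc n, hn, LinearMap.zero_comp, LinearMap.comp_zero, map_zero, zero_smul])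
  refine hφ ⟨(LinearEquiv.ofBijective c hbij).symm.toLinearMap ∘ₗ v ∘ₗ a, LinearMap.ext fun y => ?_⟩
  exact (LinearEquiv.ofBijective c hbij).symm_apply_apply y

theorem exists_isLeftAlmostSplit [hπ : IsStableQuotient π] [IsArtinianRing k] [Module.Finite k Λ]
    [hM : IsGenerator Λ M] [Module.Finite Λ X] (hX : IndecMod Λ X) [IsSimpleModule R S]
    {u : X →ₗ[Λ] M} {v : M →ₗ[Λ] X} (hvu : v ∘ₗ u = LinearMap.id) {x : S} (hx : x ≠ 0)
    (hux : π (u ∘ₗ v) • x = x) :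
    ∃ (m : ℕ) (f : X →ₗ[Λ] Fin m → M), IsLeftAlmostSplit f ∧
      ∀ j, π (LinearMap.proj j ∘ₗ f ∘ₗ v) • x = 0 := by
  have : IsArtinianRing Λ := IsArtinianRing.of_finite k Λ
  have := hM.finite
  have : Module.Finite k (X →ₗ[Λ] M) := finite_hom
  let L : Submodule k (X →ₗ[Λ] M) :=
    { carrier := {φ | π (φ ∘ₗ v) • x = 0}
      zero_mem' := by simp
      add_mem' := fun {φ φ'} h h' => by
        simp only [Set.mem_ofPred_eq] at h h' ⊢
        rw [LinearMap.add_comp, map_add, add_smul, h, h', add_zero]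
      smul_mem' := fun c φ h => by
        simp only [Set.mem_ofPred_eq] at h ⊢
        rw [LinearMap.smul_comp, map_smul, Algebra.smul_def, mul_smul, h, smul_zero] }
  obtain ⟨m, F, hF⟩ := Submodule.fg_iff_exists_fin_generating_family.1
    (IsNoetherian.noetherian L)
  have hFx : ∀ j, π (F j ∘ₗ v) • x = 0 := fun j => by
    have : F j ∈ L := hF ▸ Submodule.subset_span ⟨j, rfl⟩
    exact this
  refine ⟨m, LinearMap.pi F, ⟨?_, ?_⟩, hFx⟩
  · rintro ⟨r, hr⟩
    apply hx
    have h1 : u ∘ₗ v = ∑ j, (u ∘ₗ r ∘ₗ LinearMap.single Λ (fun _ => M) j) ∘ₗ (F j ∘ₗ v) := by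
      ext y
      have h2 := LinearMap.congr_fun hr (v y)
      conv_lhs => rw [LinearMap.comp_apply, ← LinearMap.id_apply (R := Λ) (v y), ← h2]
      simp only [LinearMap.sum_apply, LinearMap.comp_apply, ← map_sum]
      congr 2
      exact (Finset.univ_sum_single _).symm
    rw [← hux, h1, mk_sum_smul]
    exact Finset.sum_eq_zero fun j _ => by rw [mk_comp_smul, hFx, smul_zero]
  · intro W _ _ _ g hg
    obtain ⟨ι, _, a, b, hab⟩ := hM.inAdd W
    have key : ∀ j, ∃ C : (Fin m → M) →ₗ[Λ] M, C ∘ₗ LinearMap.pi F = a j ∘ₗ g := fun j => by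
      have h1 : a j ∘ₗ g ∈ L := smul_eq_zero_of_not_split hX hvu hx hux _ fun ⟨r, hr⟩ =>
        hg ⟨r ∘ₗ a j, hr⟩
      rw [← hF, Submodule.mem_span_range_iff_exists_fun] at h1
      obtain ⟨c, hc⟩ := h1
      exact ⟨∑ l, c l • LinearMap.proj l, by rw [← hc]; ext y; simp⟩
    choose C hC using key
    refine ⟨∑ j, b j ∘ₗ C j, LinearMap.ext fun y => ?_⟩
    have h1 := LinearMap.congr_fun hab (g y)
    simp only [LinearMap.sum_apply, LinearMap.comp_apply, LinearMap.id_apply] at h1 ⊢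
    rw [← h1]
    exact Finset.sum_congr rfl fun j _ => congrArg (b j) (LinearMap.congr_fun (hC j) y)

open StableDual in
theorem exists_lift_of_not_split [hπ : IsStableQuotient π] [hM : IsGenerator Λ M]
    [Module k X] [IsScalarTower k Λ X] [IsSimpleModule R S]
    [Module k S] [IsScalarTower k R S]
    {E : Type} [AddCommGroup E] [Module R E] [Module k E] [IsScalarTower k R E]
    {J : Type} [AddCommGroup J] [Module k J] [IsDualizing k J]
    {u : X →ₗ[Λ] M} {v : M →ₗ[Λ] X} (hvu : v ∘ₗ u = LinearMap.id) {x : S} (hx : x ≠ 0)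
    (hux : π (u ∘ₗ v) • x = x) {m : ℕ} {f : X →ₗ[Λ] Fin m → M} (hf : IsLeftAlmostSplit f)
    (hfx : ∀ j, π (LinearMap.proj j ∘ₗ f ∘ₗ v) • x = 0) {p : E →ₗ[R] S}
    (hp : ¬ ∃ s : S →ₗ[R] E, p ∘ₗ s = LinearMap.id) :
    ∃ (σ : S →ₗ[R] StableDual π J X) (ψ : E →ₗ[R] StableDual π J (Fin m → M)),
      Injective σ ∧ map π J f ∘ₗ ψ = σ ∘ₗ p ∧
      ¬ ∃ s : S →ₗ[R] StableDual π J (Fin m → M), map π J f ∘ₗ s = σ := by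
  have := hM.finite
  obtain ⟨l, -, hl⟩ := exists_functional_ne_zero J (p := (⊥ : Submodule k S)) (n := x) (by
    rwa [Submodule.mem_bot])
  let σ : S →ₗ[R] StableDual π J X := lift π (fun _ : Unit => u) fun _ => l
  have hσ : ∀ s h, (σ s).toMap h = l (π (u ∘ₗ h) • s) := fun s h => by
    simp only [σ, toMap_lift, Finset.univ_unique, Finset.sum_singleton]
  let G : E →ₗ[k] Fin m → E :=
    { toFun := fun n j => π (LinearMap.proj j ∘ₗ f ∘ₗ v) • n
      map_add' := fun n n' => by ext; simp
      map_smul' := fun c n => by ext j; exact smul_comm _ _ _ }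
  have hker : ∀ n, G n = 0 → l (π (u ∘ₗ v) • p n) = 0 := by
    intro n hn
    suffices h : p (π (u ∘ₗ v) • n) = 0 by rw [← map_smul, h, map_zero]
    by_contra hne
    have hj : ∀ (a : M →ₗ[Λ] M), π a • x = 0 → π a • π (u ∘ₗ v) • n = 0 := by
      intro a ha
      obtain ⟨C, hC⟩ := hf.factor (a ∘ₗ u) (by
        rintro ⟨r, hr⟩
        apply hx
        have h1 : u ∘ₗ v = (u ∘ₗ r) ∘ₗ a ∘ₗ (u ∘ₗ v) := by
          ext y
          have := LinearMap.congr_fun hr (v y)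
          simp only [LinearMap.comp_apply, LinearMap.id_apply] at this
          simp [this]
        rw [← hux, h1, mk_comp_smul, mk_comp_smul, hux, ha, smul_zero])
      have h2 : a ∘ₗ (u ∘ₗ v) =
          ∑ j, (C ∘ₗ LinearMap.single Λ (fun _ => M) j) ∘ₗ (LinearMap.proj j ∘ₗ f ∘ₗ v) := by
        ext y
        have h3 := LinearMap.congr_fun hC (v y)
        simp only [LinearMap.comp_apply] at h3
        simp only [LinearMap.sum_apply, LinearMap.comp_apply, ← map_sum, ← h3]
        congr 1
        exact (Finset.univ_sum_single _).symm
      rw [← mk_comp_smul, h2, mk_sum_smul]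
      exact Finset.sum_eq_zero fun j _ => by
        rw [mk_comp_smul]
        have : π (LinearMap.proj j ∘ₗ f ∘ₗ v) • n = 0 := congrFun hn j
        rw [this, smul_zero]
    obtain ⟨s, hs⟩ := exists_comp_eq_of_surjective
      (IsSimpleModule.toSpanSingleton_surjective R hx)
      (LinearMap.toSpanSingleton R E (π (u ∘ₗ v) • n)) fun r hr => by
        obtain ⟨a, rfl⟩ := hπ.surjective r
        exact hj a hr
    have hsx : s x = π (u ∘ₗ v) • n := by
      simpa [LinearMap.toSpanSingleton_apply] using LinearMap.congr_fun hs 1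
    have hbij : Bijective (p ∘ₗ s) := LinearMap.bijective_of_ne_zero fun h => hne (by
      rw [← hsx]; exact LinearMap.congr_fun h x)
    refine hp ⟨s ∘ₗ (LinearEquiv.ofBijective _ hbij).symm.toLinearMap, LinearMap.ext fun y => ?_⟩
    exact (LinearEquiv.ofBijective _ hbij).apply_symm_apply y
  obtain ⟨l', hl'⟩ := exists_functional_factor (J := J) G
    { toFun := fun n => l (π (u ∘ₗ v) • p n)
      map_add' := fun n n' => by simp
      map_smul' := fun c n => by
        rw [RingHom.id_apply, ← map_smul l, smul_comm c, LinearMap.map_smul_of_tower p c] } hker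
  refine ⟨σ, lift π LinearMap.proj fun j => l' ∘ₗ LinearMap.single k (fun _ => E) j, ?_, ?_, ?_⟩
  · refine LinearMap.injective_of_ne_zero fun h => hl ?_
    rw [← hux, ← hσ, h]
    rfl
  · refine LinearMap.ext fun n => StableDual.ext fun h => ?_
    have h1 : ∀ j : Fin m, π (LinearMap.proj j ∘ₗ f ∘ₗ h) • n = G (π (u ∘ₗ h) • n) j := fun j => by
      have h2 : LinearMap.proj j ∘ₗ f ∘ₗ h = (LinearMap.proj j ∘ₗ f ∘ₗ v) ∘ₗ (u ∘ₗ h) := by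
        ext y
        have := LinearMap.congr_fun hvu (h y)
        simp only [LinearMap.comp_apply, LinearMap.id_apply] at this
        simp [this]
      rw [h2, mk_comp_smul]
      rfl
    have h3 : (u ∘ₗ v) ∘ₗ (u ∘ₗ h) = u ∘ₗ h := by
      ext y
      have := LinearMap.congr_fun hvu (h y)
      simp only [LinearMap.comp_apply, LinearMap.id_apply] at this
      simp [this]
    rw [LinearMap.comp_apply, toMap_map, toMap_lift, LinearMap.comp_apply, hσ]
    simp only [LinearMap.comp_apply, h1, ← map_sum]
    have h4 : ∑ j, LinearMap.single k (fun _ => E) j (G (π (u ∘ₗ h) • n) j) =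
        G (π (u ∘ₗ h) • n) := Finset.univ_sum_single _
    rw [h4, hl']
    simp only [LinearMap.coe_mk, AddHom.coe_mk, map_smul]
    rw [← mk_comp_smul, h3]
  · rintro ⟨s, hs⟩
    apply hl
    rw [← hux, ← hσ, ← hs, LinearMap.comp_apply, toMap_map,
      toMap_eq_sum (a := LinearMap.proj) (b := LinearMap.single Λ (fun _ => M)) ?_]
    · exact Finset.sum_eq_zero fun j _ => by rw [hfx, map_zero]; rfl
    · ext j y
      simp

/-- The left term of an almost split sequence is a summand of the kernel of a map, if the right
term is mapped to the target and this does not lift. -/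
theorem IsAlmostSplitSeq.exists_retract {S T E : Type} [AddCommGroup S] [Module R S]
    [AddCommGroup T] [Module R T] [AddCommGroup E] [Module R E] {i : T →ₗ[R] E} {p : E →ₗ[R] S}
    (hAS : IsAlmostSplitSeq R i p) {I₁ I₂ : Type} [AddCommGroup I₁] [Module R I₁]
    [AddCommGroup I₂] [Module R I₂] {F : I₁ →ₗ[R] I₂} [Module.Finite R (LinearMap.ker F)]
    {σ : S →ₗ[R] I₂} {ψ : E →ₗ[R] I₁} (hψ : F ∘ₗ ψ = σ ∘ₗ p)
    (hσ : ¬ ∃ s : S →ₗ[R] I₁, F ∘ₗ s = σ) :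
    ∃ (t : T →ₗ[R] LinearMap.ker F) (r : LinearMap.ker F →ₗ[R] T),
      (∀ x, (t x : I₁) = ψ (i x)) ∧ r ∘ₗ t = LinearMap.id := by
  obtain ⟨⟨hi, hp, hex⟩, -, -, -, hT⟩ := hAS
  let t : T →ₗ[R] LinearMap.ker F := (ψ ∘ₗ i).codRestrict _ fun x => by
    have := LinearMap.congr_fun hψ (i x)
    simp only [LinearMap.comp_apply, hex.apply_apply_eq_zero, map_zero] at this
    simpa using this
  suffices h : ∃ r : LinearMap.ker F →ₗ[R] T, r ∘ₗ t = LinearMap.id by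
    obtain ⟨r, hr⟩ := h
    exact ⟨t, r, fun x => rfl, hr⟩
  by_contra hcon
  obtain ⟨l, hl⟩ := hT _ t hcon
  obtain ⟨s, hs⟩ := exists_comp_eq_of_surjective hp (ψ - (LinearMap.ker F).subtype ∘ₗ l)
    fun x hx => by
      obtain ⟨y, rfl⟩ := (hex x).1 hx
      have := congrArg Subtype.val (LinearMap.congr_fun hl y)
      simp only [LinearMap.comp_apply] at this
      rw [LinearMap.sub_apply, LinearMap.comp_apply, Submodule.subtype_apply, this]
      exact sub_self _
  refine hσ ⟨s, LinearMap.ext fun y => ?_⟩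
  obtain ⟨z, rfl⟩ := hp y
  have h1 := LinearMap.congr_fun hs z
  have h2 := LinearMap.congr_fun hψ z
  simp only [LinearMap.comp_apply] at h1 h2 ⊢
  rw [h1, ← h2]
  simp

theorem IsAlmostSplitSeq.exists_retract_of_extends {S T E : Type} [AddCommGroup S] [Module R S]
    [AddCommGroup T] [Module R T] [AddCommGroup E] [Module R E] {i : T →ₗ[R] E} {p : E →ₗ[R] S}
    (hAS : IsAlmostSplitSeq R i p) [Module.Finite R T] (l : E →ₗ[R] T) :
    ∃ r : T →ₗ[R] T, r ∘ₗ (LinearMap.id - l ∘ₗ i) = LinearMap.id := by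
  by_contra hcon
  obtain ⟨l', hl'⟩ := hAS.2.2.2.2 T _ hcon
  exact hAS.2.1 ⟨l + l', by rw [LinearMap.add_comp, hl']; abel⟩

end AlmostSplit

/-- If a left almost split map is not injective, then its source is injective. -/
theorem IsLeftAlmostSplit.injective_of_not_injective {Λ X Y : Type} [Ring Λ] [AddCommGroup X]
    [Module Λ X] [AddCommGroup Y] [Module Λ Y] [Module.Finite Λ X] {f : X →ₗ[Λ] Y}
    (hf : IsLeftAlmostSplit f) (hinj : ¬ Injective f) : Module.Injective Λ X := by
  refine Module.Baer.injective fun L y => ?_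
  let D : Submodule Λ (X × Λ) := LinearMap.range (y.prod (-L.subtype))
  let g : X →ₗ[Λ] (X × Λ) ⧸ D := D.mkQ ∘ₗ LinearMap.inl Λ X Λ
  have hg : Injective g := by
    rw [injective_iff_map_eq_zero]
    intro x hx
    obtain ⟨l, hl⟩ := (Submodule.Quotient.mk_eq_zero D).1 hx
    have hl0 : l = 0 := Subtype.ext (neg_eq_zero.1 (congrArg Prod.snd hl))
    have hlx : y l = x := congrArg Prod.fst hl
    rw [← hlx, hl0, map_zero]
  have hs : ∃ r : (X × Λ) ⧸ D →ₗ[Λ] X, r ∘ₗ g = LinearMap.id := by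
    by_contra hcon
    obtain ⟨g', hg'⟩ := hf.factor g hcon
    refine hinj (Injective.of_comp (f := g') ?_)
    rw [← LinearMap.coe_comp, hg']
    exact hg
  obtain ⟨r, hr⟩ := hs
  refine ⟨r ∘ₗ D.mkQ ∘ₗ LinearMap.inr Λ X Λ, fun l hl => ?_⟩
  have h1 : D.mkQ (0, l) = D.mkQ (y ⟨l, hl⟩, 0) := by
    rw [← sub_eq_zero, ← map_sub]
    refine (Submodule.Quotient.mk_eq_zero D).2 ⟨-⟨l, hl⟩, ?_⟩
    simp
  simp only [LinearMap.comp_apply, LinearMap.inr_apply, h1]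
  exact LinearMap.congr_fun hr (y ⟨l, hl⟩)

section NotInjective

variable {k Λ M R : Type} [CommRing k] [Ring Λ] [Algebra k Λ]
    [AddCommGroup M] [Module Λ M] [Module k M] [IsScalarTower k Λ M]
    [Ring R] [Algebra k R] {π : Module.End Λ M →ₐ[k] R} [hπ : IsStableQuotient π]
    {X C : Type} [AddCommGroup X] [Module Λ X] [Module k X] [IsScalarTower k Λ X]
    [AddCommGroup C] [Module Λ C] [Module k C] [IsScalarTower k Λ C]
    {J : Type} [AddCommGroup J] [Module k J]

open StableDual

/-- The evaluation at a map from `M`, as a functional on the kernel of `StableDual.map`. -/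
noncomputable def kerEval (π : Module.End Λ M →ₐ[k] R) [hπ : IsStableQuotient π] (J : Type) [AddCommGroup J]
    [Module k J] (q : X →ₗ[Λ] C) :
    (M →ₗ[Λ] C) →+ RightDual k J (LinearMap.ker (map π J q)) where
  toFun ξ := RightDual.ofMap
    { toFun := fun θ => θ.1.toMap ξ
      map_add' := fun _ _ => rfl
      map_smul' := fun _ _ => rfl }
  map_zero' := RightDual.ext fun θ => _root_.map_zero θ.1.toMap
  map_add' ξ ξ' := RightDual.ext fun θ => _root_.map_add θ.1.toMap ξ ξ'

theorem kerEval_apply (q : X →ₗ[Λ] C) (ξ : M →ₗ[Λ] C) (θ : LinearMap.ker (map π J q)) :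
    (kerEval π J q ξ).toMap θ = θ.1.toMap ξ := rfl

theorem op_smul_kerEval (q : X →ₗ[Λ] C) (a : M →ₗ[Λ] M) (ξ : M →ₗ[Λ] C) :
    MulOpposite.op (π a) • kerEval π J q ξ = kerEval π J q (ξ ∘ₗ a) :=
  RightDual.ext fun θ => by
    rw [RightDual.smul_apply, kerEval_apply, kerEval_apply, MulOpposite.unop_op,
      Submodule.coe_smul, toMap_mk_smul]

theorem kerEval_comp (q : X →ₗ[Λ] C) (y : M →ₗ[Λ] X) : kerEval π J q (q ∘ₗ y) = 0 :=
  RightDual.ext fun θ => by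
    rw [kerEval_apply, ← toMap_map, LinearMap.mem_ker.1 θ.2]
    rfl

theorem exists_comp_of_kerEval_eq_zero [IsDualizing k J] {q : X →ₗ[Λ] C} (hq : Surjective q)
    {ξ : M →ₗ[Λ] C} (h : kerEval π J q ξ = 0) : ∃ y : M →ₗ[Λ] X, q ∘ₗ y = ξ := by
  by_contra hcon
  let K : Submodule k (M →ₗ[Λ] C) := LinearMap.range
    ({ toFun := fun y => q ∘ₗ y
       map_add' := fun y y' => LinearMap.comp_add _ _ _
       map_smul' := fun c y => LinearMap.ext fun z => by
         simp [LinearMap.map_smul_of_tower] } : (M →ₗ[Λ] X) →ₗ[k] (M →ₗ[Λ] C))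
  obtain ⟨θ, hθ, hne⟩ := exists_functional_ne_zero J (p := K) (n := ξ) hcon
  refine hne ?_
  have h1 : ∀ w ∈ projMaps k Λ M C, θ w = 0 := fun w hw => by
    obtain ⟨w', -, hw'⟩ := exists_lift_of_mem_projMaps hw hq
    exact hθ w ⟨w', hw'⟩
  have h2 : map π J q ⟨θ, h1⟩ = 0 := StableDual.ext fun y => by
    rw [toMap_map]
    exact hθ _ ⟨y, rfl⟩
  exact congrArg (fun ρ => ρ.toMap ⟨⟨θ, h1⟩, h2⟩) h

theorem kerEval_surjective [IsDualizing k J] [IsArtinianRing k] [Module.Finite k Λ]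
    [Module.Finite Λ M] [Module.Finite Λ C] (q : X →ₗ[Λ] C) : Surjective (kerEval π J q) := by
  intro ρ
  have : Module.Finite k (M →ₗ[Λ] C) := finite_hom
  obtain ⟨φ, hφ⟩ := exists_functional_factor (J := J)
    ({ toFun := fun θ => θ.1.toMap
       map_add' := fun _ _ => rfl
       map_smul' := fun _ _ => rfl } :
      LinearMap.ker (map π J q) →ₗ[k] ((M →ₗ[Λ] C) →ₗ[k] J)) ρ.toMap fun θ hθ => by
    have h1 : θ = 0 := Subtype.ext (toMap_injective hθ)
    rw [h1, _root_.map_zero]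
  obtain ⟨ξ, hξ⟩ := exists_eval φ
  exact ⟨ξ, RightDual.ext fun θ => by rw [← hφ, hξ]; rfl⟩

theorem injective_dual_ker_map [IsDualizing k J] [IsArtinianRing k] [Module.Finite k Λ]
    [hM : IsGenerator Λ M] [Module.Finite k R] [Module.Finite Λ C] [hX : Module.Injective Λ X]
    {q : X →ₗ[Λ] C} (hq : Surjective q) :
    Module.Injective Rᵐᵒᵖ (RightDual k J (LinearMap.ker (map π J q))) := by
  have := hM.finite
  have : IsNoetherianRing Rᵐᵒᵖ := IsNoetherianRing.of_finite k Rᵐᵒᵖ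
  have : IsNoetherianRing Λ := IsNoetherianRing.of_finite k Λ
  refine Module.Baer.injective fun N g => ?_
  obtain ⟨s, n, hn⟩ := Submodule.fg_iff_exists_fin_generating_family.1 (IsNoetherian.noetherian N)
  have hnN : ∀ l, n l ∈ N := fun l => hn ▸ Submodule.subset_span ⟨l, rfl⟩
  choose ν hν using fun l => hπ.surjective (n l).unop
  choose ξ hξ using fun l => kerEval_surjective (π := π) (J := J) q (g ⟨n l, hnN l⟩)
  obtain ⟨m, c, hc⟩ := Module.Finite.exists_fin' Λ M
  let h₀ : (Fin s → M) →ₗ[Λ] M := ∑ l, (ν l : M →ₗ[Λ] M) ∘ₗ LinearMap.proj l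
  let h : (Fin s → M) × (Fin m → Λ) →ₗ[Λ] M := h₀.coprod c
  have hh : Surjective h := fun z => by
    obtain ⟨w, rfl⟩ := hc z
    exact ⟨(0, w), by simp [h]⟩
  let ξ' : (Fin s → M) × (Fin m → Λ) →ₗ[Λ] C :=
    (∑ l, ξ l ∘ₗ LinearMap.proj l) ∘ₗ LinearMap.fst Λ _ _
  obtain ⟨ι, _, a, b, hab⟩ := hM.inAdd (LinearMap.ker h)
  have key : ∀ j, ∃ y : M →ₗ[Λ] X, q ∘ₗ y = ξ' ∘ₗ (LinearMap.ker h).subtype ∘ₗ b j := by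
    intro j
    refine exists_comp_of_kerEval_eq_zero (π := π) (J := J) hq ?_
    let β : M →ₗ[Λ] (Fin s → M) × (Fin m → Λ) := (LinearMap.ker h).subtype ∘ₗ b j
    let β' : Fin s → M →ₗ[Λ] M := fun l => LinearMap.proj l ∘ₗ LinearMap.fst Λ _ _ ∘ₗ β
    have h1 : ξ' ∘ₗ β = ∑ l, ξ l ∘ₗ β' l := by ext z; simp [ξ', β']
    have h2 : ∑ l, MulOpposite.op (π (β' l)) * n l = 0 := by
      have h3 : ∑ l, ν l ∘ₗ β' l = c ∘ₗ (-(LinearMap.snd Λ _ _ ∘ₗ β)) := by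
        ext z
        have h4 : h (β z) = 0 := (b j z).2
        simp only [h, LinearMap.coprod_apply] at h4
        simp only [LinearMap.comp_apply, LinearMap.neg_apply, map_neg, LinearMap.snd_apply]
        rw [← eq_neg_of_add_eq_zero_left h4]
        simp [h₀, β']
      have h5 : ∑ l, π (ν l) * π (β' l) = 0 := by
        have : ∑ l, π (ν l) * π (β' l) = π (∑ l, ν l ∘ₗ β' l) := by
          rw [map_sum]
          exact Finset.sum_congr rfl fun l _ => (map_mul π _ _).symm
        rw [this, h3]
        exact (hπ.eq_zero_iff _).2 (mem_projMaps_of_projective k _ _)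
      apply MulOpposite.unop_injective
      simpa [hν] using h5
    change kerEval π J q (ξ' ∘ₗ β) = 0
    rw [h1, map_sum]
    have h6 : ∀ l, kerEval π J q (ξ l ∘ₗ β' l) = g (MulOpposite.op (π (β' l)) • ⟨n l, hnN l⟩) :=
      fun l => by rw [map_smul, ← hξ, op_smul_kerEval]
    simp only [h6, ← map_sum]
    have h7 : ∑ l, MulOpposite.op (π (β' l)) • (⟨n l, hnN l⟩ : N) = 0 :=
      Subtype.ext (by simpa using h2)
    rw [h7, map_zero]
  choose y hy using key
  obtain ⟨y', hy'⟩ := hX.out (LinearMap.ker h).subtype (LinearMap.ker h).injective_subtype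
    (∑ j, y j ∘ₗ a j)
  obtain ⟨ζ, hζ⟩ := exists_comp_eq_of_surjective hh (ξ' - q ∘ₗ y') fun w hw => by
    have h1 := hy' ⟨w, hw⟩
    have h2 := LinearMap.congr_fun hab ⟨w, hw⟩
    simp only [Submodule.subtype_apply] at h1
    rw [LinearMap.sub_apply, LinearMap.comp_apply q, h1, sub_eq_zero]
    simp only [LinearMap.sum_apply, LinearMap.comp_apply, map_sum, LinearMap.id_apply] at h2 ⊢
    have h3 : ∀ j, q (y j (a j ⟨w, hw⟩)) = ξ' (b j (a j ⟨w, hw⟩)) := fun j =>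
      LinearMap.congr_fun (hy j) _
    simp only [h3, ← map_sum]
    have h4 := congrArg Subtype.val h2
    simp only [Submodule.coe_sum] at h4
    rw [h4]
  refine ⟨LinearMap.toSpanSingleton _ _ (kerEval π J q ζ), fun x hx => ?_⟩
  have hgen : ∀ l, n l • kerEval π J q ζ = g ⟨n l, hnN l⟩ := fun l => by
    have h1 : ζ ∘ₗ ν l = ξ l + q ∘ₗ (-(y' ∘ₗ LinearMap.inl Λ _ _ ∘ₗ
        LinearMap.single Λ (fun _ => M) l)) := by
      ext z
      have h2 : h (Pi.single l z, 0) = ν l z := by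
        simp only [h, h₀, LinearMap.coprod_apply, map_zero, add_zero, LinearMap.sum_apply,
          LinearMap.comp_apply, LinearMap.proj_apply]
        rw [Finset.sum_eq_single l (fun l' _ hl' => by rw [Pi.single_eq_of_ne hl', map_zero])
          (by simp), Pi.single_eq_same]
      have h3 : ξ' (Pi.single l z, 0) = ξ l z := by
        simp only [ξ', LinearMap.sum_apply, LinearMap.comp_apply, LinearMap.proj_apply,
          LinearMap.fst_apply]
        rw [Finset.sum_eq_single l (fun l' _ hl' => by rw [Pi.single_eq_of_ne hl', map_zero])
          (by simp), Pi.single_eq_same]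
      have h4 := LinearMap.congr_fun hζ (Pi.single l z, 0)
      simp only [LinearMap.comp_apply, LinearMap.sub_apply, h2, h3] at h4
      simp [h4, sub_eq_add_neg]
    rw [← hξ, ← MulOpposite.op_unop (n l), ← hν, op_smul_kerEval, h1, _root_.map_add, kerEval_comp,
      add_zero]
  have hx' : x ∈ Submodule.span Rᵐᵒᵖ (Set.range n) := hn ▸ hx
  obtain ⟨r, rfl⟩ := (Submodule.mem_span_range_iff_exists_fun _).1 hx'
  have h1 : (⟨∑ l, r l • n l, hx⟩ : N) = ∑ l, r l • ⟨n l, hnN l⟩ := Subtype.ext (by simp)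
  rw [h1, map_sum, map_sum]
  refine Finset.sum_congr rfl fun l _ => ?_
  rw [map_smul, map_smul, ← hgen, LinearMap.toSpanSingleton_apply]

theorem projective_of_not_injective [IsDualizing k J] [IsArtinianRing k] [Module.Finite k Λ]
    [hM : IsGenerator Λ M] [Module.Finite k R] [Module.Finite Λ X]
    {S T E : Type} [AddCommGroup S] [Module R S] [AddCommGroup T] [Module R T]
    [AddCommGroup E] [Module R E] {i : T →ₗ[R] E} {p : E →ₗ[R] S} (hAS : IsAlmostSplitSeq R i p)
    {m : ℕ} {f : X →ₗ[Λ] Fin m → M} (hf : IsLeftAlmostSplit f) (hinj : ¬ Injective f)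
    {σ : S →ₗ[R] StableDual π J X} {ψ : E →ₗ[R] StableDual π J (Fin m → M)}
    (hψ : map π J f ∘ₗ ψ = σ ∘ₗ p)
    (hσ : ¬ ∃ s : S →ₗ[R] StableDual π J (Fin m → M), map π J f ∘ₗ s = σ) :
    Module.Projective R T := by
  have := hM.finite
  have : IsNoetherianRing R := IsNoetherianRing.of_finite k R
  have : IsNoetherianRing Λ := IsNoetherianRing.of_finite k Λ
  obtain ⟨t, r, ht, hrt⟩ := hAS.exists_retract hψ hσ
  have : Module.Finite R T := Module.Finite.of_surjective r fun z =>
    ⟨t z, LinearMap.congr_fun hrt z⟩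
  have := hf.injective_of_not_injective hinj
  let C := LinearMap.range f
  let q : X →ₗ[Λ] C := f.rangeRestrict
  have hq : Surjective q := f.surjective_rangeRestrict
  have hjq : C.subtype ∘ₗ q = f := rfl
  obtain ⟨c, hc⟩ := hf.factor q fun ⟨r', hr'⟩ => hinj fun z z' hz => by
    rw [← LinearMap.id_apply (R := Λ) z, ← LinearMap.id_apply (R := Λ) z', ← hr',
      LinearMap.comp_apply, LinearMap.comp_apply]
    exact congrArg r' (Subtype.ext hz)
  have hproj : Module.Projective R (LinearMap.ker (map π J q)) :=
    projective_of_injective_dual (k := k) (J := J) (injective_dual_ker_map hq)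
  have hF : ∀ θ, map π J q (map π J C.subtype θ) = map π J f θ := fun θ => by
    rw [← LinearMap.comp_apply, ← StableDual.map_comp, hjq]
  have hF' : ∀ θ, map π J f (map π J c θ) = map π J q θ := fun θ => by
    rw [← LinearMap.comp_apply, ← StableDual.map_comp, hc]
  let a : T →ₗ[R] LinearMap.ker (map π J q) :=
    (map π J C.subtype ∘ₗ (LinearMap.ker (map π J f)).subtype ∘ₗ t).codRestrict _ fun z =>
      (hF _).trans (t z).2
  let b : LinearMap.ker (map π J q) →ₗ[R] LinearMap.ker (map π J f) :=
    (map π J c ∘ₗ (LinearMap.ker (map π J q)).subtype).codRestrict _ fun z =>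
      (hF' _).trans z.2
  let l : E →ₗ[R] LinearMap.ker (map π J f) :=
    (ψ - map π J c ∘ₗ map π J C.subtype ∘ₗ ψ).codRestrict _ fun z => by
      rw [LinearMap.mem_ker, LinearMap.sub_apply, LinearMap.comp_apply, LinearMap.comp_apply,
        _root_.map_sub, hF', hF, sub_self]
  obtain ⟨r', hr'⟩ := hAS.exists_retract_of_extends (r ∘ₗ l)
  have hba : LinearMap.id - (r ∘ₗ l) ∘ₗ i = r ∘ₗ b ∘ₗ a := by
    rw [sub_eq_iff_eq_add, LinearMap.comp_assoc, ← LinearMap.comp_add, ← hrt]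
    congr 1
    ext1 z
    apply Subtype.ext
    change (t z).1 = map π J c (map π J C.subtype (t z).1) +
      (ψ (i z) - map π J c (map π J C.subtype (ψ (i z))))
    rw [ht, add_sub_cancel]
  exact Module.Projective.of_split a (r' ∘ₗ r ∘ₗ b) (by rw [← hr', hba]; rfl)

end NotInjective

section General

variable {R : Type} [Ring R]

theorem exists_factor_of_exact {W X Y Z : Type} [AddCommGroup W] [Module R W] [AddCommGroup X]
    [Module R X] [AddCommGroup Y] [Module R Y] [AddCommGroup Z] [Module R Z] {f : X →ₗ[R] Y}
    {g : Y →ₗ[R] Z} (hf : Injective f) (hfg : Exact f g) (h : W →ₗ[R] Y) (hh : g ∘ₗ h = 0) :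
    ∃ h' : W →ₗ[R] X, f ∘ₗ h' = h := by
  have hmem : ∀ w, h w ∈ LinearMap.range f := fun w => (hfg _).1 (LinearMap.congr_fun hh w)
  refine ⟨(LinearEquiv.ofInjective f hf).symm.toLinearMap ∘ₗ h.codRestrict _ hmem,
    LinearMap.ext fun w => ?_⟩
  exact congrArg Subtype.val ((LinearEquiv.ofInjective f hf).apply_symm_apply ⟨h w, hmem w⟩)

theorem IsLeftAlmostSplit.exists_section [IsNoetherianRing R] {W X Y Z : Type} [AddCommGroup W]
    [Module R W] [Module.Finite R W] [AddCommGroup X] [Module R X] [AddCommGroup Y] [Module R Y]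
    [Module.Finite R Y] [AddCommGroup Z] [Module R Z] {f : X →ₗ[R] Y} {g : Y →ₗ[R] Z}
    (hf : IsLeftAlmostSplit f) (hfg : Exact f g) (hg : Surjective g)
    {h : W →ₗ[R] Z} (hh : ¬ ∃ h' : W →ₗ[R] Y, g ∘ₗ h' = h) :
    ∃ (u : Z →ₗ[R] W) (y : Z →ₗ[R] Y), h ∘ₗ u + g ∘ₗ y = LinearMap.id := by
  let B : Submodule R (Y × W) :=
    LinearMap.ker (g ∘ₗ LinearMap.fst R Y W - h ∘ₗ LinearMap.snd R Y W)
  have hB : ∀ b : B, g b.1.1 = h b.1.2 := fun b => sub_eq_zero.1 b.2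
  let ι : X →ₗ[R] B := (LinearMap.inl R Y W ∘ₗ f).codRestrict B fun x => by
    simp [B, hfg.apply_apply_eq_zero]
  let b₁ : B →ₗ[R] Y := LinearMap.fst R Y W ∘ₗ B.subtype
  let b₂ : B →ₗ[R] W := LinearMap.snd R Y W ∘ₗ B.subtype
  have hb₂ : Surjective b₂ := fun w => by
    obtain ⟨y, hy⟩ := hg (h w)
    exact ⟨⟨(y, w), by simp [B, hy]⟩, rfl⟩
  obtain ⟨g', hg'⟩ := hf.factor ι fun ⟨r, hr⟩ => by
    obtain ⟨h', hh'⟩ := exists_comp_eq_of_surjective hb₂ (b₁ - f ∘ₗ r) fun b hb => by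
      obtain ⟨x, hx⟩ := (hfg b.1.1).1 (by rw [hB]; exact (congrArg h hb).trans (map_zero h))
      have hbx : b = ι x := Subtype.ext (Prod.ext hx.symm hb)
      have hrx : r (ι x) = x := LinearMap.congr_fun hr x
      rw [LinearMap.sub_apply, LinearMap.comp_apply f, hbx, hrx]
      exact sub_self _
    refine hh ⟨h', LinearMap.ext fun w => ?_⟩
    obtain ⟨b, rfl⟩ := hb₂ w
    have h1 : h' (b₂ b) = b.1.1 - f (r b) := LinearMap.congr_fun hh' b
    rw [LinearMap.comp_apply, h1, map_sub, hfg.apply_apply_eq_zero, sub_zero, hB]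
    rfl
  obtain ⟨u, hu⟩ := exists_comp_eq_of_surjective hg (b₂ ∘ₗ g') fun y hy => by
    obtain ⟨x, rfl⟩ := (hfg y).1 hy
    exact congrArg b₂ (LinearMap.congr_fun hg' x)
  obtain ⟨y, hy⟩ := exists_comp_eq_of_surjective hg (LinearMap.id - b₁ ∘ₗ g') fun y hy => by
    obtain ⟨x, rfl⟩ := (hfg y).1 hy
    rw [LinearMap.sub_apply, sub_eq_zero]
    exact (congrArg b₁ (LinearMap.congr_fun hg' x)).symm
  refine ⟨u, y, LinearMap.ext fun z => ?_⟩
  obtain ⟨y', rfl⟩ := hg z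
  have h1 : u (g y') = (g' y').1.2 := LinearMap.congr_fun hu y'
  have h2 : y (g y') = y' - (g' y').1.1 := LinearMap.congr_fun hy y'
  rw [LinearMap.add_apply, LinearMap.comp_apply, LinearMap.comp_apply, h1, h2, map_sub, hB]
  simp

/-- If the left term of an almost split sequence is a summand of a quotient of an injective module
by a simple module, and the complement lifts to the injective module, then it is the first cosyzygy
of a simple module. -/
theorem IsAlmostSplitSeq.exists_cosyzygy [IsNoetherianRing R] {S T E : Type} [AddCommGroup S]
    [Module R S] [AddCommGroup T] [Module R T] [AddCommGroup E] [Module R E] {i : T →ₗ[R] E}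
    {p : E →ₗ[R] S} (hAS : IsAlmostSplitSeq R i p) {Q T₀ : Type} [AddCommGroup Q] [Module R Q]
    [AddCommGroup T₀] [Module R T₀] (hQ : Module.Injective R Q) [Module.Finite R Q]
    {G : Q →ₗ[R] T₀} (hG : Surjective G) (hS' : IsSimpleModule R (LinearMap.ker G))
    {t : T →ₗ[R] T₀} {r : T₀ →ₗ[R] T} (hrt : r ∘ₗ t = LinearMap.id) {v : T₀ →ₗ[R] Q}
    (hv : G ∘ₗ v = LinearMap.id - t ∘ₗ r) (hvt : v ∘ₗ t = 0) :
    ∃ (S' I : ModuleCat.{0} R) (ι : (S' : Type) →ₗ[R] (I : Type)),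
      IsSimpleModule R S' ∧ Module.Injective R I ∧ Module.Finite R I ∧ Injective ι ∧
      (∀ N : Submodule R I, N ≠ ⊥ → N ⊓ LinearMap.range ι ≠ ⊥) ∧
      Nonempty (T ≃ₗ[R] ((I : Type) ⧸ LinearMap.range ι)) := by
  have hrt' : ∀ x, r (t x) = x := LinearMap.congr_fun hrt
  have hv' : ∀ x, G (v x) = x - t (r x) := LinearMap.congr_fun hv
  have hvt' : ∀ x, v (t x) = 0 := LinearMap.congr_fun hvt
  let κ : Q →ₗ[R] Q := LinearMap.id - v ∘ₗ G
  have hκ : ∀ z, κ z = z - v (G z) := fun z => rfl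
  have hκκ : ∀ z, κ (κ z) = κ z := fun z => by
    simp only [hκ, map_sub, hv', hvt', sub_zero]
    abel
  have hGκ : ∀ z, G (κ z) = t (r (G z)) := fun z => by
    rw [hκ, map_sub, hv', sub_sub_cancel]
  let Q₁ : Submodule R Q := LinearMap.range κ
  have hQ₁ : ∀ z : Q₁, κ z.1 = z.1 := by
    rintro ⟨-, z, rfl⟩
    exact hκκ z
  have hle : LinearMap.ker G ≤ Q₁ := fun z hz => ⟨z, by
    rw [hκ, LinearMap.mem_ker.1 hz, map_zero, sub_zero]⟩
  have hinj : Module.Injective R Q₁ :=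
    injective_of_retract hQ Q₁.subtype κ.rangeRestrict fun z => Subtype.ext (hQ₁ z)
  let ρ : Q₁ →ₗ[R] T := r ∘ₗ G ∘ₗ Q₁.subtype
  have hρ : Surjective ρ := fun x => by
    obtain ⟨z, hz⟩ := hG (t x)
    refine ⟨⟨κ z, z, rfl⟩, ?_⟩
    change r (G (κ z)) = x
    rw [hGκ, hrt', hz, hrt']
  let ι : LinearMap.ker G →ₗ[R] Q₁ := Submodule.inclusion hle
  have hker : LinearMap.ker ρ = LinearMap.range ι := by
    ext z
    rw [Submodule.range_inclusion, Submodule.mem_comap, LinearMap.mem_ker, LinearMap.mem_ker,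
      Submodule.subtype_apply]
    refine ⟨fun hz => ?_, fun hz => (congrArg r hz).trans (map_zero r)⟩
    have hz' : r (G z.1) = 0 := hz
    rw [← hQ₁, hGκ, hz', map_zero]
  have : Module.Finite R T := Module.Finite.of_surjective ρ hρ
  refine ⟨ModuleCat.of R (LinearMap.ker G), ModuleCat.of R Q₁, ι, hS', hinj,
    inferInstanceAs (Module.Finite R Q₁), Submodule.inclusion_injective hle, ?_,
    ⟨(ρ.quotKerEquivOfSurjective hρ).symm.trans (Submodule.quotEquivOfEq _ _ hker)⟩⟩
  intro N hN hNι
  change Submodule R Q₁ at N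
  have hNρ : Injective (ρ ∘ₗ N.subtype) := by
    rw [injective_iff_map_eq_zero]
    intro z hz
    have h1 : z.1 ∈ N ⊓ LinearMap.range ι := ⟨z.2, hker ▸ hz⟩
    rw [hNι] at h1
    exact Subtype.ext ((Submodule.mem_bot R).1 h1)
  obtain ⟨ω, hω⟩ := hinj.out _ hNρ N.subtype
  obtain ⟨ω', hω'⟩ := hinj.out i hAS.1.1 ω
  obtain ⟨r', hr'⟩ := hAS.exists_retract_of_extends (ρ ∘ₗ ω')
  refine hN ((Submodule.eq_bot_iff N).2 fun z hz => ?_)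
  have h1 : r' (ρ z - ρ (ω' (i (ρ z)))) = ρ z := LinearMap.congr_fun hr' (ρ z)
  have h2 : ω (ρ z) = z := hω ⟨z, hz⟩
  rw [hω', h2, sub_self, map_zero] at h1
  rw [← h2, ← h1, map_zero]

end General

section Injective

variable {k Λ M R : Type} [CommRing k] [Ring Λ] [Algebra k Λ]
    [AddCommGroup M] [Module Λ M] [Module k M] [IsScalarTower k Λ M]
    [Ring R] [Algebra k R] {π : Module.End Λ M →ₐ[k] R} [hπ : IsStableQuotient π]
    {X Y Z : Type} [AddCommGroup X] [Module Λ X]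
    [AddCommGroup Y] [Module Λ Y] [Module k Y] [IsScalarTower k Λ Y]
    [AddCommGroup Z] [Module Λ Z] [Module k Z] [IsScalarTower k Λ Z]
    {J : Type} [AddCommGroup J] [Module k J] [IsDualizing k J]

open StableDual

theorem range_map_eq_ker_map [Module k X] [IsScalarTower k Λ X] {f : X →ₗ[Λ] Y} {g : Y →ₗ[Λ] Z}
    (hf : Injective f) (hfg : Exact f g) (hg : Surjective g) :
    LinearMap.range (map π J g) = LinearMap.ker (map π J f) := by
  refine le_antisymm ?_ fun θ hθ => ?_
  · rintro - ⟨θ, rfl⟩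
    refine StableDual.ext fun h => ?_
    have h1 : g ∘ₗ f ∘ₗ h = 0 := LinearMap.ext fun z => hfg.apply_apply_eq_zero _
    rw [toMap_map, toMap_map, h1, _root_.map_zero]
    rfl
  · obtain ⟨θ', hθ'⟩ := exists_functional_factor (J := J)
      ({ toFun := fun y => g ∘ₗ y
         map_add' := fun y y' => LinearMap.comp_add _ _ _
         map_smul' := fun c y => LinearMap.ext fun z => by
           simp [LinearMap.map_smul_of_tower] } : (M →ₗ[Λ] Y) →ₗ[k] (M →ₗ[Λ] Z)) θ.toMap
      fun h hh => by
        obtain ⟨h', rfl⟩ := exists_factor_of_exact hf hfg h hh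
        rw [← toMap_map, LinearMap.mem_ker.1 hθ]
        rfl
    refine ⟨⟨θ', fun w hw => ?_⟩, StableDual.ext fun h => (toMap_map ..).trans (hθ' h)⟩
    obtain ⟨w', hw', rfl⟩ := exists_lift_of_mem_projMaps hw hg
    exact (hθ' w').trans (θ.eq_zero w' hw')

theorem IsLeftAlmostSplit.isSimpleModule_ker_map [IsArtinianRing k] [Module.Finite k Λ]
    [hM : IsGenerator Λ M] [Module.Finite Λ Y] [Module.Finite Λ Z] {f : X →ₗ[Λ] Y}
    {g : Y →ₗ[Λ] Z} (hf : IsLeftAlmostSplit f) (hinj : Injective f) (hfg : Exact f g)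
    (hg : Surjective g) : IsSimpleModule R (LinearMap.ker (map π J g)) := by
  have := hM.finite
  have : IsNoetherianRing Λ := IsNoetherianRing.of_finite k Λ
  have : Module.Finite k (M →ₗ[Λ] Z) := finite_hom
  rw [isSimpleModule_iff_isAtom]
  refine ⟨fun hbot => ?_, fun U hU => ?_⟩
  · obtain ⟨ι, _, a, b, hab⟩ := hM.inAdd Z
    have key : ∀ j, ∃ y : M →ₗ[Λ] Y, g ∘ₗ y = b j := fun j => by
      refine exists_comp_of_kerEval_eq_zero (π := π) (J := J) hg (RightDual.ext fun θ => ?_)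
      have h1 : θ = 0 := Subtype.ext ((Submodule.mem_bot R).1 (hbot ▸ θ.2))
      rw [h1, _root_.map_zero, _root_.map_zero]
    choose y hy using key
    have hs : g ∘ₗ (∑ j, y j ∘ₗ a j) = LinearMap.id := by
      rw [← hab]
      ext z
      simp only [LinearMap.comp_apply, LinearMap.sum_apply, map_sum]
      exact Finset.sum_congr rfl fun j _ => LinearMap.congr_fun (hy j) _
    obtain ⟨r, hr⟩ := exists_factor_of_exact hinj hfg
      (LinearMap.id - (∑ j, y j ∘ₗ a j) ∘ₗ g) (by
        rw [LinearMap.comp_sub, ← LinearMap.comp_assoc, hs]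
        simp)
    refine hf.not_split ⟨r, LinearMap.ext fun x => hinj ?_⟩
    have h1 := LinearMap.congr_fun hr (f x)
    simp only [LinearMap.comp_apply, LinearMap.sub_apply, hfg.apply_apply_eq_zero,
      _root_.map_zero, sub_zero] at h1
    exact h1
  · by_contra hne
    obtain ⟨θ, hθU, hθ⟩ := Submodule.exists_mem_ne_zero_of_ne_bot hne
    obtain ⟨θ₁, hθ₁, hθ₁U⟩ := SetLike.exists_of_lt hU
    let K : Submodule k ((M →ₗ[Λ] Z) →ₗ[k] J) := (U.restrictScalars k).map toMapₗ
    obtain ⟨φ, hφ, hφ₁⟩ := exists_functional_ne_zero J (p := K) (n := θ₁.toMap) (by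
      rintro ⟨θ', hθ', h⟩
      exact hθ₁U (toMap_injective h ▸ hθ'))
    obtain ⟨h₁, hh₁⟩ := exists_eval φ
    have hU₁ : ∀ θ' ∈ U, θ'.toMap h₁ = 0 := fun θ' hθ' => by
      rw [← hh₁]
      exact hφ _ ⟨θ', hθ', rfl⟩
    rw [hh₁] at hφ₁
    obtain ⟨u, y, huy⟩ := hf.exists_section hfg hg (h := h₁) (by
      rintro ⟨h', rfl⟩
      rw [← toMap_map, LinearMap.mem_ker.1 hθ₁] at hφ₁
      exact hφ₁ rfl)
    refine hθ (StableDual.ext fun h₀ => ?_)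
    have h2 : h₀ = h₁ ∘ₗ (u ∘ₗ h₀) + g ∘ₗ (y ∘ₗ h₀) := by
      ext z
      exact (LinearMap.congr_fun huy (h₀ z)).symm
    rw [h2, _root_.map_add, ← toMap_mk_smul, ← toMap_map, LinearMap.mem_ker.1 (hU.le hθU),
      hU₁ _ (U.smul_mem _ hθU)]
    simp

/-- The complement of the left term of an almost split sequence in the kernel of
`StableDual.map π J f` is induced by a map `Z → Y`. -/
theorem IsLeftAlmostSplit.exists_comp_eq_sub [IsArtinianRing k] [Module.Finite k Λ]
    [hM : IsGenerator Λ M] [Module.Finite Λ X] [Module.Finite Λ Y] [Module k X]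
    [IsScalarTower k Λ X] {S T E : Type} [AddCommGroup S] [Module R S] [Nontrivial S]
    [AddCommGroup T] [Module R T]
    [AddCommGroup E] [Module R E] {i : T →ₗ[R] E} {p : E →ₗ[R] S} (hp : Surjective p)
    (hip : Exact i p) {f : X →ₗ[Λ] Y} {g : Y →ₗ[Λ] Z} (hf : IsLeftAlmostSplit f)
    (hfg : Exact f g) (hg : Surjective g) (hX : ¬ Module.Projective Λ X)
    {σ : S →ₗ[R] StableDual π J X} (hσ : Injective σ) {ψ : E →ₗ[R] StableDual π J Y}
    (hψ : map π J f ∘ₗ ψ = σ ∘ₗ p) {t : T →ₗ[R] LinearMap.ker (map π J f)}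
    {r : LinearMap.ker (map π J f) →ₗ[R] T} (ht : ∀ x, (t x).1 = ψ (i x))
    (hrt : r ∘ₗ t = LinearMap.id) :
    ∃ z : Z →ₗ[Λ] Y, ∀ θ : LinearMap.ker (map π J f),
      map π J g (map π J z θ.1) = θ.1 - (t (r θ)).1 := by
  have := hM.finite
  have : IsArtinianRing Λ := IsArtinianRing.of_finite k Λ
  have hIX : Module.Injective R (StableDual π J X) := injective_of_inAdd (hM.inAdd X)
  have hIY : Module.Injective R (StableDual π J Y) := injective_of_inAdd (hM.inAdd Y)
  let F : StableDual π J Y →ₗ[R] StableDual π J X := map π J f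
  have hrt' : ∀ x, r (t x) = x := LinearMap.congr_fun hrt
  have hψ' : ∀ x, F (ψ x) = σ (p x) := LinearMap.congr_fun hψ
  obtain ⟨ε, hε⟩ := hIY.out (LinearMap.ker F).subtype (LinearMap.ker F).injective_subtype
    ((LinearMap.ker F).subtype ∘ₗ (LinearMap.id - t ∘ₗ r))
  replace hε : ∀ θ : LinearMap.ker F, ε θ.1 = θ.1 - (t (r θ)).1 := hε
  obtain ⟨w₀, hw₀⟩ := exists_comp_eq_of_surjective hp (ε ∘ₗ ψ) fun x hx => by
    obtain ⟨x, rfl⟩ := (hip x).1 hx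
    rw [LinearMap.comp_apply, ← ht, hε, hrt', sub_self]
  obtain ⟨w, hw⟩ := hIY.out σ hσ w₀
  obtain ⟨y, hy⟩ := exists_eq_map (hM.inAdd Y) (ε - w ∘ₗ F)
  replace hy : ∀ θ, map π J y θ = ε θ - w (F θ) := fun θ => (LinearMap.congr_fun hy θ).symm
  have hyψ : ∀ x, map π J y (ψ x) = 0 := fun x => by
    rw [hy, hψ', hw, sub_eq_zero]
    exact (LinearMap.congr_fun hw₀ x).symm
  have hyT : ∀ θ : LinearMap.ker F, map π J y θ.1 = θ.1 - (t (r θ)).1 := fun θ => by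
    rw [hy, LinearMap.mem_ker.1 θ.2, _root_.map_zero, sub_zero, hε]
  obtain ⟨χ₀, hχ₀⟩ := exists_comp_eq_of_surjective F.surjective_rangeRestrict (F ∘ₗ map π J y)
    fun θ hθ => by
      have hθ' : θ ∈ LinearMap.ker F := congrArg Subtype.val hθ
      rw [LinearMap.comp_apply, hyT ⟨θ, hθ'⟩, _root_.map_sub, LinearMap.mem_ker.1 hθ',
        LinearMap.mem_ker.1 (t _).2, sub_zero]
  obtain ⟨χ, hχ⟩ := hIX.out (LinearMap.range F).subtype (LinearMap.range F).injective_subtype χ₀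
  have hχF : ∀ θ, χ (F θ) = F (map π J y θ) := fun θ =>
    (hχ (F.rangeRestrict θ)).trans (LinearMap.congr_fun hχ₀ θ)
  obtain ⟨x', rfl⟩ := exists_eq_map (hM.inAdd X) χ
  have hχσ : ∀ s, map π J x' (σ s) = 0 := fun s => by
    obtain ⟨x, rfl⟩ := hp s
    rw [← hψ', hχF, hyψ, _root_.map_zero]
  obtain ⟨a, ha⟩ := hf.factor x' fun ⟨r', hr'⟩ => by
    have hb := IsArtinian.bijective_of_injective_endomorphism x' fun z z' hz => by
      rw [← LinearMap.id_apply (R := Λ) z, ← LinearMap.id_apply (R := Λ) z', ← hr',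
        LinearMap.comp_apply, LinearMap.comp_apply, hz]
    have hr'' : x' ∘ₗ r' = LinearMap.id := LinearMap.ext fun z => by
      obtain ⟨z, rfl⟩ := hb.2 z
      exact congrArg x' (LinearMap.congr_fun hr' z)
    obtain ⟨s, hs⟩ := exists_ne (0 : S)
    apply hs
    apply hσ
    have h1 : map π J r' (map π J x' (σ s)) = σ s := by
      rw [← LinearMap.comp_apply, ← StableDual.map_comp, hr'', StableDual.map_id,
        LinearMap.id_apply]
    rw [← h1, hχσ, _root_.map_zero, _root_.map_zero]
  have hmem : y ∘ₗ f - f ∘ₗ x' ∈ projMaps k Λ X Y := by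
    refine mem_projMaps_of_map_eq_zero (π := π) (J := J) (hM.inAdd X) ?_
    rw [StableDual.map_sub, StableDual.map_comp, StableDual.map_comp, sub_eq_zero]
    exact LinearMap.ext fun θ => (hχF θ).symm
  obtain ⟨ι, _, α, β, hαβ⟩ := exists_fun_of_mem_projMaps hmem
  obtain ⟨α', hα'⟩ := hf.factor α fun ⟨r', hr'⟩ => hX (Module.Projective.of_split α r' hr')
  obtain ⟨z, hz⟩ := exists_comp_eq_of_surjective hg (y - f ∘ₗ a - β ∘ₗ α') fun y' hy' => by
    obtain ⟨x, rfl⟩ := (hfg y').1 hy'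
    have h1 := LinearMap.congr_fun hαβ x
    have h2 := LinearMap.congr_fun ha x
    have h3 := LinearMap.congr_fun hα' x
    simp only [LinearMap.comp_apply, LinearMap.sub_apply] at h1 h2 h3 ⊢
    rw [h2, h3, h1, sub_self]
  refine ⟨z, fun θ => ?_⟩
  rw [← LinearMap.comp_apply, ← StableDual.map_comp, hz, StableDual.map_sub, StableDual.map_sub,
    StableDual.map_comp, StableDual.map_eq_zero (mem_projMaps_of_projective k α' β), sub_zero,
    LinearMap.sub_apply, LinearMap.comp_apply, LinearMap.mem_ker.1 θ.2, _root_.map_zero, sub_zero,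
    hyT]

theorem exists_cosyzygy_of_injective [IsArtinianRing k] [Module.Finite k Λ]
    [hM : IsGenerator Λ M] [Module.Finite k R] [Module.Finite Λ X] [Module k X]
    [IsScalarTower k Λ X] {S T E : Type} [AddCommGroup S] [Module R S] [Nontrivial S]
    [AddCommGroup T] [Module R T] [AddCommGroup E] [Module R E] {i : T →ₗ[R] E} {p : E →ₗ[R] S}
    (hAS : IsAlmostSplitSeq R i p) {m : ℕ} {f : X →ₗ[Λ] Fin m → M} (hf : IsLeftAlmostSplit f)
    (hinj : Injective f) (hX : ¬ Module.Projective Λ X)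
    {σ : S →ₗ[R] StableDual π J X} (hσ : Injective σ) {ψ : E →ₗ[R] StableDual π J (Fin m → M)}
    (hψ : map π J f ∘ₗ ψ = σ ∘ₗ p)
    (hσ' : ¬ ∃ s : S →ₗ[R] StableDual π J (Fin m → M), map π J f ∘ₗ s = σ) :
    ∃ (S' I : ModuleCat.{0} R) (ι : (S' : Type) →ₗ[R] (I : Type)),
      IsSimpleModule R S' ∧ Module.Injective R I ∧ Module.Finite R I ∧ Injective ι ∧
      (∀ N : Submodule R I, N ≠ ⊥ → N ⊓ LinearMap.range ι ≠ ⊥) ∧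
      Nonempty (T ≃ₗ[R] ((I : Type) ⧸ LinearMap.range ι)) := by
  have := hM.finite
  have : IsNoetherianRing R := IsNoetherianRing.of_finite k R
  obtain ⟨t, r, ht, hrt⟩ := hAS.exists_retract hψ hσ'
  let g : (Fin m → M) →ₗ[Λ] (Fin m → M) ⧸ LinearMap.range f := (LinearMap.range f).mkQ
  have hg : Surjective g := Submodule.mkQ_surjective _
  have hfg : Exact f g := LinearMap.exact_map_mkQ_range f
  obtain ⟨z, hz⟩ := hf.exists_comp_eq_sub hAS.1.2.1 hAS.1.2.2 hfg hg hX hσ hψ ht hrt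
  have hrange := range_map_eq_ker_map (π := π) (J := J) hinj hfg hg
  let G : StableDual π J ((Fin m → M) ⧸ LinearMap.range f) →ₗ[R] LinearMap.ker (map π J f) :=
    (map π J g).codRestrict _ fun θ => hrange ▸ ⟨θ, rfl⟩
  have hG : Surjective G := fun θ => by
    obtain ⟨θ', hθ'⟩ := hrange.ge θ.2
    exact ⟨θ', Subtype.ext hθ'⟩
  have hker : LinearMap.ker G = LinearMap.ker (map π J g) := LinearMap.ker_codRestrict ..
  have hrt' : ∀ x, r (t x) = x := LinearMap.congr_fun hrt
  have hGz : ∀ θ : LinearMap.ker (map π J f), G (map π J z θ.1) = θ - t (r θ) := fun θ =>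
    Subtype.ext (hz θ)
  refine hAS.exists_cosyzygy (injective_of_inAdd (hM.inAdd _)) hG
    (hker ▸ hf.isSimpleModule_ker_map hinj hfg hg) hrt
    (v := map π J z ∘ₗ (LinearMap.ker (map π J f)).subtype ∘ₗ (LinearMap.id - t ∘ₗ r))
    (LinearMap.ext fun θ => ?_) (LinearMap.ext fun x => ?_)
  · refine (hGz (θ - t (r θ))).trans ?_
    simp [hrt']
  · simp [hrt']

end Injective

theorem subsingleton_of_projective_cosyzygy {R S' I T : Type} [Ring R] [AddCommGroup S']
    [Module R S'] [AddCommGroup I] [Module R I] [AddCommGroup T] [Module R T] {ι : S' →ₗ[R] I}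
    (hι : ∀ N : Submodule R I, N ≠ ⊥ → N ⊓ LinearMap.range ι ≠ ⊥)
    (e : T ≃ₗ[R] I ⧸ LinearMap.range ι) (hT : Module.Projective R T) : Subsingleton T := by
  obtain ⟨s, hs⟩ := Module.projective_lifting_property (LinearMap.range ι).mkQ e.toLinearMap
    (Submodule.mkQ_surjective _)
  have hs' : ∀ x, (LinearMap.range ι).mkQ (s x) = e x := LinearMap.congr_fun hs
  have hbot : LinearMap.range s = ⊥ := by
    by_contra hne
    refine hι _ hne ((Submodule.eq_bot_iff _).2 ?_)
    rintro - ⟨⟨x, rfl⟩, hx⟩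
    have h1 : e x = 0 := by
      rw [← hs']
      exact (Submodule.Quotient.mk_eq_zero _).2 hx
    rw [e.map_eq_zero_iff.1 h1, map_zero]
  refine subsingleton_of_forall_eq 0 fun x => e.injective ?_
  rw [← hs', LinearMap.range_eq_bot.1 hbot]
  simp

/-- A ring homomorphism out of an algebra, with surjective underlying map, makes its target an
algebra. -/
@[reducible]
def algebraOfSurjective {k A R : Type} [CommRing k] [Ring A] [Algebra k A] [Ring R] (π : A →+* R)
    (hπ : Surjective π) : Algebra k R :=
  (π.comp (algebraMap k A)).toAlgebra' fun c x => by
    obtain ⟨a, rfl⟩ := hπ x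
    rw [RingHom.comp_apply, ← map_mul, ← map_mul, Algebra.commutes]

/-- The scalar action of the base ring on a module over an algebra. -/
@[reducible]
def moduleOfAlgebra (k R N : Type) [CommRing k] [Ring R] [Algebra k R] [AddCommGroup N]
    [Module R N] : Module k N := Module.compHom N (algebraMap k R)

theorem isScalarTower_moduleOfAlgebra (k R N : Type) [CommRing k] [Ring R] [Algebra k R]
    [AddCommGroup N] [Module R N] :
    letI := moduleOfAlgebra k R N
    IsScalarTower k R N :=
  letI := moduleOfAlgebra k R N
  ⟨fun c r x => by rw [Algebra.smul_def, mul_smul]; rfl⟩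

theorem isGenerator_of_directSum {Λ M : Type} [Ring Λ] [IsArtinianRing Λ] [AddCommGroup M]
    [Module Λ M] {n : ℕ} {V : Fin n → ModuleCat.{0} Λ} (hVfg : ∀ i, Module.Finite Λ (V i))
    (hVall : ∀ (W : ModuleCat.{0} Λ), Module.Finite Λ W → IndecMod Λ W →
      ∃ i, Nonempty ((W : Type) ≃ₗ[Λ] (V i : Type)))
    (e : M ≃ₗ[Λ] (⨁ i, (V i : Type))) : IsGenerator Λ M where
  finite := Module.Finite.equiv e.symm
  inAdd W _ _ _ := by
    refine inAdd_of_finite (fun W' _ _ _ hW' => ?_) W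
    obtain ⟨i, ⟨e'⟩⟩ := hVall (ModuleCat.of Λ W') ‹_› hW'
    refine ⟨Unit, inferInstance,
      fun _ => e.symm.toLinearMap ∘ₗ DirectSum.lof Λ (Fin n) (fun i => (V i : Type)) i ∘ₗ
        e'.toLinearMap,
      fun _ => e'.symm.toLinearMap ∘ₗ DirectSum.component Λ (Fin n) (fun i => (V i : Type)) i ∘ₗ
        e.toLinearMap, LinearMap.ext fun x => ?_⟩
    simp [DirectSum.component.lof_self]

/-- A nonzero element of a simple module over the stable endomorphism algebra can be chosen to be
fixed by the projection to an indecomposable summand. -/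
theorem exists_summand {Λ M R S : Type} [Ring Λ] [AddCommGroup M] [Module Λ M] [Ring R]
    [AddCommGroup S] [Module R S] [Nontrivial S] (π : Module.End Λ M →+* R) {n : ℕ}
    {V : Fin n → ModuleCat.{0} Λ} (e : M ≃ₗ[Λ] (⨁ i, (V i : Type))) :
    ∃ (j : Fin n) (u : (V j : Type) →ₗ[Λ] M) (v : M →ₗ[Λ] V j) (x : S),
      v ∘ₗ u = LinearMap.id ∧ x ≠ 0 ∧ π (u ∘ₗ v) • x = x := by
  let u : ∀ j, (V j : Type) →ₗ[Λ] M := fun j =>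
    e.symm.toLinearMap ∘ₗ DirectSum.lof Λ (Fin n) (fun i => (V i : Type)) j
  let v : ∀ j, M →ₗ[Λ] V j := fun j =>
    DirectSum.component Λ (Fin n) (fun i => (V i : Type)) j ∘ₗ e.toLinearMap
  have hvu : ∀ j, v j ∘ₗ u j = LinearMap.id := fun j => LinearMap.ext fun x => by
    simp [u, v, DirectSum.component.lof_self]
  have hsum : ∑ j, (u j ∘ₗ v j : Module.End Λ M) = 1 := LinearMap.ext fun z => by
    apply e.injective
    simp only [LinearMap.sum_apply, map_sum, LinearMap.comp_apply, u, v, LinearEquiv.coe_coe,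
      LinearEquiv.apply_symm_apply, Module.End.one_apply]
    exact DirectSum.sum_univ_of (e z)
  obtain ⟨x, hx⟩ := exists_ne (0 : S)
  have hj : ∃ j, π (u j ∘ₗ v j) • x ≠ 0 := by
    by_contra! hcon
    apply hx
    rw [← one_smul R x, ← map_one π, ← hsum, map_sum, Finset.sum_smul]
    exact Finset.sum_eq_zero fun j _ => hcon j
  obtain ⟨j, hj⟩ := hj
  refine ⟨j, u j, v j, _, hvu j, hj, ?_⟩
  rw [smul_smul, ← map_mul]
  congr 2
  ext z
  exact congrArg (u j) (LinearMap.congr_fun (hvu j) (v j z))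

theorem factorsThroughProjective_iff {k Λ M : Type} [CommRing k] [Ring Λ] [Algebra k Λ]
    [AddCommGroup M] [Module Λ M] [Module k M] [IsScalarTower k Λ M] [Module.Finite Λ M]
    (a : Module.End Λ M) : FactorsThroughProjective Λ M a ↔ a ∈ projMaps k Λ M M := by
  constructor
  · rintro ⟨P, hP, α, β, rfl⟩
    exact mem_projMaps_of_projective k α β
  · intro ha
    obtain ⟨ι, _, α, β, hαβ⟩ := exists_fun_of_mem_projMaps ha
    exact ⟨ModuleCat.of Λ (ι → Λ), inferInstanceAs (Module.Projective Λ (ι → Λ)), α, β, hαβ⟩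

theorem projective_or_cosyzygy {k Λ M R : Type} [CommRing k] [IsArtinianRing k] [Ring Λ]
    [Algebra k Λ] [Module.Finite k Λ] [AddCommGroup M] [Module Λ M] [Module k M]
    [IsScalarTower k Λ M] [hM : IsGenerator Λ M] [Ring R] [Algebra k R]
    (π : Module.End Λ M →ₐ[k] R) [hπ : IsStableQuotient π] {X S T E : Type} [AddCommGroup X]
    [Module Λ X] [Module k X] [IsScalarTower k Λ X] [Module.Finite Λ X] (hX : IndecMod Λ X)
    [AddCommGroup S] [Module R S] [Module k S] [IsScalarTower k R S] [IsSimpleModule R S]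
    [AddCommGroup T] [Module R T] [AddCommGroup E] [Module R E] [Module k E]
    [IsScalarTower k R E] {i : T →ₗ[R] E} {p : E →ₗ[R] S} (hAS : IsAlmostSplitSeq R i p)
    {u : X →ₗ[Λ] M} {v : M →ₗ[Λ] X} (hvu : v ∘ₗ u = LinearMap.id) {x : S} (hx : x ≠ 0)
    (hux : π (u ∘ₗ v) • x = x) :
    Module.Projective R T ∨
      ∃ (S' I : ModuleCat.{0} R) (ι : (S' : Type) →ₗ[R] (I : Type)),
        IsSimpleModule R S' ∧ Module.Injective R I ∧ Module.Finite R I ∧ Injective ι ∧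
        (∀ N : Submodule R I, N ≠ ⊥ → N ⊓ LinearMap.range ι ≠ ⊥) ∧
        Nonempty (T ≃ₗ[R] ((I : Type) ⧸ LinearMap.range ι)) := by
  have := hM.finite
  have : Module.Finite k (Module.End Λ M) := finite_hom
  have : Module.Finite k R := Module.Finite.of_surjective π.toLinearMap hπ.surjective
  have : Nontrivial S := IsSimpleModule.nontrivial R S
  have hXp : ¬ Module.Projective Λ X := fun _ => hx (by
    rw [← hux, (hπ.eq_zero_iff _).2 (mem_projMaps_of_projective k v u), zero_smul])
  obtain ⟨J, _, _, hJ⟩ := exists_isDualizing k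
  obtain ⟨m, f, hf, hfx⟩ := exists_isLeftAlmostSplit hX hvu hx hux
  obtain ⟨σ, ψ, hσ, hψ, hσ'⟩ := exists_lift_of_not_split (J := J) hvu hx hux hf hfx hAS.2.2.1
  by_cases hinj : Injective f
  · exact Or.inr (exists_cosyzygy_of_injective hAS hf hinj hXp hσ hψ hσ')
  · exact Or.inl (projective_of_not_injective hAS hf hinj hψ hσ')

theorem statement14
    (Λ : Type) [Ring Λ] [Algebra k Λ] [Module.Finite k Λ] [IsArtinianRing k]
    (hrep : FiniteRepType Λ)
    -- M is a basic representation generator: the direct sum of one representative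
    -- of each isomorphism class of indecomposable f.g. Λ-modules
    (n : ℕ) (V : Fin n → ModuleCat.{0} Λ)
    (hVfg : ∀ i, Module.Finite Λ (V i)) (hVind : ∀ i, IndecMod Λ (V i))
    (hVdistinct : ∀ i j, Nonempty ((V i : Type) ≃ₗ[Λ] (V j : Type)) → i = j)
    (hVall : ∀ (W : ModuleCat.{0} Λ), Module.Finite Λ W → IndecMod Λ W →
      ∃ i, Nonempty ((W : Type) ≃ₗ[Λ] (V i : Type)))
    (M : Type) [AddCommGroup M] [Module Λ M]
    (hM : Nonempty (M ≃ₗ[Λ] (⨁ i, (V i : Type))))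
    -- A̲ = End_Λ(M)/P, presented as the quotient of A = End_Λ(M) by the ideal P of
    -- endomorphisms factoring through a projective module
    (Ab : Type) [Ring Ab] (π : Module.End Λ M →+* Ab)
    (hπsurj : Function.Surjective π)
    (hπker : ∀ φ : Module.End Λ M, π φ = 0 ↔ FactorsThroughProjective Λ M φ)
    -- S : a simple non-projective A̲-module
    (S : Type) [AddCommGroup S] [Module Ab S]
    (hS : IsSimpleModule Ab S) (hSnp : ¬ Module.Projective Ab S)
    -- the almost split sequence 0 → T → E → S → 0 in mod-A̲
    (T E : Type) [AddCommGroup T] [Module Ab T] [AddCommGroup E] [Module Ab E]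
    (i : T →ₗ[Ab] E) (p : E →ₗ[Ab] S) (hAS : IsAlmostSplitSeq Ab i p) :
    -- conclusion: exactly one of (1) and (2) holds
    Xor'
      (Module.Projective Ab T)
      (∃ (S' I : ModuleCat.{0} Ab) (ι : (S' : Type) →ₗ[Ab] (I : Type)),
        IsSimpleModule Ab S' ∧
        Module.Injective Ab I ∧ Module.Finite Ab I ∧
        Function.Injective ι ∧
        (∀ N : Submodule Ab I, N ≠ ⊥ → N ⊓ LinearMap.range ι ≠ ⊥) ∧
        Nonempty (T ≃ₗ[Ab] ((I : Type) ⧸ LinearMap.range ι))) := by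
  refine (xor_iff_or_and_not_and _ _).2 ⟨?_, ?_⟩
  · obtain ⟨e⟩ := hM
    have : IsArtinianRing Λ := IsArtinianRing.of_finite k Λ
    have hgen : IsGenerator Λ M := isGenerator_of_directSum hVfg hVall e
    have := hgen.finite
    let _ : Module k M := moduleOfAlgebra k Λ M
    have _ : IsScalarTower k Λ M := isScalarTower_moduleOfAlgebra k Λ M
    let _ : Algebra k Ab := algebraOfSurjective π hπsurj
    let π' : Module.End Λ M →ₐ[k] Ab := { π with commutes' := fun _ => rfl }
    have hπ' : IsStableQuotient π' :=
      ⟨hπsurj, fun a => (hπker a).trans (factorsThroughProjective_iff a)⟩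
    have : Nontrivial S := IsSimpleModule.nontrivial Ab S
    obtain ⟨j, u, v, x, hvu, hx, hux⟩ := exists_summand (S := S) π e
    have := hVfg j
    let _ : Module k (V j) := moduleOfAlgebra k Λ (V j)
    have _ : IsScalarTower k Λ (V j) := isScalarTower_moduleOfAlgebra k Λ (V j)
    let _ : Module k S := moduleOfAlgebra k Ab S
    have _ : IsScalarTower k Ab S := isScalarTower_moduleOfAlgebra k Ab S
    let _ : Module k E := moduleOfAlgebra k Ab E
    have _ : IsScalarTower k Ab E := isScalarTower_moduleOfAlgebra k Ab E
    exact projective_or_cosyzygy π' (hVind j) hAS hvu hx hux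
  · rintro ⟨hT, S', I, ι, -, -, -, -, hι, ⟨e⟩⟩
    have := subsingleton_of_projective_cosyzygy hι e hT
    exact hAS.2.1 ⟨0, LinearMap.ext fun x => Subsingleton.elim _ _⟩

end Statement14
end

section
/- Let Λ be a self-injective Artin algebra of finite representation type, M a basic representation generator of mod-Λ, and A = End_Λ(M) its Auslander algebra. Let S be a simple right A-module of projective dimension two. Then there exist a simple right A-module S' of projective dimension two, a projective cover p : P → S' in mod-A, and an almost split sequence 0 → S → E → Ker(p) → 0 in mod-A; that is, the first syzygy Ω_A(S') is isomorphic to the inverse Auslander–Reiten translate τ_A^{-1}(S). -/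
/-!
STATEMENT 16: Let Λ be a self-injective Artin algebra of finite representation type,
M a basic representation generator, A = End_Λ(M) its Auslander algebra, and S a
simple right A-module of projective dimension two.  Then there exist a simple
A-module S' of projective dimension two, a projective cover p : P → S', and an
almost split sequence 0 → S → E → Ker(p) → 0 in mod-A; i.e. Ω_A(S') ≅ τ_A⁻¹(S).
-/

open DirectSum Function

namespace Statement16

variable (k : Type) [CommRing k]

/-- An indecomposable module. -/
def IndecMod (R V : Type) [Ring R] [AddCommGroup V] [Module R V] : Prop :=
  Nontrivial V ∧ ∀ N₁ N₂ : Submodule R V, IsCompl N₁ N₂ → N₁ = ⊥ ∨ N₂ = ⊥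

/-- Finite representation type. -/
def FiniteRepType (R : Type) [Ring R] : Prop :=
  ∃ (n : ℕ) (rep : Fin n → ModuleCat.{0} R),
    ∀ (V : ModuleCat.{0} R), Module.Finite R V → IndecMod R V →
      ∃ i, Nonempty ((V : Type) ≃ₗ[R] (rep i : Type))

/-- `(i, p)` is an almost split sequence of finitely generated `R`-modules. -/
def IsAlmostSplitSeq (R : Type) [Ring R] {T B C : Type} [AddCommGroup T] [Module R T]
    [AddCommGroup B] [Module R B] [AddCommGroup C] [Module R C]
    (i : T →ₗ[R] B) (p : B →ₗ[R] C) : Prop :=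
  (Function.Injective i ∧ Function.Surjective p ∧ Function.Exact i p) ∧
  ¬ (∃ r : B →ₗ[R] T, r ∘ₗ i = LinearMap.id) ∧
  ¬ (∃ s : C →ₗ[R] B, p ∘ₗ s = LinearMap.id) ∧
  (∀ (Z : Type) [AddCommGroup Z] [Module R Z] [Module.Finite R Z],
    ∀ t : Z →ₗ[R] C, ¬ (∃ s : C →ₗ[R] Z, t ∘ₗ s = LinearMap.id) →
      ∃ l : Z →ₗ[R] B, p ∘ₗ l = t) ∧
  (∀ (Z : Type) [AddCommGroup Z] [Module R Z] [Module.Finite R Z],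
    ∀ t : T →ₗ[R] Z, ¬ (∃ r : Z →ₗ[R] T, r ∘ₗ t = LinearMap.id) →
      ∃ l : B →ₗ[R] Z, l ∘ₗ i = t)

/-- The module `V` has projective dimension at most 1:
there is an exact sequence 0 → P1 → P0 → V → 0 with P0, P1 projective. -/
def PdLE1 (R V : Type) [Ring R] [AddCommGroup V] [Module R V] : Prop :=
  ∃ (P₀ P₁ : ModuleCat.{0} R) (d : (P₁ : Type) →ₗ[R] (P₀ : Type)) (e : (P₀ : Type) →ₗ[R] V),
    Module.Projective R P₀ ∧ Module.Projective R P₁ ∧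
    Function.Injective d ∧ Function.Surjective e ∧ Function.Exact d e

/-- The module `V` has projective dimension at most 2. -/
def PdLE2 (R V : Type) [Ring R] [AddCommGroup V] [Module R V] : Prop :=
  ∃ (P₀ P₁ P₂ : ModuleCat.{0} R) (d₂ : (P₂ : Type) →ₗ[R] (P₁ : Type))
    (d₁ : (P₁ : Type) →ₗ[R] (P₀ : Type)) (e : (P₀ : Type) →ₗ[R] V),
    Module.Projective R P₀ ∧ Module.Projective R P₁ ∧ Module.Projective R P₂ ∧
    Function.Injective d₂ ∧ Function.Exact d₂ d₁ ∧ Function.Exact d₁ e ∧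
    Function.Surjective e

/-- The module `V` has projective dimension exactly 2. -/
def PdEq2 (R V : Type) [Ring R] [AddCommGroup V] [Module R V] : Prop :=
  PdLE2 R V ∧ ¬ PdLE1 R V

/-- A linear map with a left inverse. -/
def SplitMono {R X Y : Type} [Ring R] [AddCommGroup X] [Module R X] [AddCommGroup Y] [Module R Y]
    (f : X →ₗ[R] Y) : Prop :=
  ∃ r : Y →ₗ[R] X, r ∘ₗ f = LinearMap.id

/-- A linear map with a right inverse. -/
def SplitEpi {R X Y : Type} [Ring R] [AddCommGroup X] [Module R X] [AddCommGroup Y] [Module R Y]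
    (f : X →ₗ[R] Y) : Prop :=
  ∃ s : Y →ₗ[R] X, f ∘ₗ s = LinearMap.id

section Modules

variable {R : Type} [Ring R]

theorem isSemisimpleModule_quotient_jacobson_smul_top [IsArtinianRing R] (Z : Type)
    [AddCommGroup Z] [Module R Z] :
    IsSemisimpleModule R (Z ⧸ (Ring.jacobson R • (⊤ : Submodule R Z))) := by
  have h : Module.IsTorsionBySet R (Z ⧸ (Ring.jacobson R • (⊤ : Submodule R Z)))
      (Ring.jacobson R) := by
    rw [Module.isTorsionBySet_quotient_iff]
    exact fun m i hi ↦ Submodule.smul_mem_smul hi trivial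
  let _ := h.module
  exact (h.semilinearMap.isSemisimpleModule_iff_of_bijective Function.bijective_id).2 inferInstance

theorem splitMono_of_notMem_jacobson_smul_top [IsArtinianRing R] {S Z : Type}
    [AddCommGroup S] [Module R S] [AddCommGroup Z] [Module R Z] [IsSimpleModule R S]
    (t : S →ₗ[R] Z) (s : S) (hs : t s ∉ Ring.jacobson R • (⊤ : Submodule R Z)) :
    SplitMono t := by
  have := isSemisimpleModule_quotient_jacobson_smul_top (R := R) Z
  let N : Submodule R Z := Ring.jacobson R • ⊤
  have hinj : Injective (N.mkQ ∘ₗ t) := by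
    refine LinearMap.injective_of_ne_zero fun h ↦ hs ?_
    have : N.mkQ (t s) = 0 := LinearMap.congr_fun h s
    rwa [Submodule.mkQ_apply, Submodule.Quotient.mk_eq_zero] at this
  obtain ⟨h, hh⟩ := IsSemisimpleModule.extension_property _ hinj LinearMap.id
  exact ⟨h ∘ₗ N.mkQ, hh⟩

theorem eq_zero_of_mem_jacobson_of_isIdempotentElem {e : R} (he : e ∈ Ring.jacobson R)
    (hidem : e * e = e) : e = 0 := by
  rw [← Ideal.jacobson_bot, Ideal.mem_jacobson_iff] at he
  obtain ⟨z, hz⟩ := he (-1)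
  rw [Ideal.mem_bot, sub_eq_zero] at hz
  calc e = (z * -1 * e + z) * e := by rw [hz, one_mul]
    _ = z * e - z * (e * e) := by noncomm_ring
    _ = 0 := by rw [hidem, sub_self]

theorem isLocalRing_end_of_indecMod {Y : Type} [AddCommGroup Y] [Module R Y] [IsArtinian R Y]
    [IsNoetherian R Y] (hY : IndecMod R Y) : IsLocalRing (Module.End R Y) := by
  have := hY.1
  have key : ∀ u : Module.End R Y, IsUnit u ∨ IsNilpotent u := by
    intro u
    obtain ⟨m, hm⟩ := Filter.eventually_atTop.mp u.eventually_isCompl_ker_pow_range_pow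
    have hm := hm (m + 1) (by omega)
    rcases hY.2 _ _ hm with h | h
    · left
      rw [h] at hm
      have h2 := eq_top_of_bot_isCompl hm
      have : IsUnit (u ^ (m + 1)) := by
        rw [Module.End.isUnit_iff]
        exact ⟨LinearMap.ker_eq_bot.mp h, LinearMap.range_eq_top.mp h2⟩
      exact (isUnit_pow_iff (by omega)).mp this
    · right
      exact ⟨m + 1, LinearMap.range_eq_bot.mp h⟩
  refine ⟨fun {a b} h ↦ ?_⟩
  rcases key a with ha | ha
  · exact Or.inl ha
  · right
    rw [← eq_sub_iff_add_eq'] at h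
    rw [h]
    exact ha.isUnit_one_sub

variable {X Y Z : Type} [AddCommGroup X] [Module R X] [AddCommGroup Y] [Module R Y]
  [AddCommGroup Z] [Module R Z]

theorem splitMono_of_isUnit_comp (f : X →ₗ[R] Y) (r : Y →ₗ[R] X)
    (h : IsUnit (r ∘ₗ f : Module.End R X)) : SplitMono f := by
  obtain ⟨v, hv⟩ := h.exists_left_inv
  exact ⟨v ∘ₗ r, hv⟩

theorem splitEpi_of_isUnit_comp (f : Y →ₗ[R] X) (s : X →ₗ[R] Y)
    (h : IsUnit (f ∘ₗ s : Module.End R X)) : SplitEpi f := by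
  obtain ⟨v, hv⟩ := h.exists_right_inv
  exact ⟨s ∘ₗ v, hv⟩

theorem SplitMono.of_comp {f : X →ₗ[R] Y} {h : Y →ₗ[R] Z} (hf : SplitMono (h ∘ₗ f)) :
    SplitMono f := by
  obtain ⟨r, hr⟩ := hf
  exact ⟨r ∘ₗ h, hr⟩

theorem SplitEpi.of_comp {f : X →ₗ[R] Y} {h : Y →ₗ[R] Z} (hf : SplitEpi (h ∘ₗ f)) :
    SplitEpi h := by
  obtain ⟨s, hs⟩ := hf
  exact ⟨f ∘ₗ s, hs⟩

theorem splitMono_or_splitMono_of_add [IsLocalRing (Module.End R X)] {f g : X →ₗ[R] Y}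
    (h : SplitMono (f + g)) : SplitMono f ∨ SplitMono g := by
  obtain ⟨r, hr⟩ := h
  rw [LinearMap.comp_add] at hr
  exact (IsLocalRing.isUnit_or_isUnit_of_add_one (R := Module.End R X) hr).imp
    (splitMono_of_isUnit_comp _ _) (splitMono_of_isUnit_comp _ _)

theorem splitEpi_or_splitEpi_of_add [IsLocalRing (Module.End R X)] {f g : Y →ₗ[R] X}
    (h : SplitEpi (f + g)) : SplitEpi f ∨ SplitEpi g := by
  obtain ⟨r, hr⟩ := h
  rw [LinearMap.add_comp] at hr
  exact (IsLocalRing.isUnit_or_isUnit_of_add_one (R := Module.End R X) hr).imp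
    (splitEpi_of_isUnit_comp _ _) (splitEpi_of_isUnit_comp _ _)

theorem not_splitMono_zero [Nontrivial X] : ¬ SplitMono (0 : X →ₗ[R] Y) := by
  rintro ⟨r, hr⟩
  obtain ⟨x, hx⟩ := exists_ne (0 : X)
  exact hx (by simpa using (LinearMap.congr_fun hr x).symm)

theorem not_splitEpi_zero [Nontrivial X] : ¬ SplitEpi (0 : Y →ₗ[R] X) := by
  rintro ⟨r, hr⟩
  obtain ⟨x, hx⟩ := exists_ne (0 : X)
  exact hx (by simpa using (LinearMap.congr_fun hr x).symm)

theorem splitEpi_of_exact {f : X →ₗ[R] Y} {g : Y →ₗ[R] Z} (hg : Surjective g)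
    (h : Function.Exact f g) (hf : SplitMono f) : SplitEpi g :=
  (((List.TFAE.out h.split_tfae' 0 1 :) : (Injective f ∧ SplitEpi g) ↔
    (Surjective g ∧ SplitMono f)).mpr ⟨hg, hf⟩).2

theorem splitMono_of_exact {f : X →ₗ[R] Y} {g : Y →ₗ[R] Z} (hf : Injective f)
    (h : Function.Exact f g) (hg : SplitEpi g) : SplitMono f :=
  (((List.TFAE.out h.split_tfae' 0 1 :) : (Injective f ∧ SplitEpi g) ↔
    (Surjective g ∧ SplitMono f)).mp ⟨hf, hg⟩).2

/-- In a short exact sequence whose left-hand map is left almost split and left minimal, the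
right-hand map is right almost split. -/
theorem rightAlmostSplit_of_leftAlmostSplit {S E W : Type} [AddCommGroup S] [Module R S]
    [AddCommGroup E] [Module R E] [AddCommGroup W] [Module R W] [IsNoetherian R E]
    [IsNoetherianRing R] {i : S →ₗ[R] E} {q : E →ₗ[R] W}
    (hq : Surjective q) (hiq : Function.Exact i q)
    (hleft : ∀ (Z : Type) [AddCommGroup Z] [Module R Z] [Module.Finite R Z] (t : S →ₗ[R] Z),
      ¬ SplitMono t → ∃ l : E →ₗ[R] Z, l ∘ₗ i = t)
    (hmin : ∀ u : E →ₗ[R] E, u ∘ₗ i = i → Surjective u)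
    (Z : Type) [AddCommGroup Z] [Module R Z] [Module.Finite R Z] (t : Z →ₗ[R] W)
    (ht : ¬ SplitEpi t) : ∃ l : Z →ₗ[R] E, q ∘ₗ l = t := by
  have : IsNoetherian R W := isNoetherian_of_surjective q (LinearMap.range_eq_top.mpr hq)
  let Q : Submodule R (E × Z) := LinearMap.eqLocus (q ∘ₗ LinearMap.fst R E Z)
    (t ∘ₗ LinearMap.snd R E Z)
  have hQ : ∀ y : Q, q y.1.1 = t y.1.2 := fun y ↦ y.2
  have hqi : ∀ s, q (i s) = 0 := hiq.apply_apply_eq_zero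
  let j : S →ₗ[R] Q := LinearMap.codRestrict Q (LinearMap.inl R E Z ∘ₗ i) fun s ↦ by
    change q (i s) = t 0
    rw [hqi, map_zero]
  by_cases hj : SplitMono j
  · let π : Q →ₗ[R] Z := LinearMap.snd R E Z ∘ₗ Q.subtype
    have hπ : Surjective π := fun z ↦ by
      obtain ⟨e, he⟩ := hq (t z)
      exact ⟨⟨(e, z), he⟩, rfl⟩
    have hex : Function.Exact j π := by
      intro y
      refine ⟨fun hy ↦ ?_, ?_⟩
      · obtain ⟨s, hs⟩ := (hiq y.1.1).mp (by rw [hQ]; exact (congrArg t hy).trans (map_zero t))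
        exact ⟨s, Subtype.ext (Prod.ext hs hy.symm)⟩
      · rintro ⟨s, rfl⟩
        rfl
    obtain ⟨s, hs⟩ := splitEpi_of_exact hπ hex hj
    refine ⟨LinearMap.fst R E Z ∘ₗ Q.subtype ∘ₗ s, LinearMap.ext fun z ↦ ?_⟩
    exact (hQ (s z)).trans (congrArg t (LinearMap.congr_fun hs z))
  · obtain ⟨l, hl⟩ := hleft Q j hj
    exfalso
    apply ht
    let u : E →ₗ[R] E := LinearMap.fst R E Z ∘ₗ Q.subtype ∘ₗ l
    have hu : u ∘ₗ i = i := by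
      ext s
      change (l (i s)).1.1 = i s
      rw [← LinearMap.comp_apply l i, hl]
      rfl
    let v : E →ₗ[R] Z := LinearMap.snd R E Z ∘ₗ Q.subtype ∘ₗ l
    have hv : ∀ x y, q x = q y → v x = v y := by
      intro x y hxy
      obtain ⟨s, hs⟩ := (hiq (x - y)).mp (by rw [map_sub, hxy, sub_self])
      rw [← sub_eq_zero, ← map_sub, ← hs]
      change (l (i s)).1.2 = 0
      rw [← LinearMap.comp_apply l i, hl]
      rfl
    let m : W →ₗ[R] Z :=
      { toFun := fun w ↦ v (Function.surjInv hq w)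
        map_add' := fun a b ↦ by
          rw [← map_add]
          apply hv
          simp [Function.surjInv_eq]
        map_smul' := fun a b ↦ by
          rw [RingHom.id_apply, ← map_smul]
          apply hv
          simp [Function.surjInv_eq] }
    have hmq : ∀ x, t (m (q x)) = q (u x) := by
      intro x
      have : m (q x) = v x := hv _ _ (Function.surjInv_eq hq _)
      rw [this]
      exact (hQ (l x)).symm
    have hsurj : Surjective (t ∘ₗ m) := by
      intro w
      obtain ⟨e, rfl⟩ := hq w
      obtain ⟨e', rfl⟩ := hmin u hu e
      exact ⟨q e', hmq e'⟩
    have hbij := IsNoetherian.bijective_of_surjective_endomorphism (t ∘ₗ m) hsurj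
    exact splitEpi_of_isUnit_comp t m ((Module.End.isUnit_iff _).mpr hbij)

end Modules

section AlmostSplit

variable {Λ : Type} [Ring Λ]

/-- A right almost split map of finitely generated modules. -/
structure RightAlmostSplit {B X : Type} [AddCommGroup B] [Module Λ B] [AddCommGroup X] [Module Λ X]
    (g : B →ₗ[Λ] X) : Prop where
  not_splitEpi : ¬ SplitEpi g
  exists_lift : ∀ (Y : Type) [AddCommGroup Y] [Module Λ Y] [Module.Finite Λ Y] (t : Y →ₗ[Λ] X),
    ¬ SplitEpi t → ∃ l : Y →ₗ[Λ] B, g ∘ₗ l = t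

/-- A right minimal map, in the form suited to Noetherian sources. -/
def RightMinimal {B X : Type} [AddCommGroup B] [Module Λ B] [AddCommGroup X] [Module Λ X]
    (g : B →ₗ[Λ] X) : Prop :=
  ∀ u : B →ₗ[Λ] B, g ∘ₗ u = g → Surjective u

/-- `Y` is a direct summand of a finite power of `M`. -/
def InAdd (Λ M Y : Type) [Ring Λ] [AddCommGroup M] [Module Λ M] [AddCommGroup Y] [Module Λ Y] :
    Prop :=
  ∃ (J : Type) (_ : Fintype J) (ι : J → (Y →ₗ[Λ] M)) (κ : J → (M →ₗ[Λ] Y)),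
    ∑ j, κ j ∘ₗ ι j = LinearMap.id

variable {M : Type} [AddCommGroup M] [Module Λ M]

theorem InAdd.of_isCompl {Y : Type} [AddCommGroup Y] [Module Λ Y] {N₁ N₂ : Submodule Λ Y}
    (h : IsCompl N₁ N₂) (h₁ : InAdd Λ M N₁) (h₂ : InAdd Λ M N₂) : InAdd Λ M Y := by
  obtain ⟨J₁, _, ι₁, κ₁, e₁⟩ := h₁
  obtain ⟨J₂, _, ι₂, κ₂, e₂⟩ := h₂
  let p₁ := N₁.projectionOnto N₂ h
  let p₂ := N₂.projectionOnto N₁ h.symm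
  refine ⟨J₁ ⊕ J₂, inferInstance, Sum.elim (fun j ↦ ι₁ j ∘ₗ p₁) (fun j ↦ ι₂ j ∘ₗ p₂),
    Sum.elim (fun j ↦ N₁.subtype ∘ₗ κ₁ j) (fun j ↦ N₂.subtype ∘ₗ κ₂ j), ?_⟩
  ext y
  have h₁ := LinearMap.congr_fun e₁ (p₁ y)
  have h₂ := LinearMap.congr_fun e₂ (p₂ y)
  simp only [LinearMap.sum_apply, LinearMap.comp_apply, LinearMap.id_apply] at h₁ h₂
  simp only [Fintype.sum_sum_type, Sum.elim_inl, Sum.elim_inr, LinearMap.add_apply,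
    LinearMap.sum_apply, LinearMap.comp_apply, ← map_sum, h₁, h₂, LinearMap.id_apply]
  have := LinearMap.congr_fun (Submodule.projection_add_projection_eq_id h) y
  simpa [p₁, p₂] using this

theorem inAdd_of_finite [IsArtinianRing Λ]
    (hind : ∀ (Y : Type) [AddCommGroup Y] [Module Λ Y] [Module.Finite Λ Y], IndecMod Λ Y →
      ∃ ι : Y →ₗ[Λ] M, SplitMono ι)
    (Y : Type) [AddCommGroup Y] [Module Λ Y] [Module.Finite Λ Y] : InAdd Λ M Y := by
  suffices ∀ (ℓ : ℕ∞) (Y : Type) [AddCommGroup Y] [Module Λ Y] [Module.Finite Λ Y],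
      Module.length Λ Y = ℓ → InAdd Λ M Y from this _ Y rfl
  intro ℓ
  induction ℓ using WellFoundedLT.induction with
  | ind ℓ ih =>
    intro Y _ _ _ hℓ
    subst hℓ
    by_cases hY : IndecMod Λ Y
    · obtain ⟨ι, ρ, h⟩ := hind Y hY
      exact ⟨Unit, inferInstance, fun _ ↦ ι, fun _ ↦ ρ, by simpa using h⟩
    by_cases hn : Nontrivial Y
    · simp only [IndecMod, hn, true_and, not_forall, not_or] at hY
      obtain ⟨N₁, N₂, hc, h₁, h₂⟩ := hY
      refine InAdd.of_isCompl hc (ih _ (Submodule.length_lt ?_) N₁ rfl)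
        (ih _ (Submodule.length_lt ?_) N₂ rfl)
      · rintro rfl
        exact h₂ (eq_bot_of_top_isCompl hc)
      · rintro rfl
        exact h₁ (eq_bot_of_isCompl_top hc)
    · have := not_nontrivial_iff_subsingleton.mp hn
      exact ⟨Empty, inferInstance, Empty.elim, Empty.elim, Subsingleton.elim _ _⟩

theorem exists_splitEpi_of_sum {X Y J : Type} [AddCommGroup X] [Module Λ X] [AddCommGroup Y]
    [Module Λ Y] [IsLocalRing (Module.End Λ X)] [Nontrivial X] (s : Finset J)
    (f : J → (Y →ₗ[Λ] X)) (h : SplitEpi (∑ j ∈ s, f j)) : ∃ j ∈ s, SplitEpi (f j) := by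
  classical
  induction s using Finset.induction_on with
  | empty => exact absurd h (by simpa using not_splitEpi_zero)
  | insert a s ha ih =>
    rw [Finset.sum_insert ha] at h
    rcases splitEpi_or_splitEpi_of_add h with h | h
    · exact ⟨a, by simp, h⟩
    · obtain ⟨j, hj, hj'⟩ := ih h
      exact ⟨j, by simp [hj], hj'⟩

variable {X : Type} [AddCommGroup X] [Module Λ X]

/-- The non-split epimorphisms onto a module with local endomorphism ring form a subspace. -/
def nonSplitEpi (k : Type) [CommRing k] [Algebra k Λ] [Module k X] [IsScalarTower k Λ X]
    (Y : Type) [AddCommGroup Y] [Module Λ Y] [IsLocalRing (Module.End Λ X)] [Nontrivial X] :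
    Submodule k (Y →ₗ[Λ] X) where
  carrier := {f | ¬ SplitEpi f}
  add_mem' := fun ha hb h ↦ (splitEpi_or_splitEpi_of_add h).elim ha hb
  zero_mem' := not_splitEpi_zero
  smul_mem' := fun c f hf h ↦ hf <| by
    obtain ⟨s, hs⟩ := h
    refine ⟨s ∘ₗ (c • LinearMap.id), LinearMap.ext fun x ↦ ?_⟩
    refine Eq.trans ?_ (LinearMap.congr_fun hs x)
    simp only [LinearMap.comp_apply, LinearMap.smul_apply, LinearMap.id_apply]
    rw [← algebraMap_smul Λ c x, map_smul, map_smul, algebraMap_smul]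

theorem exists_rightAlmostSplit (k : Type) [CommRing k] [IsNoetherianRing k] [Algebra k Λ]
    [Module k M] [IsScalarTower k Λ M] [Module.Finite k M] [Module k X] [IsScalarTower k Λ X]
    [Module.Finite k X] [IsLocalRing (Module.End Λ X)] [Nontrivial X]
    (hadd : ∀ (Y : Type) [AddCommGroup Y] [Module Λ Y] [Module.Finite Λ Y], InAdd Λ M Y) :
    ∃ (J : Type) (_ : Finite J) (g : (J → M) →ₗ[Λ] X), RightAlmostSplit g := by
  have hnoeth : IsNoetherian k (M →ₗ[Λ] X) :=
    isNoetherian_of_injective (LinearMap.restrictScalarsₗ k Λ M X k)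
      (LinearMap.restrictScalars_injective k)
  obtain ⟨s, hs⟩ := hnoeth.noetherian (nonSplitEpi k M)
  have hmem : ∀ j : s, ¬ SplitEpi j.1 := fun j ↦ by
    have : j.1 ∈ nonSplitEpi k M := hs ▸ Submodule.subset_span j.2
    exact this
  let g : (s → M) →ₗ[Λ] X := ∑ j : s, j.1 ∘ₗ LinearMap.proj j
  have hlift : ∀ f : M →ₗ[Λ] X, ¬ SplitEpi f → ∃ l : M →ₗ[Λ] (s → M), g ∘ₗ l = f := by
    classical
    intro f hfs
    have hf : f ∈ Submodule.span k (s : Set (M →ₗ[Λ] X)) := hs ▸ hfs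
    clear hfs
    induction hf using Submodule.span_induction with
    | mem f hf =>
      refine ⟨LinearMap.single Λ (fun _ : s ↦ M) ⟨f, hf⟩, ?_⟩
      ext y
      simp only [g, LinearMap.comp_apply, LinearMap.sum_apply, LinearMap.proj_apply,
        LinearMap.single_apply]
      rw [Finset.sum_eq_single ⟨f, hf⟩]
      · simp
      · intro b _ hb
        simp [Pi.single_eq_of_ne hb]
      · simp
    | zero => exact ⟨0, by simp⟩
    | add a b _ _ ha hb =>
      obtain ⟨l, rfl⟩ := ha
      obtain ⟨l', rfl⟩ := hb
      exact ⟨l + l', LinearMap.comp_add _ _ _⟩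
    | smul c a _ ha =>
      obtain ⟨l, rfl⟩ := ha
      refine ⟨c • l, ?_⟩
      ext y
      simp
  refine ⟨s, inferInstance, g, ⟨fun h ↦ ?_, fun Y _ _ _ t ht ↦ ?_⟩⟩
  · obtain ⟨j, -, hj⟩ := exists_splitEpi_of_sum _ _ h
    exact hmem j hj.of_comp
  · obtain ⟨J, _, ι, κ, e⟩ := hadd Y
    have : ∀ j, ∃ l : M →ₗ[Λ] (s → M), g ∘ₗ l = t ∘ₗ κ j := fun j ↦
      hlift _ fun h ↦ ht h.of_comp
    choose l hl using this
    refine ⟨∑ j, l j ∘ₗ ι j, ?_⟩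
    ext y
    have hy := congrArg t (LinearMap.congr_fun e y)
    simp only [LinearMap.sum_apply, LinearMap.comp_apply, map_sum, LinearMap.id_apply] at hy ⊢
    exact (Finset.sum_congr rfl fun j _ ↦ LinearMap.congr_fun (hl j) (ι j y)).trans hy

theorem RightAlmostSplit.exists_rightMinimal [IsArtinianRing Λ] {B₀ : Type} [AddCommGroup B₀]
    [Module Λ B₀] [Module.Finite Λ B₀] {g₀ : B₀ →ₗ[Λ] X} (h₀ : RightAlmostSplit g₀) :
    ∃ (B : ModuleCat.{0} Λ) (g : B →ₗ[Λ] X), Module.Finite Λ B ∧ RightAlmostSplit g ∧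
      RightMinimal g := by
  suffices ∀ (ℓ : ℕ∞) (B₀ : Type) [AddCommGroup B₀] [Module Λ B₀] [Module.Finite Λ B₀]
      (g₀ : B₀ →ₗ[Λ] X), RightAlmostSplit g₀ → Module.length Λ B₀ = ℓ →
      ∃ (B : ModuleCat.{0} Λ) (g : B →ₗ[Λ] X), Module.Finite Λ B ∧ RightAlmostSplit g ∧
      RightMinimal g from this _ B₀ g₀ h₀ rfl
  intro ℓ
  induction ℓ using WellFoundedLT.induction with
  | ind ℓ ih =>
    intro B _ _ _ g hg hℓ
    subst hℓ
    by_cases hm : RightMinimal g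
    · exact ⟨ModuleCat.of Λ B, g, ‹_›, hg, hm⟩
    · simp only [RightMinimal, not_forall] at hm
      obtain ⟨u, hgu, hu⟩ := hm
      refine ih _ (Submodule.length_lt fun h ↦ hu (LinearMap.range_eq_top.mp h))
        (LinearMap.range u) (g ∘ₗ (LinearMap.range u).subtype)
        ⟨fun h ↦ hg.not_splitEpi h.of_comp, fun Y _ _ _ t ht ↦ ?_⟩ rfl
      obtain ⟨l, rfl⟩ := hg.exists_lift Y t ht
      refine ⟨u.rangeRestrict ∘ₗ l, ?_⟩
      conv_rhs => rw [← hgu]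
      rfl

theorem RightAlmostSplit.surjective {B : Type} [AddCommGroup B] [Module Λ B]
    {g : B →ₗ[Λ] X} (hg : RightAlmostSplit g) [Module.Finite Λ X]
    (hX : ¬ Module.Projective Λ X) : Surjective g := by
  obtain ⟨m, f, hf⟩ := Module.Finite.exists_fin' Λ X
  obtain ⟨l, hl⟩ := hg.exists_lift _ f fun ⟨s, hs⟩ ↦ hX (Module.Projective.of_split s f hs)
  intro x
  obtain ⟨y, rfl⟩ := hf x
  exact ⟨l y, LinearMap.congr_fun hl y⟩

section Kernel

variable {B : Type} [AddCommGroup B] [Module Λ B] [Module.Finite Λ B] [IsArtinianRing Λ]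
  {g : B →ₗ[Λ] X}

theorem RightAlmostSplit.exists_extension_ker (hg : RightAlmostSplit g) (hmin : RightMinimal g)
    (hsurj : Surjective g) (Y : Type) [AddCommGroup Y] [Module Λ Y] [Module.Finite Λ Y]
    (h : LinearMap.ker g →ₗ[Λ] Y) (hh : ¬ SplitMono h) :
    ∃ l : B →ₗ[Λ] Y, l ∘ₗ (LinearMap.ker g).subtype = h := by
  let D : Submodule Λ (Y × B) := LinearMap.range (h.prod (-(LinearMap.ker g).subtype))
  let a : Y →ₗ[Λ] (Y × B) ⧸ D := D.mkQ ∘ₗ LinearMap.inl Λ Y B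
  let b : B →ₗ[Λ] (Y × B) ⧸ D := D.mkQ ∘ₗ LinearMap.inr Λ Y B
  have hab : ∀ x : LinearMap.ker g, b x.1 = a (h x) := by
    intro x
    refine ((Submodule.Quotient.eq D).mpr ⟨-x, ?_⟩)
    simp
  have hD : D ≤ LinearMap.ker (g ∘ₗ LinearMap.snd Λ Y B) := by
    rintro _ ⟨x, rfl⟩
    simp
  let π : ((Y × B) ⧸ D) →ₗ[Λ] X := D.liftQ (g ∘ₗ LinearMap.snd Λ Y B) hD
  have hπ : Surjective π := fun x ↦ by
    obtain ⟨y, rfl⟩ := hsurj x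
    exact ⟨b y, by simp [π, b]⟩
  have hex : Function.Exact a π := by
    intro d
    obtain ⟨⟨y, z⟩, rfl⟩ := D.mkQ_surjective d
    refine ⟨fun hd ↦ ?_, ?_⟩
    · have hz : g z = 0 := by simpa [π] using hd
      refine ⟨y + h ⟨z, hz⟩, ?_⟩
      refine (Submodule.Quotient.eq D).mpr ⟨⟨z, hz⟩, ?_⟩
      simp
    · rintro ⟨y', hy'⟩
      rw [← hy']
      simp [π, a]
  have ha : Injective a := by
    rw [← LinearMap.ker_eq_bot, LinearMap.ker_eq_bot']
    intro y hy
    obtain ⟨x, hx⟩ := (Submodule.Quotient.mk_eq_zero D).mp hy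
    have h1 : h x = y := congrArg Prod.fst hx
    have h2 : -(x : B) = 0 := congrArg Prod.snd hx
    have h3 : x = 0 := Subtype.ext (neg_eq_zero.mp h2)
    rw [← h1, h3, map_zero]
  by_cases hs : SplitEpi π
  · obtain ⟨r, hr⟩ := splitMono_of_exact ha hex hs
    refine ⟨r ∘ₗ b, LinearMap.ext fun x ↦ ?_⟩
    exact (congrArg r (hab x)).trans (LinearMap.congr_fun hr (h x))
  · exfalso
    apply hh
    obtain ⟨l, hl⟩ := hg.exists_lift _ π hs
    have hgl : ∀ d, g (l d) = π d := LinearMap.congr_fun hl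
    have hu : Surjective (l ∘ₗ b) := hmin _ (LinearMap.ext fun y ↦ by simp [hgl, π, b])
    have huinj : Injective (l ∘ₗ b) :=
      (IsNoetherian.bijective_of_surjective_endomorphism _ hu).1
    let c : Y →ₗ[Λ] LinearMap.ker g := LinearMap.codRestrict _ (l ∘ₗ a) fun y ↦ by
      simp [hgl, π, a]
    have hc : ∀ x, (c (h x) : B) = l (b x.1) := fun x ↦ by rw [hab]; rfl
    have hcinj : Injective (c ∘ₗ h) := by
      intro x y hxy
      have := congrArg Subtype.val hxy
      simp only [LinearMap.comp_apply, hc] at this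
      exact Subtype.ext (huinj this)
    exact splitMono_of_isUnit_comp h c ((Module.End.isUnit_iff _).mpr
      (IsArtinian.bijective_of_injective_endomorphism _ hcinj))

theorem RightAlmostSplit.indecMod_ker (hg : RightAlmostSplit g) (hmin : RightMinimal g)
    (hsurj : Surjective g) : IndecMod Λ (LinearMap.ker g) := by
  have hex : Function.Exact (LinearMap.ker g).subtype g := LinearMap.exact_subtype_ker_map g
  refine ⟨?_, fun N₁ N₂ hc ↦ ?_⟩
  · by_contra hn
    have := not_nontrivial_iff_subsingleton.mp hn
    exact hg.not_splitEpi (splitEpi_of_exact hsurj hex ⟨0, Subsingleton.elim _ _⟩)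
  · by_contra! hne
    have key : ∀ (N₁ N₂ : Submodule Λ (LinearMap.ker g)) (hc : IsCompl N₁ N₂), N₂ ≠ ⊥ →
        ¬ SplitMono (N₁.projectionOnto N₂ hc) := by
      rintro N₁ N₂ hc hN ⟨r, hr⟩
      refine hN ((Submodule.eq_bot_iff _).mpr fun x hx ↦ ?_)
      have := LinearMap.congr_fun hr x
      rwa [LinearMap.comp_apply, (Submodule.projectionOnto_apply_eq_zero_iff hc).mpr hx, map_zero,
        LinearMap.id_apply, eq_comm] at this
    obtain ⟨l₁, h₁⟩ := hg.exists_extension_ker hmin hsurj _ _ (key N₁ N₂ hc hne.2)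
    obtain ⟨l₂, h₂⟩ := hg.exists_extension_ker hmin hsurj _ _ (key N₂ N₁ hc.symm hne.1)
    refine hg.not_splitEpi (splitEpi_of_exact hsurj hex
      ⟨N₁.subtype ∘ₗ l₁ + N₂.subtype ∘ₗ l₂, ?_⟩)
    rw [LinearMap.add_comp, LinearMap.comp_assoc, LinearMap.comp_assoc, h₁, h₂]
    exact Submodule.projection_add_projection_eq_id hc

end Kernel

end AlmostSplit

section AuslanderAlgebra

variable {Λ M : Type} [Ring Λ] [AddCommGroup M] [Module Λ M]

section Hom

variable {X Y : Type} [AddCommGroup X] [Module Λ X] [AddCommGroup Y] [Module Λ Y]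

/-- Precomposition with `f`, as a map of modules over `End M`. -/
def precomp (M : Type) [AddCommGroup M] [Module Λ M] (f : X →ₗ[Λ] Y) :
    (Y →ₗ[Λ] M) →ₗ[Module.End Λ M] (X →ₗ[Λ] M) where
  toFun φ := φ ∘ₗ f
  map_add' _ _ := LinearMap.add_comp _ _ _
  map_smul' _ _ := rfl

@[simp]
theorem precomp_apply (f : X →ₗ[Λ] Y) (φ : Y →ₗ[Λ] M) : precomp M f φ = φ ∘ₗ f := rfl

theorem precomp_injective {f : X →ₗ[Λ] Y} (hf : Surjective f) : Injective (precomp M f) :=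
  fun _ _ h ↦ (LinearMap.cancel_right hf).mp h

theorem InAdd.exists_retract (h : InAdd Λ M Y) :
    ∃ (J : Type) (_ : Finite J) (i : (Y →ₗ[Λ] M) →ₗ[Module.End Λ M] (J → Module.End Λ M))
      (r : (J → Module.End Λ M) →ₗ[Module.End Λ M] (Y →ₗ[Λ] M)), r ∘ₗ i = LinearMap.id := by
  obtain ⟨J, _, ι, κ, e⟩ := h
  refine ⟨J, inferInstance, LinearMap.pi fun j ↦
    { toFun := fun φ ↦ φ ∘ₗ κ j, map_add' := fun φ ψ ↦ LinearMap.add_comp _ _ _,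
      map_smul' := fun _ _ ↦ rfl },
    Fintype.linearCombination (Module.End Λ M) ι, LinearMap.ext fun φ ↦ LinearMap.ext fun y ↦ ?_⟩
  have := congrArg φ (LinearMap.congr_fun e y)
  simpa [Fintype.linearCombination_apply, LinearMap.sum_apply] using this

theorem InAdd.projective (h : InAdd Λ M Y) : Module.Projective (Module.End Λ M) (Y →ₗ[Λ] M) := by
  obtain ⟨J, _, i, r, hir⟩ := h.exists_retract
  exact Module.Projective.of_split i r hir

theorem InAdd.finite (h : InAdd Λ M Y) : Module.Finite (Module.End Λ M) (Y →ₗ[Λ] M) := by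
  obtain ⟨J, _, i, r, hir⟩ := h.exists_retract
  exact Module.Finite.of_surjective r fun φ ↦ ⟨i φ, LinearMap.congr_fun hir φ⟩

/-- Every `End M`-linear map between modules `Hom(Y, M)` and `Hom(X, M)` is a precomposition. -/
theorem InAdd.exists_eq_precomp (h : InAdd Λ M Y)
    (θ : (Y →ₗ[Λ] M) →ₗ[Module.End Λ M] (X →ₗ[Λ] M)) :
    ∃ f : X →ₗ[Λ] Y, θ = precomp M f := by
  obtain ⟨J, _, ι, κ, e⟩ := h
  refine ⟨∑ j, κ j ∘ₗ θ (ι j), LinearMap.ext fun φ ↦ ?_⟩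
  have hφ : φ = ∑ j, (φ ∘ₗ κ j : Module.End Λ M) • ι j := by
    ext y
    simpa [LinearMap.sum_apply] using (congrArg φ (LinearMap.congr_fun e y)).symm
  conv_lhs => rw [hφ, map_sum]
  simp_rw [map_smul]
  ext x
  simp [LinearMap.sum_apply]

theorem eq_top_of_splitMono_mem (N : Submodule (Module.End Λ M) (Y →ₗ[Λ] M)) {φ : Y →ₗ[Λ] M}
    (hφ : φ ∈ N) (hs : SplitMono φ) : N = ⊤ := by
  obtain ⟨r, hr⟩ := hs
  refine eq_top_iff.mpr fun ψ _ ↦ ?_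
  have : ψ = (ψ ∘ₗ r : Module.End Λ M) • φ := by
    ext y
    simpa using (congrArg ψ (LinearMap.congr_fun hr y)).symm
  rw [this]
  exact N.smul_mem _ hφ

/-- The submodule of `Hom(Y, M)` of maps which are not split monomorphisms. -/
def nonSplitMono (M Y : Type) [AddCommGroup M] [Module Λ M] [AddCommGroup Y] [Module Λ Y]
    [IsLocalRing (Module.End Λ Y)] [Nontrivial Y] :
    Submodule (Module.End Λ M) (Y →ₗ[Λ] M) where
  carrier := {f | ¬ SplitMono f}
  add_mem' := fun ha hb h ↦ (splitMono_or_splitMono_of_add h).elim ha hb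
  zero_mem' := not_splitMono_zero
  smul_mem' := fun a _ hf h ↦ hf (SplitMono.of_comp (h := a) h)

variable [IsLocalRing (Module.End Λ Y)] [Nontrivial Y]

theorem mem_nonSplitMono {φ : Y →ₗ[Λ] M} : φ ∈ nonSplitMono M Y ↔ ¬ SplitMono φ := Iff.rfl

theorem isCoatom_nonSplitMono {ι : Y →ₗ[Λ] M} (hι : SplitMono ι) :
    IsCoatom (nonSplitMono (Λ := Λ) M Y) := by
  refine ⟨fun h ↦ ?_, fun N hN ↦ ?_⟩
  · have : ι ∈ nonSplitMono M Y := h ▸ Submodule.mem_top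
    exact this hι
  · obtain ⟨φ, hφ, hφ'⟩ := SetLike.exists_of_lt hN
    exact eq_top_of_splitMono_mem N hφ (not_not.mp hφ')

theorem eq_top_of_sup_nonSplitMono_eq_top {ι : Y →ₗ[Λ] M} (hι : SplitMono ι)
    (N : Submodule (Module.End Λ M) (Y →ₗ[Λ] M)) (h : N ⊔ nonSplitMono M Y = ⊤) : N = ⊤ := by
  by_contra hN
  have hle : N ≤ nonSplitMono M Y := fun φ hφ hs ↦ hN (eq_top_of_splitMono_mem N hφ hs)
  rw [sup_eq_right.mpr hle] at h
  exact (isCoatom_nonSplitMono hι).1 h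

theorem ker_eq_nonSplitMono {S : Type} [AddCommGroup S] [Module (Module.End Λ M) S]
    [IsSimpleModule (Module.End Λ M) S] {ι : Y →ₗ[Λ] M} (hι : SplitMono ι)
    {e : (Y →ₗ[Λ] M) →ₗ[Module.End Λ M] S} (he : Surjective e) :
    LinearMap.ker e = nonSplitMono M Y := by
  have hc : IsCoatom (LinearMap.ker e) := LinearMap.isCoatom_ker_of_surjective he
  refine (hc.le_iff_eq (isCoatom_nonSplitMono hι).1).mp (fun φ hφ hs ↦ ?_) |>.symm
  exact hc.1 (eq_top_of_splitMono_mem _ hφ hs)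

end Hom

/-- The image in `S` of the action of a fixed element, as a map out of `Hom(X, M)`. -/
def evalHom {X S : Type} [AddCommGroup X] [Module Λ X] [AddCommGroup S]
    [Module (Module.End Λ M) S] (ρ : M →ₗ[Λ] X) (s : S) :
    (X →ₗ[Λ] M) →ₗ[Module.End Λ M] S where
  toFun φ := (φ ∘ₗ ρ : Module.End Λ M) • s
  map_add' φ ψ := by rw [LinearMap.add_comp]; exact add_smul _ _ _
  map_smul' a φ := mul_smul a (φ ∘ₗ ρ : Module.End Λ M) s

section Injective

variable {X : Type} [AddCommGroup X] [Module Λ X]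

theorem injective_of_projective [Module.Finite Λ X] (hself : Module.Injective Λ Λ)
    [Module.Projective Λ X] : Module.Injective Λ X := by
  obtain ⟨m, f, hf⟩ := Module.Finite.exists_fin' Λ X
  obtain ⟨s, hs⟩ := Module.projective_lifting_property f LinearMap.id hf
  refine ⟨fun Y Z _ _ _ _ i hi t ↦ ?_⟩
  obtain ⟨h, hh⟩ := Module.Injective.out (Q := Fin m → Λ) i hi (s ∘ₗ t)
  exact ⟨f ∘ₗ h, fun y ↦ by
    rw [LinearMap.comp_apply, hh]
    exact LinearMap.congr_fun hs (t y)⟩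

/-- A nonzero Artinian injective module with local endomorphism ring has a nonzero submodule
contained in all the others. -/
theorem exists_least_ne_bot [IsArtinian Λ X] [Nontrivial X] [IsLocalRing (Module.End Λ X)]
    (hinj : Module.Injective Λ X) :
    ∃ N : Submodule Λ X, N ≠ ⊥ ∧ ∀ N' : Submodule Λ X, N' ≠ ⊥ → N ≤ N' := by
  have huniform : ∀ N₁ N₂ : Submodule Λ X, N₁ ≠ ⊥ → N₂ ≠ ⊥ → N₁ ⊓ N₂ ≠ ⊥ := by
    intro N₁ N₂ h₁ h₂ h
    have hj : Injective (N₁.subtype.coprod N₂.subtype) := by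
      rw [← LinearMap.ker_eq_bot, LinearMap.ker_coprod_of_disjoint_range]
      · simp
      · simpa using disjoint_iff.mpr h
    obtain ⟨u, hu⟩ := hinj.out _ hj (N₁.subtype ∘ₗ LinearMap.fst Λ N₁ N₂)
    have hu₁ : ∀ x ∈ N₁, u x = x := fun x hx ↦ by simpa using hu (⟨x, hx⟩, 0)
    have hu₂ : ∀ x ∈ N₂, u x = 0 := fun x hx ↦ by simpa using hu (0, ⟨x, hx⟩)
    rcases IsLocalRing.isUnit_or_isUnit_of_add_one (R := Module.End Λ X)
      (add_sub_cancel u 1) with hunit | hunit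
    · rw [Module.End.isUnit_iff] at hunit
      refine h₂ ((Submodule.eq_bot_iff _).mpr fun x hx ↦ hunit.1 ?_)
      rw [hu₂ x hx, map_zero]
    · rw [Module.End.isUnit_iff] at hunit
      refine h₁ ((Submodule.eq_bot_iff _).mpr fun x hx ↦ hunit.1 ?_)
      rw [map_zero]
      simp [hu₁ x hx]
  obtain ⟨N, hN, hmin⟩ := IsArtinian.set_has_minimal {N : Submodule Λ X | N ≠ ⊥}
    ⟨⊤, top_ne_bot⟩
  refine ⟨N, hN, fun N' hN' ↦ ?_⟩
  have h := hmin (N ⊓ N') (huniform _ _ hN hN')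
  by_contra hle
  exact h (inf_lt_left.mpr hle)

theorem pdLE1_of_injective [Module.Finite Λ X] [IsArtinianRing Λ] [Nontrivial X]
    [IsLocalRing (Module.End Λ X)] (hinj : Module.Injective Λ X)
    (hadd : ∀ (Y : Type) [AddCommGroup Y] [Module Λ Y] [Module.Finite Λ Y], InAdd Λ M Y)
    {S : Type} [AddCommGroup S] [Module (Module.End Λ M) S]
    {e : (X →ₗ[Λ] M) →ₗ[Module.End Λ M] S} (he : Surjective e)
    (hker : LinearMap.ker e = nonSplitMono M X) : PdLE1 (Module.End Λ M) S := by
  obtain ⟨N, hN, hleast⟩ := exists_least_ne_bot hinj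
  refine ⟨ModuleCat.of _ (X →ₗ[Λ] M), ModuleCat.of _ ((X ⧸ N) →ₗ[Λ] M), precomp M N.mkQ, e,
    (hadd X).projective, (hadd (X ⧸ N)).projective, precomp_injective N.mkQ_surjective, he, ?_⟩
  intro φ
  rw [← LinearMap.mem_ker, hker, mem_nonSplitMono]
  refine ⟨fun hφ ↦ ?_, ?_⟩
  · have hφker : LinearMap.ker φ ≠ ⊥ := fun h ↦ hφ <| by
      obtain ⟨r, hr⟩ := hinj.out φ (LinearMap.ker_eq_bot.mp h) LinearMap.id
      exact ⟨r, LinearMap.ext hr⟩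
    exact ⟨N.liftQ φ (hleast _ hφker), N.liftQ_mkQ φ _⟩
  · rintro ⟨ψ, rfl⟩ ⟨r, hr⟩
    refine hN ((Submodule.eq_bot_iff _).mpr fun x hx ↦ ?_)
    have hx' : N.mkQ x = 0 := (Submodule.Quotient.mk_eq_zero N).mpr hx
    have := LinearMap.congr_fun hr x
    rw [precomp_apply, LinearMap.comp_apply, LinearMap.comp_apply, hx', map_zero, map_zero] at this
    exact this.symm

end Injective

end AuslanderAlgebra

section Descent

variable {R : Type} [Ring R] {X Y Z : Type} [AddCommGroup X] [Module R X] [AddCommGroup Y]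
  [Module R Y] [AddCommGroup Z] [Module R Z]

theorem exists_comp_eq_of_ker_le_ker {e : X →ₗ[R] Y} (he : Surjective e) {f : X →ₗ[R] Z}
    (h : LinearMap.ker e ≤ LinearMap.ker f) : ∃ i : Y →ₗ[R] Z, i ∘ₗ e = f := by
  refine ⟨(LinearMap.ker e).liftQ f h ∘ₗ (e.quotKerEquivOfSurjective he).symm,
    LinearMap.ext fun x ↦ ?_⟩
  have : (e.quotKerEquivOfSurjective he).symm (e x) = (LinearMap.ker e).mkQ x := by
    rw [LinearEquiv.symm_apply_eq]
    rfl
  simp [this]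

theorem not_pdLE1_of_not_projective_ker [Module.Projective R X] {p : X →ₗ[R] Y}
    (hp : Surjective p) (hsup : ∀ N : Submodule R X, N ⊔ LinearMap.ker p = ⊤ → N = ⊤)
    (hker : ¬ Module.Projective R (LinearMap.ker p)) : ¬ PdLE1 R Y := by
  rintro ⟨P₀, P₁, d, e, _, _, hd, he, hde⟩
  obtain ⟨a, ha⟩ := Module.projective_lifting_property p e hp
  have hpa : ∀ x, p (a x) = e x := LinearMap.congr_fun ha
  have hsurj : Surjective a := by
    refine LinearMap.range_eq_top.mp (hsup _ (eq_top_iff.mpr fun x _ ↦ ?_))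
    obtain ⟨y, hy⟩ := he (p x)
    refine Submodule.mem_sup.mpr ⟨a y, ⟨y, rfl⟩, x - a y, ?_, add_sub_cancel _ _⟩
    rw [LinearMap.mem_ker, map_sub, hpa, hy, sub_self]
  obtain ⟨s, hs⟩ := Module.projective_lifting_property a LinearMap.id hsurj
  have has : ∀ x, a (s x) = x := LinearMap.congr_fun hs
  let dd : P₁ ≃ₗ[R] LinearMap.range d := LinearEquiv.ofInjective d hd
  have hsmem : ∀ x : LinearMap.ker p, s x ∈ LinearMap.range d := fun x ↦ by
    refine (hde _).mp ?_
    rw [← hpa, has]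
    exact x.2
  have hamem : ∀ y, a (d y) ∈ LinearMap.ker p := fun y ↦ by
    rw [LinearMap.mem_ker, hpa]
    exact (hde _).mpr ⟨y, rfl⟩
  refine hker (Module.Projective.of_split
    (dd.symm.toLinearMap ∘ₗ (s ∘ₗ (LinearMap.ker p).subtype).codRestrict _ hsmem)
    ((a ∘ₗ d).codRestrict _ hamem) (LinearMap.ext fun x ↦ Subtype.ext ?_))
  have : d (dd.symm ⟨s x, hsmem x⟩) = s x :=
    congrArg Subtype.val (dd.apply_symm_apply ⟨s x, hsmem x⟩)
  exact (congrArg a this).trans (has x)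

end Descent

section AlmostSplit

variable {Λ M : Type} [Ring Λ] [AddCommGroup M] [Module Λ M]
  {X B : Type} [AddCommGroup X] [Module Λ X] [AddCommGroup B] [Module Λ B] {g : B →ₗ[Λ] X}

theorem exact_precomp (hsurj : Surjective g) :
    Function.Exact (precomp M g) (precomp M (LinearMap.ker g).subtype) := by
  intro φ
  refine ⟨fun h ↦ ?_, ?_⟩
  · obtain ⟨i, hi⟩ := exists_comp_eq_of_ker_le_ker (f := φ) hsurj fun x hx ↦
      LinearMap.congr_fun h ⟨x, hx⟩
    exact ⟨i, hi⟩
  · rintro ⟨ψ, rfl⟩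
    ext x
    simp

theorem RightAlmostSplit.range_precomp_ker_subtype [Module.Finite Λ B] [IsArtinianRing Λ]
    [Module.Finite Λ M] (hg : RightAlmostSplit g) (hmin : RightMinimal g) (hsurj : Surjective g)
    [IsLocalRing (Module.End Λ (LinearMap.ker g))] [Nontrivial (LinearMap.ker g)] :
    LinearMap.range (precomp M (LinearMap.ker g).subtype) = nonSplitMono M (LinearMap.ker g) := by
  ext φ
  refine ⟨?_, fun h ↦ hg.exists_extension_ker hmin hsurj M φ h⟩
  rintro ⟨ψ, rfl⟩ h
  exact hg.not_splitEpi
    (splitEpi_of_exact hsurj (LinearMap.exact_subtype_ker_map g) (SplitMono.of_comp h))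

theorem RightAlmostSplit.exists_extension_of_mem_jacobson_smul_top [Nontrivial X]
    [Module.Finite Λ M] (hg : RightAlmostSplit g) {ι : X →ₗ[Λ] M} {ρ : M →ₗ[Λ] X}
    (hρι : ρ ∘ₗ ι = LinearMap.id) {Z : Type} [AddCommGroup Z] [Module (Module.End Λ M) Z] {y : Z}
    (hy : y ∈ Ring.jacobson (Module.End Λ M) • (⊤ : Submodule (Module.End Λ M) Z)) :
    ∃ l : (B →ₗ[Λ] M) →ₗ[Module.End Λ M] Z, l ∘ₗ precomp M g = evalHom ρ y := by
  induction hy using Submodule.smul_induction_on' with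
  | smul j hj z _ =>
    have hns : ¬ SplitEpi (ρ ∘ₗ j) := by
      rintro ⟨σ, hσ⟩
      have hmem : (ι ∘ₗ ρ) * j * (σ ∘ₗ ρ) ∈ Ring.jacobson (Module.End Λ M) :=
        Ideal.mul_mem_right _ _ (Ideal.mul_mem_left _ _ hj)
      have heq : (ι ∘ₗ ρ) * j * (σ ∘ₗ ρ) = ι ∘ₗ ρ :=
        LinearMap.ext fun x ↦ congrArg ι (LinearMap.congr_fun hσ (ρ x))
      rw [heq] at hmem
      have hzero := eq_zero_of_mem_jacobson_of_isIdempotentElem hmem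
        (LinearMap.ext fun x ↦ congrArg ι (LinearMap.congr_fun hρι (ρ x)))
      obtain ⟨x, hx⟩ := exists_ne (0 : X)
      have hι : ∀ x, ρ (ι x) = x := LinearMap.congr_fun hρι
      refine hx ?_
      have := congrArg ρ (LinearMap.congr_fun hzero (ι x))
      simpa [hι] using this
    obtain ⟨h, hh⟩ := hg.exists_lift M _ hns
    refine ⟨evalHom h z, LinearMap.ext fun ψ ↦ ?_⟩
    change (ψ ∘ₗ (g ∘ₗ h) : Module.End Λ M) • z = (ψ ∘ₗ ρ : Module.End Λ M) • j • z
    rw [hh, smul_smul]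
    rfl
  | add y hy z hz ihy ihz =>
    obtain ⟨l, hl⟩ := ihy
    obtain ⟨l', hl'⟩ := ihz
    refine ⟨l + l', ?_⟩
    rw [LinearMap.add_comp, hl, hl']
    exact LinearMap.ext fun ψ ↦ (smul_add _ _ _).symm

variable [IsLocalRing (Module.End Λ X)] [Nontrivial X]
  {S : Type} [AddCommGroup S] [Module (Module.End Λ M) S]
  {e : (X →ₗ[Λ] M) →ₗ[Module.End Λ M] S}

theorem RightAlmostSplit.not_splitMono_of_comp_eq (hg : RightAlmostSplit g)
    (hB : InAdd Λ M B) (he : Surjective e) (hker : LinearMap.ker e = nonSplitMono M X)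
    {ι : X →ₗ[Λ] M} (hι : SplitMono ι) {E : Type} [AddCommGroup E] [Module (Module.End Λ M) E]
    {π : (B →ₗ[Λ] M) →ₗ[Module.End Λ M] E} {i : S →ₗ[Module.End Λ M] E}
    (hi : i ∘ₗ e = π ∘ₗ precomp M g) : ¬ SplitMono i := by
  rintro ⟨r, hr⟩
  have := hB.projective
  obtain ⟨θ, hθ⟩ := Module.projective_lifting_property e (r ∘ₗ π) he
  obtain ⟨h, rfl⟩ := hB.exists_eq_precomp θ
  have hmem : ι ∘ₗ (LinearMap.id - g ∘ₗ h) ∈ nonSplitMono M X := by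
    have h₁ : e (ι ∘ₗ g ∘ₗ h) = r (π (ι ∘ₗ g)) := LinearMap.congr_fun hθ (ι ∘ₗ g)
    have h₂ : i (e ι) = π (ι ∘ₗ g) := LinearMap.congr_fun hi ι
    have h₃ : r (i (e ι)) = e ι := LinearMap.congr_fun hr (e ι)
    rw [← hker, LinearMap.mem_ker, LinearMap.comp_sub, LinearMap.comp_id, map_sub, h₁, ← h₂, h₃,
      sub_self]
  rcases IsLocalRing.isUnit_or_isUnit_of_add_one (R := Module.End Λ X)
    (add_sub_cancel (g ∘ₗ h) 1) with hu | hu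
  · exact hg.not_splitEpi (splitEpi_of_isUnit_comp _ _ hu)
  · obtain ⟨ρ, hρ⟩ := hι
    refine hmem (splitMono_of_isUnit_comp _ ρ ?_)
    rw [← LinearMap.comp_assoc, hρ]
    exact hu

theorem RightAlmostSplit.surjective_of_comp_eq [Module.Finite Λ B] [IsArtinianRing Λ]
    (hg : RightAlmostSplit g) (hmin : RightMinimal g) (hB : InAdd Λ M B)
    {ι : X →ₗ[Λ] M} (hι : SplitMono ι)
    {u : Module.End (Module.End Λ M)
      ((B →ₗ[Λ] M) ⧸ (nonSplitMono (Λ := Λ) M X).map (precomp M g))}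
    (hu : u ∘ₗ Submodule.mkQ _ ∘ₗ precomp M g = Submodule.mkQ _ ∘ₗ precomp M g) :
    Surjective u := by
  let N := (nonSplitMono (Λ := Λ) M X).map (precomp M g)
  have := hB.projective
  obtain ⟨θ, hθ⟩ := Module.projective_lifting_property N.mkQ (u ∘ₗ N.mkQ) N.mkQ_surjective
  obtain ⟨h, rfl⟩ := hB.exists_eq_precomp θ
  obtain ⟨ρ, hρ⟩ := hι
  have hmem : (ι ∘ₗ g) ∘ₗ h - ι ∘ₗ g ∈ N := by
    rw [← Submodule.ker_mkQ N, LinearMap.mem_ker, map_sub, sub_eq_zero]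
    exact (LinearMap.congr_fun hθ (ι ∘ₗ g)).trans (LinearMap.congr_fun hu ι)
  obtain ⟨σ, hσ, hσg⟩ := hmem
  have hgh : g ∘ₗ h = (1 + ρ ∘ₗ σ) ∘ₗ g := by
    have h₁ := congrArg (fun φ ↦ ρ ∘ₗ φ) hσg
    simp only [precomp_apply, LinearMap.comp_sub, ← LinearMap.comp_assoc, hρ] at h₁
    rw [LinearMap.add_comp, h₁]
    simp [Module.End.one_eq_id]
  have hunit : IsUnit (1 + ρ ∘ₗ σ : Module.End Λ X) := by
    rcases IsLocalRing.isUnit_or_isUnit_of_add_one (R := Module.End Λ X)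
      (add_neg_cancel_right 1 (ρ ∘ₗ σ)) with h' | h'
    · exact h'
    · exact absurd (splitMono_of_isUnit_comp _ _ ((IsUnit.neg_iff _).mp h')) hσ
  obtain ⟨v, hv⟩ := hunit.exists_left_inv
  obtain ⟨w, hw⟩ := hunit.exists_right_inv
  obtain ⟨c, hc⟩ := hg.exists_lift B (v ∘ₗ g) (by
    rintro ⟨s, hs⟩
    have hvw : v = w := left_inv_eq_right_inv hv hw
    refine hg.not_splitEpi ⟨s ∘ₗ v, ?_⟩
    have hs' : v * (g ∘ₗ s) = 1 := hs
    calc g ∘ₗ s ∘ₗ v = ((1 + ρ ∘ₗ σ) * v) * (g ∘ₗ s) * v := by rw [hvw, hw, one_mul]; rfl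
      _ = (1 + ρ ∘ₗ σ) * (v * (g ∘ₗ s)) * v := by rw [mul_assoc (1 + ρ ∘ₗ σ)]
      _ = LinearMap.id := by rw [hs', mul_one, hvw, hw]; rfl)
  have hch : g ∘ₗ (c ∘ₗ h) = g := by
    rw [← LinearMap.comp_assoc, hc, LinearMap.comp_assoc, hgh, ← LinearMap.comp_assoc]
    change (v * (1 + ρ ∘ₗ σ)) ∘ₗ g = g
    rw [hv]
    rfl
  have hinj : Injective h := Injective.of_comp (f := c)
    (IsNoetherian.injective_of_surjective_endomorphism (c ∘ₗ h) (hmin _ hch))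
  obtain ⟨h', hh'⟩ := ((Module.End.isUnit_iff h).mpr
    (IsArtinian.bijective_of_injective_endomorphism h hinj)).exists_left_inv
  intro x
  obtain ⟨φ, rfl⟩ := N.mkQ_surjective x
  refine ⟨N.mkQ (φ ∘ₗ h'), ?_⟩
  refine (LinearMap.congr_fun hθ (φ ∘ₗ h')).symm.trans ?_
  change N.mkQ (φ ∘ₗ (h' * h)) = N.mkQ φ
  rw [hh']
  rfl

/-- The almost split sequence starting at the simple module `S` attached to `X`, obtained from
the minimal right almost split map ending at `X`. -/
theorem RightAlmostSplit.exists_isAlmostSplitSeq [Module.Finite Λ B] [IsArtinianRing Λ]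
    [Module.Finite Λ M] [IsArtinianRing (Module.End Λ M)] [IsSimpleModule (Module.End Λ M) S]
    (hg : RightAlmostSplit g) (hmin : RightMinimal g) (hsurj : Surjective g)
    (hB : InAdd Λ M B) (he : Surjective e) {ι : X →ₗ[Λ] M} (hι : SplitMono ι)
    {W : Type} [AddCommGroup W] [Module (Module.End Λ M) W]
    {c : (B →ₗ[Λ] M) →ₗ[Module.End Λ M] W} (hc : Surjective c)
    (hgc : Function.Exact (precomp M g) c) :
    ∃ (E : ModuleCat.{0} (Module.End Λ M)) (i : S →ₗ[Module.End Λ M] E)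
      (q : E →ₗ[Module.End Λ M] W), IsAlmostSplitSeq (Module.End Λ M) i q := by
  have hker := ker_eq_nonSplitMono hι he
  have := hB.finite
  let N := (nonSplitMono (Λ := Λ) M X).map (precomp M g)
  have hN : ∀ ψ, ψ ∘ₗ g ∈ N ↔ e ψ = 0 := fun ψ ↦ by
    rw [← LinearMap.mem_ker, hker]
    exact ⟨fun ⟨ψ', h, h'⟩ ↦ precomp_injective hsurj h' ▸ h, fun h ↦ ⟨ψ, h, rfl⟩⟩
  obtain ⟨i, hi⟩ := exists_comp_eq_of_ker_le_ker (f := N.mkQ ∘ₗ precomp M g) he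
    fun ψ hψ ↦ (Submodule.Quotient.mk_eq_zero N).mpr ((hN ψ).mpr hψ)
  have hi' : ∀ ψ, i (e ψ) = N.mkQ (ψ ∘ₗ g) := LinearMap.congr_fun hi
  have hNc : N ≤ LinearMap.ker c := by
    rintro _ ⟨ψ, _, rfl⟩
    exact (hgc _).mpr ⟨ψ, rfl⟩
  let q := N.liftQ c hNc
  have hinj : Injective i := by
    refine (injective_iff_map_eq_zero i).mpr fun s hs ↦ ?_
    obtain ⟨ψ, rfl⟩ := he s
    rw [hi'] at hs
    exact (hN ψ).mp ((Submodule.Quotient.mk_eq_zero N).mp hs)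
  have hq : Surjective q := fun w ↦ by
    obtain ⟨φ, rfl⟩ := hc w
    exact ⟨N.mkQ φ, rfl⟩
  have hiq : Function.Exact i q := fun x ↦ by
    obtain ⟨φ, rfl⟩ := N.mkQ_surjective x
    refine ⟨fun h ↦ ?_, ?_⟩
    · obtain ⟨ψ, rfl⟩ := (hgc φ).mp h
      exact ⟨e ψ, hi' ψ⟩
    · rintro ⟨s, hs⟩
      obtain ⟨ψ, rfl⟩ := he s
      rw [← hs, hi']
      exact (hgc _).mpr ⟨ψ, rfl⟩
  have hnot : ¬ SplitMono i := hg.not_splitMono_of_comp_eq hB he hker hι hi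
  have hleft : ∀ (Z : Type) [AddCommGroup Z] [Module (Module.End Λ M) Z]
      [Module.Finite (Module.End Λ M) Z] (t : S →ₗ[Module.End Λ M] Z), ¬ SplitMono t →
      ∃ l : ((B →ₗ[Λ] M) ⧸ N) →ₗ[Module.End Λ M] Z, l ∘ₗ i = t := by
    intro Z _ _ _ t ht
    obtain ⟨ρ, hρ⟩ := hι
    have hmem := not_not.mp (mt (splitMono_of_notMem_jacobson_smul_top t (e ι)) ht)
    obtain ⟨l, hl⟩ := hg.exists_extension_of_mem_jacobson_smul_top hρ hmem
    have hlψ : ∀ ψ, l (ψ ∘ₗ g) = t (e ψ) := fun ψ ↦ by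
      refine (LinearMap.congr_fun hl ψ).trans ?_
      change (ψ ∘ₗ ρ : Module.End Λ M) • t (e ι) = _
      rw [← map_smul, ← map_smul]
      change t (e (ψ ∘ₗ (ρ ∘ₗ ι))) = _
      rw [hρ, LinearMap.comp_id]
    have hNl : N ≤ LinearMap.ker l := by
      rintro _ ⟨ψ, hψ, rfl⟩
      rw [← hker] at hψ
      exact (hlψ ψ).trans (by rw [LinearMap.mem_ker.mp hψ, map_zero])
    refine ⟨N.liftQ l hNl, LinearMap.ext fun s ↦ ?_⟩
    obtain ⟨ψ, rfl⟩ := he s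
    rw [LinearMap.comp_apply, hi']
    exact hlψ ψ
  have hleftmin : ∀ u : Module.End (Module.End Λ M) ((B →ₗ[Λ] M) ⧸ N), u ∘ₗ i = i →
      Surjective u := fun u hu ↦
    hg.surjective_of_comp_eq hmin hB hι (by
      change u ∘ₗ (N.mkQ ∘ₗ precomp M g) = N.mkQ ∘ₗ precomp M g
      rw [← hi, ← LinearMap.comp_assoc, hu])
  exact ⟨ModuleCat.of _ ((B →ₗ[Λ] M) ⧸ N), i, q, ⟨hinj, hq, hiq⟩, hnot,
    fun h ↦ hnot (splitMono_of_exact hinj hiq h),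
    fun Z _ _ _ t ht ↦ rightAlmostSplit_of_leftAlmostSplit hq hiq hleft hleftmin Z t ht,
    fun Z _ _ _ t ht ↦ hleft Z t ht⟩

end AlmostSplit

theorem statement16
    (Λ : Type) [Ring Λ] [Algebra k Λ] [Module.Finite k Λ] [IsArtinianRing k]
    -- Λ is self-injective of finite representation type
    (hself : Module.Injective Λ Λ) (hrep : FiniteRepType Λ)
    -- M is a basic representation generator of mod-Λ
    (n : ℕ) (V : Fin n → ModuleCat.{0} Λ)
    (hVfg : ∀ i, Module.Finite Λ (V i)) (hVind : ∀ i, IndecMod Λ (V i))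
    (hVdistinct : ∀ i j, Nonempty ((V i : Type) ≃ₗ[Λ] (V j : Type)) → i = j)
    (hVall : ∀ (W : ModuleCat.{0} Λ), Module.Finite Λ W → IndecMod Λ W →
      ∃ i, Nonempty ((W : Type) ≃ₗ[Λ] (V i : Type)))
    (M : Type) [AddCommGroup M] [Module Λ M]
    (hM : Nonempty (M ≃ₗ[Λ] (⨁ i, (V i : Type))))
    -- S : a simple module over the Auslander algebra A = End_Λ(M), of projective
    -- dimension two
    (S : Type) [AddCommGroup S] [Module (Module.End Λ M) S]
    (hS : IsSimpleModule (Module.End Λ M) S)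
    (hSpd : PdEq2 (Module.End Λ M) S) :
    -- conclusion
    ∃ (S' P : ModuleCat.{0} (Module.End Λ M))
      (p : (P : Type) →ₗ[Module.End Λ M] (S' : Type)),
      IsSimpleModule (Module.End Λ M) S' ∧
      PdEq2 (Module.End Λ M) S' ∧
      -- p : P → S' is a projective cover in mod-A
      Module.Projective (Module.End Λ M) P ∧ Module.Finite (Module.End Λ M) P ∧
      Function.Surjective p ∧
      (∀ N : Submodule (Module.End Λ M) P, N ⊔ LinearMap.ker p = ⊤ → N = ⊤) ∧
      -- and an almost split sequence 0 → S → E → Ker(p) → 0 in mod-A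
      ∃ (E : ModuleCat.{0} (Module.End Λ M))
        (i : S →ₗ[Module.End Λ M] (E : Type))
        (q : (E : Type) →ₗ[Module.End Λ M] (LinearMap.ker p : Type)),
        IsAlmostSplitSeq (Module.End Λ M) i q := by
  classical
  obtain ⟨f⟩ := hM
  have : IsArtinianRing Λ := IsArtinianRing.of_finite k Λ
  have : Module.Finite Λ M := Module.Finite.equiv f.symm
  let ι : ∀ i, V i →ₗ[Λ] M := fun i ↦ f.symm.toLinearMap ∘ₗ DirectSum.lof Λ (Fin n) (fun i ↦ V i) i
  let ρ : ∀ i, M →ₗ[Λ] V i := fun i ↦ DirectSum.component Λ (Fin n) (fun i ↦ V i) i ∘ₗ f.toLinearMap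
  have hρι : ∀ i, ρ i ∘ₗ ι i = LinearMap.id := fun i ↦ by
    ext x
    simp [ι, ρ, DirectSum.component.lof_self]
  have hsum : ∑ i, (ι i ∘ₗ ρ i : Module.End Λ M) = 1 := by
    ext x
    apply f.injective
    simp only [ι, ρ, LinearMap.sum_apply, map_sum, LinearMap.comp_apply, LinearEquiv.coe_coe,
      LinearEquiv.apply_symm_apply, Module.End.one_apply]
    exact DirectSum.sum_univ_of (f x)
  have hind : ∀ (Y : Type) [AddCommGroup Y] [Module Λ Y] [Module.Finite Λ Y], IndecMod Λ Y →
      ∃ ι : Y →ₗ[Λ] M, SplitMono ι := by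
    intro Y _ _ hfin hY
    obtain ⟨j, ⟨φ⟩⟩ := hVall (ModuleCat.of Λ Y) hfin hY
    refine ⟨ι j ∘ₗ φ.toLinearMap, φ.symm.toLinearMap ∘ₗ ρ j, LinearMap.ext fun y ↦ ?_⟩
    exact (congrArg φ.symm (LinearMap.congr_fun (hρι j) (φ y))).trans (φ.symm_apply_apply y)
  have hadd := inAdd_of_finite hind
  obtain ⟨s, hs⟩ : ∃ s : S, s ≠ 0 := by
    have := IsSimpleModule.nontrivial (Module.End Λ M) S
    exact exists_ne 0
  obtain ⟨j, hj⟩ : ∃ j, (ι j ∘ₗ ρ j : Module.End Λ M) • s ≠ 0 := by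
    by_contra! h
    refine hs ?_
    rw [← one_smul (Module.End Λ M) s, ← hsum, Finset.sum_smul]
    exact Finset.sum_eq_zero fun i _ ↦ h i
  have := hVfg j
  have := (hVind j).1
  have := isLocalRing_end_of_indecMod (hVind j)
  have hι : SplitMono (ι j) := ⟨ρ j, hρι j⟩
  have he : Surjective (evalHom (ρ j) s) :=
    LinearMap.surjective_of_ne_zero fun h ↦ hj (LinearMap.congr_fun h (ι j))
  have hproj : ¬ Module.Projective Λ (V j) := fun _ ↦
    hSpd.2 (pdLE1_of_injective (injective_of_projective hself) hadd he (ker_eq_nonSplitMono hι he))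
  let _ : Module k M := Module.compHom M (algebraMap k Λ)
  let _ : Module k (V j) := Module.compHom (V j) (algebraMap k Λ)
  have : IsScalarTower k Λ M := IsScalarTower.of_algebraMap_smul fun _ _ ↦ rfl
  have : IsScalarTower k Λ (V j) := IsScalarTower.of_algebraMap_smul fun _ _ ↦ rfl
  have : Module.Finite k M := Module.Finite.trans Λ M
  have : Module.Finite k (V j) := Module.Finite.trans Λ (V j)
  have : Module.Finite k (Module.End Λ M) :=
    have := isNoetherian_of_injective (LinearMap.restrictScalarsₗ k Λ M M k)
      (LinearMap.restrictScalars_injective k)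
    inferInstanceAs (Module.Finite k (M →ₗ[Λ] M))
  have : IsArtinianRing (Module.End Λ M) := IsArtinianRing.of_finite k (Module.End Λ M)
  obtain ⟨J, _, g₀, hg₀⟩ := exists_rightAlmostSplit (X := V j) k hadd
  obtain ⟨B, g, _, hg, hmin⟩ := hg₀.exists_rightMinimal
  have hsurj := hg.surjective hproj
  have hKind := hg.indecMod_ker hmin hsurj
  have := hKind.1
  have := isLocalRing_end_of_indecMod hKind
  obtain ⟨κ, hκ⟩ := hind _ hKind
  let K := LinearMap.ker g
  let p := (nonSplitMono (Λ := Λ) M K).mkQ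
  have hpker : LinearMap.ker p = nonSplitMono M K := Submodule.ker_mkQ _
  have hsup : ∀ N, N ⊔ LinearMap.ker p = ⊤ → N = ⊤ := fun N hN ↦
    eq_top_of_sup_nonSplitMono_eq_top hκ N (hpker ▸ hN)
  have hrange : LinearMap.range (precomp M K.subtype) = LinearMap.ker p :=
    (hg.range_precomp_ker_subtype hmin hsurj).trans hpker.symm
  let c := (precomp M K.subtype).codRestrict (LinearMap.ker p) fun φ ↦ hrange ▸ ⟨φ, rfl⟩
  have hc : Surjective c := by
    rintro ⟨φ, hφ⟩
    obtain ⟨ψ, rfl⟩ := hrange.symm ▸ hφ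
    exact ⟨ψ, rfl⟩
  have hgc : Function.Exact (precomp M g) c := fun φ ↦
    Subtype.ext_iff.trans (exact_precomp hsurj φ)
  have hK := (hadd K).projective
  obtain ⟨E, i, q, hiq⟩ := hg.exists_isAlmostSplitSeq hmin hsurj (hadd B) he hι hc hgc
  refine ⟨ModuleCat.of _ ((K →ₗ[Λ] M) ⧸ nonSplitMono (Λ := Λ) M K), ModuleCat.of _ (K →ₗ[Λ] M), p,
    isSimpleModule_iff_isCoatom.mpr (isCoatom_nonSplitMono hκ), ⟨?_, ?_⟩, hK, (hadd K).finite,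
    Submodule.mkQ_surjective _, hsup, E, i, q, hiq⟩
  · exact ⟨ModuleCat.of _ (K →ₗ[Λ] M), ModuleCat.of _ (B →ₗ[Λ] M), ModuleCat.of _ (V j →ₗ[Λ] M),
      precomp M g, precomp M K.subtype, p, hK, (hadd B).projective, (hadd (V j)).projective,
      precomp_injective hsurj, exact_precomp hsurj, LinearMap.exact_iff.mpr hrange.symm,
      Submodule.mkQ_surjective _⟩
  · exact not_pdLE1_of_not_projective_ker (Submodule.mkQ_surjective _) hsup fun _ ↦
      hiq.2.2.1 (Module.projective_lifting_property q LinearMap.id hiq.1.2.1)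

end Statement16
end
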